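/- arXiv:1206.6642 — 4 statements merged into one kernel-verified Lean document; each statement's English description precedes it below -/
import Mathlib

section
/- For every nonnegative integer n, p_3(121n + 106) ≡ 0 (mod 121). -/
/-- `multipartition r n` is the number of `r`-component multipartitions of `n`,
i.e. the number of `r`-tuples of integer partitions whose sizes sum to `n`. -/
def multipartition (r n : ℕ) : ℕ :=
  ∑ c ∈ Finset.Nat.antidiagonalTuple r n, ∏ i, Fintype.card (Nat.Partition (c i))

open PowerSeries in
/-- generating series of a weighted family -/
noncomputable def MPgs {ι : Type} (e : ι → ℕ) (w : ι → ℤ) : ℤ⟦X⟧ :=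
  PowerSeries.mk fun n => ∑ᶠ i, if e i = n then w i else 0

namespace MP
open PowerSeries

abbrev LF {ι : Type} (e : ι → ℕ) : Prop := ∀ n, {i | e i = n}.Finite

lemma coeff_gs {ι : Type} (e : ι → ℕ) (w : ι → ℤ) (n : ℕ) :
    coeff n (MPgs e w) = ∑ᶠ i, if e i = n then w i else 0 := by
  simp [MPgs]

lemma coeff_gs' {ι : Type} {e : ι → ℕ} (he : LF e) (w : ι → ℤ) (n : ℕ) :
    coeff n (MPgs e w) = ∑ i ∈ (he n).toFinset, w i := by
  rw [coeff_gs]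
  rw [finsum_eq_sum_of_support_subset (s := (he n).toFinset)]
  · apply Finset.sum_congr rfl
    intro i hi
    simp at hi
    simp [hi]
  · intro i hi
    simp at hi ⊢
    exact hi.1

lemma LF.prod {ι κ : Type} {e : ι → ℕ} {e' : κ → ℕ} (he : LF e) (he' : LF e') :
    LF (fun p : ι × κ => e p.1 + e' p.2) := by
  intro n
  have h1 : (⋃ a ∈ Finset.range (n+1), {i | e i = a}).Finite :=
    Set.Finite.biUnion (Finset.finite_toSet _) (fun a _ => he a)
  have h2 : (⋃ a ∈ Finset.range (n+1), {i | e' i = a}).Finite :=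
    Set.Finite.biUnion (Finset.finite_toSet _) (fun a _ => he' a)
  refine (h1.prod h2).subset ?_
  rintro ⟨a, b⟩ h
  simp at h ⊢
  omega

lemma gs_mul {ι κ : Type} {e : ι → ℕ} {e' : κ → ℕ} (he : LF e) (he' : LF e')
    (w : ι → ℤ) (w' : κ → ℤ) :
    MPgs e w * MPgs e' w' =
      MPgs (fun p : ι × κ => e p.1 + e' p.2) (fun p => w p.1 * w' p.2) := by
  classical
  ext n
  rw [coeff_mul, coeff_gs' (he.prod he')]
  simp_rw [coeff_gs' he, coeff_gs' he', Finset.sum_mul_sum, ← Finset.sum_product']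
  rw [Finset.sum_sigma']
  refine Finset.sum_bij' (fun x _ => x.2) (fun p _ => ⟨(e p.1, e' p.2), p⟩) ?_ ?_ ?_ ?_ ?_
  · rintro ⟨⟨a, b⟩, p⟩ h
    simp at h ⊢
    omega
  · rintro p h
    simp at h ⊢
    exact h
  · rintro ⟨⟨a, b⟩, p⟩ h
    simp at h ⊢
    simp [h]
  · simp
  · simp

lemma gs_equiv {ι κ : Type} (σ : ι ≃ κ) (e : κ → ℕ) (w : κ → ℤ) :
    MPgs (fun i => e (σ i)) (fun i => w (σ i)) = MPgs e w := by
  ext n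
  rw [coeff_gs, coeff_gs]
  exact finsum_comp_equiv σ (f := fun i => if e i = n then w i else 0)

lemma gs_inj {ι κ : Type} (φ : ι → κ) (hφ : Function.Injective φ) (e : κ → ℕ) (w : κ → ℤ)
    (hw : ∀ k, k ∉ Set.range φ → w k = 0) :
    MPgs (fun i => e (φ i)) (fun i => w (φ i)) = MPgs e w := by
  ext n
  rw [coeff_gs, coeff_gs, ← finsum_mem_range (f := fun i => if e i = n then w i else 0) hφ,
    ← finsum_mem_univ (fun i => if e i = n then w i else 0)]
  apply finsum_mem_inter_support_eq
  ext k
  simp only [Set.mem_inter_iff, Function.mem_support, Set.mem_univ, true_and]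
  constructor
  · exact fun h => h.2
  · intro h
    refine ⟨?_, h⟩
    by_contra hk
    simp [hw k hk] at h

lemma gs_add {ι : Type} {e : ι → ℕ} (he : LF e) (w w' : ι → ℤ) :
    MPgs e (fun i => w i + w' i) = MPgs e w + MPgs e w' := by
  ext n
  simp [coeff_gs' he, Finset.sum_add_distrib]

lemma gs_smul {ι : Type} {e : ι → ℕ} (he : LF e) (c : ℤ) (w : ι → ℤ) :
    MPgs e (fun i => c * w i) = (c : ℤ⟦X⟧) * MPgs e w := by
  ext n
  rw [show (c : ℤ⟦X⟧) = C c by simp, coeff_C_mul]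
  simp only [coeff_gs' he, Finset.mul_sum]

lemma gs_neg {ι : Type} {e : ι → ℕ} (he : LF e) (w : ι → ℤ) :
    MPgs e (fun i => - w i) = - MPgs e w := by
  ext n
  simp [coeff_gs' he]

lemma gs_invol {ι : Type} {e : ι → ℕ} (he : LF e) (w : ι → ℤ) (σ : ι ≃ ι)
    (h1 : ∀ i, e (σ i) = e i) (h2 : ∀ i, w (σ i) = - w i) : MPgs e w = 0 := by
  have := gs_equiv σ e w
  simp_rw [h1, h2] at this
  rw [gs_neg he] at this
  ext n
  have := congrArg (coeff n) this
  simp at this ⊢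
  omega

/-- the Euler operator -/
noncomputable def θ (R : Type) [CommRing R] : Derivation R R⟦X⟧ R⟦X⟧ :=
  (X : R⟦X⟧) • PowerSeries.derivative R

lemma coeff_θ {R : Type} [CommRing R] (f : R⟦X⟧) (n : ℕ) :
    coeff n (θ R f) = n * coeff n f := by
  have : θ R f = X * PowerSeries.derivative R f := rfl
  rw [this]
  cases n with
  | zero => simp
  | succ n => rw [coeff_succ_X_mul, coeff_derivative]; push_cast; ring

lemma gs_D {ι : Type} {e : ι → ℕ} (he : LF e) (w : ι → ℤ) (c : ℤ) (x : ι → ℤ)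
    (hx : ∀ i, c * e i + 1 = x i) :
    (c : ℤ⟦X⟧) * θ ℤ (MPgs e w) + MPgs e w = MPgs e (fun i => x i * w i) := by
  ext n
  rw [show (c : ℤ⟦X⟧) = C c by simp]
  simp only [map_add, coeff_C_mul, coeff_θ, coeff_gs' he, Finset.mul_sum]
  rw [← Finset.sum_add_distrib]
  apply Finset.sum_congr rfl
  intro i hi
  simp at hi
  rw [← hx i, hi]; ring

end MP
namespace MP
open PowerSeries

lemma LF_of_inj {ι : Type} {e : ι → ℕ} (h : Function.Injective e) : LF e := by
  intro n
  apply Set.Subsingleton.finite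
  intro a ha b hb
  exact h (by simp at ha hb; rw [ha, hb])

def sg (m : ℤ) : ℤ := if Even m then 1 else -1

def eE (m : ℤ) : ℕ := pentagonal (-m)
def eY (k : ℤ) : ℕ := (k * (2 * k + 1)).toNat

lemma eE_spec (m : ℤ) : 24 * (eE m : ℤ) + 1 = (6 * m + 1) ^ 2 := by
  have := two_mul_natCast_pentagonal_neg m
  unfold eE
  linear_combination 12 * this

lemma eY_spec (k : ℤ) : 8 * (eY k : ℤ) + 1 = (4 * k + 1) ^ 2 := by
  unfold eY
  rw [Int.toNat_of_nonneg]
  · ring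
  · rcases le_or_gt 0 k with h | h
    · positivity
    · nlinarith

lemma eE_LF : LF eE := LF_of_inj (fun a b h => by
  have := pentagonal_injective h
  omega)

lemma eY_LF : LF eY := LF_of_inj (fun a b h => by
  have h1 := eY_spec a
  rw [h, eY_spec b] at h1
  rcases sq_eq_sq_iff_eq_or_eq_neg.mp h1 with h | h <;> omega)

noncomputable def E : ℤ⟦X⟧ := MPgs eE sg
noncomputable def Y : ℤ⟦X⟧ := MPgs eY (fun k => 4 * k + 1)

lemma E_eq : E = pentagonalSeries ℤ := by
  ext n
  unfold E
  rw [coeff_gs' eE_LF]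
  by_cases h : ∃ k, pentagonal k = n
  · obtain ⟨k, rfl⟩ := h
    rw [coeff_pentagonalSeries_pentagonal, Finset.sum_eq_single (-k)]
    · unfold sg
      by_cases hk : Even k
      · simp [hk, Int.negOnePow_even k hk]
      · have hk' : Odd k := Int.not_even_iff_odd.mp hk
        simp [hk, Int.negOnePow_odd k hk']
    · intro b hb hb'
      simp [eE] at hb
      omega
    · intro h
      simp [eE] at h
  · rw [coeff_pentagonalSeries_eq_zero ℤ (by simpa using h)]
    apply Finset.sum_eq_zero
    intro i hi
    simp [eE] at hi
    exact absurd ⟨_, hi⟩ h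

noncomputable def F : ℤ⟦X⟧ := PowerSeries.mk fun n => (Fintype.card (Nat.Partition n) : ℤ)

open scoped PowerSeries.WithPiTopology in
lemma F_mul_E : F * E = 1 := by
  let : TopologicalSpace ℤ := ⊥
  have : DiscreteTopology ℤ := ⟨rfl⟩
  have h1 := Nat.Partition.hasProd_genFun (R := ℤ) (fun _ _ => 1)
  have h2 := WithPiTopology.hasProd_one_sub_X_pow ℤ
  have hF : Nat.Partition.genFun (R := ℤ) (fun _ _ => 1) = F := by
    ext n
    rw [Nat.Partition.coeff_genFun]
    simp [F, Finsupp.prod]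
  rw [hF] at h1
  simp only [PowerSeries.smul_eq_C_mul, map_one, one_mul] at h1
  rw [← E_eq] at h2
  have h3 := h1.mul h2
  refine h3.unique ?_
  convert hasProd_one with i
  have hs : Summable fun j : ℕ => (1 : ℤ) • (X : ℤ⟦X⟧) ^ ((i + 1) * (j + 1)) :=
    Nat.Partition.summable_genFun_term (R := ℤ) (fun _ _ => 1) i
  have h4 : (∑' j : ℕ, (1 : ℤ) • (X : ℤ⟦X⟧) ^ ((i + 1) * (j + 1))) = PowerSeries.mk
      (fun n => if n ≠ 0 ∧ (i+1) ∣ n then 1 else 0) := by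
    ext n
    rw [hs.map_tsum _ (WithPiTopology.continuous_coeff _ _)]
    simp only [coeff_mk, one_smul, coeff_X_pow]
    split_ifs with h
    · obtain ⟨h0, d, rfl⟩ := h
      rw [tsum_eq_single (d - 1)]
      · have : d ≠ 0 := by rintro rfl; simp at h0
        rw [Nat.sub_add_cancel (by omega)]; simp
      · intro b hb
        have : d ≠ b + 1 := by omega
        simp [this]
    · convert tsum_zero with b
      rw [if_neg]
      rintro rfl
      apply h
      simp
  simp only [one_smul] at h4
  rw [h4]
  ext n
  rw [mul_sub, mul_one, map_sub, coeff_mul_X_pow']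
  simp only [map_add, coeff_mk, coeff_one]
  rcases Nat.eq_zero_or_pos n with h0 | h0
  · subst h0; simp
  · by_cases h5 : i + 1 ≤ n
    · have e1 : (i+1) ∣ n - (i+1) ↔ (i+1) ∣ n := by
        rw [Nat.dvd_sub_iff_left h5 (dvd_refl _)]
      by_cases h6 : n = i + 1
      · subst h6; simp
      · have : n - (i+1) ≠ 0 := by omega
        have : n ≠ 0 := by omega
        simp [*]
    · have : ¬ (i+1) ∣ n := fun h => h5 (Nat.le_of_dvd h0 h)
      have h7 : n ≠ 0 := by omega
      simp [h5, this, h7]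

lemma multi_eq (n : ℕ) : (multipartition 3 n : ℤ) = coeff n (F ^ 3) := by
  have : F ^ 3 = ∏ _i : Fin 3, F := by simp
  rw [this]
  unfold multipartition
  rw [← Finset.piAntidiag_univ_fin_eq_antidiagonalTuple, coeff_prod]
  push_cast
  rw [Finset.finsuppAntidiag, Finset.sum_map]
  simp only [F, coeff_mk]
  exact (Finset.sum_attach _ (fun x : Fin 3 → ℕ => ∏ i, (Fintype.card (Nat.Partition (x i)) : ℤ))).symm

end MP
namespace MP
open PowerSeries

abbrev e2 (q : ℤ × ℤ) : ℕ := eE q.1 + eY q.2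

lemma e2_LF : LF e2 := eE_LF.prod eY_LF

lemma e2_spec (q : ℤ × ℤ) : 24 * (e2 q : ℤ) + 4 = (6 * q.1 + 1) ^ 2 + 3 * (4 * q.2 + 1) ^ 2 := by
  have h1 := eE_spec q.1
  have h2 := eY_spec q.2
  push_cast [e2]
  linarith

def psi : ℤ × ℤ ≃ ℤ × ℤ where
  toFun q := (q.1, if Even q.1 then 3 * (q.1 / 2) - q.2 else q.2 - 3 * (q.1 / 2) - 2)
  invFun q := (q.1, if Even q.1 then 3 * (q.1 / 2) - q.2 else q.2 + 3 * (q.1 / 2) + 2)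
  left_inv q := by ext <;> simp; split_ifs <;> ring
  right_inv q := by ext <;> simp; split_ifs <;> ring

def hexI : ℤ × ℤ ≃ ℤ × ℤ where
  toFun q := (q.1 - q.2, - q.2)
  invFun q := (q.1 - q.2, - q.2)
  left_inv q := by ext <;> simp
  right_inv q := by ext <;> simp

lemma psi_y (m j : ℤ) : 4 * (psi (m, j)).2 + 1 = - sg m * (4 * j - 6 * m - 1) := by
  unfold psi sg
  by_cases h : Even m
  · simp only [Equiv.coe_fn_mk, h, if_true]
    obtain ⟨a, rfl⟩ := h
    have : (a + a) / 2 = a := by omega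
    rw [this]; ring
  · simp only [Equiv.coe_fn_mk, h, if_false]
    obtain ⟨a, rfl⟩ := Int.not_even_iff_odd.mp h
    have : (2 * a + 1) / 2 = a := by omega
    rw [this]; ring

lemma sg_cases (m : ℤ) : sg m = 1 ∨ sg m = -1 := by
  unfold sg; split_ifs <;> simp

lemma hex (p : ℤ → ℤ → ℤ) (hodd : ∀ x y, p x (-y) = - p x y)
    (hinv : ∀ m j, p (6 * (m - j) + 1) (2 * j - 6 * m - 1) = - p (6 * m + 1) (4 * j - 6 * m - 1)) :
    MPgs e2 (fun q => sg q.1 * p (6 * q.1 + 1) (4 * q.2 + 1)) = 0 := by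
  have key : ∀ m j, sg m * p (6 * m + 1) (4 * (psi (m, j)).2 + 1)
      = - p (6 * m + 1) (4 * j - 6 * m - 1) := by
    intro m j
    rw [psi_y]
    rcases sg_cases m with h | h <;> rw [h]
    · rw [show -1 * (4 * j - 6 * m - 1) = -(4 * j - 6 * m - 1) by ring, hodd]; ring
    · rw [show - -1 * (4 * j - 6 * m - 1) = (4 * j - 6 * m - 1) by ring]; ring
  have f1 : ∀ q, (psi q).1 = q.1 := fun q => rfl
  have ysq : ∀ m j, (4 * (psi (m, j)).2 + 1) ^ 2 = (4 * j - 6 * m - 1) ^ 2 := by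
    intro m j
    rw [psi_y]
    rcases sg_cases m with h | h <;> rw [h] <;> ring
  refine gs_invol e2_LF _ ((psi.symm.trans hexI).trans psi) ?_ ?_
  · intro i
    obtain ⟨⟨m, j⟩, rfl⟩ := psi.surjective i
    have h1 := e2_spec (psi (m, j))
    have h2 := e2_spec (psi (m - j, -j))
    rw [ysq, f1] at h1 h2
    have : ((psi.symm.trans hexI).trans psi) (psi (m, j)) = psi (m - j, -j) := by
      simp [hexI]
    rw [this]
    simp only at h1 h2
    have : (24 : ℤ) * (e2 (psi (m - j, -j)) : ℤ) = 24 * (e2 (psi (m, j)) : ℤ) := by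
      linear_combination h2 - h1
    omega
  · intro i
    obtain ⟨⟨m, j⟩, rfl⟩ := psi.surjective i
    have : ((psi.symm.trans hexI).trans psi) (psi (m, j)) = psi (m - j, -j) := by
      simp [hexI]
    rw [this]
    simp only [f1]
    rw [key, key, show 4 * -j - 6 * (m - j) - 1 = 2 * j - 6 * m - 1 by ring, hinv]

noncomputable def EE (i : ℕ) : ℤ⟦X⟧ := MPgs eE (fun m => ((6 * m + 1) ^ 2) ^ i * sg m)
noncomputable def YY (i : ℕ) : ℤ⟦X⟧ := MPgs eY (fun k => ((4 * k + 1) ^ 2) ^ i * (4 * k + 1))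

lemma EE_zero : EE 0 = E := by simp [EE, E]
lemma YY_zero : YY 0 = Y := by simp [YY, Y]

lemma EE_succ (i : ℕ) : EE (i+1) = 24 * θ ℤ (EE i) + EE i := by
  have := gs_D eE_LF (fun m => ((6 * m + 1) ^ 2) ^ i * sg m) 24 (fun m => (6 * m + 1) ^ 2) eE_spec
  push_cast at this
  unfold EE
  rw [this]
  congr 1; ext m; ring

lemma YY_succ (i : ℕ) : YY (i+1) = 8 * θ ℤ (YY i) + YY i := by
  have := gs_D eY_LF (fun k => ((4 * k + 1) ^ 2) ^ i * (4 * k + 1)) 8 (fun m => (4 * m + 1) ^ 2)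
    eY_spec
  push_cast at this
  unfold YY
  rw [this]
  congr 1; ext m; ring

lemma EY (i j : ℕ) : EE i * YY j = MPgs e2 (fun q => sg q.1 * ((6 * q.1 + 1) ^ (2 * i) *
    (4 * q.2 + 1) ^ (2 * j + 1))) := by
  unfold EE YY
  rw [gs_mul eE_LF eY_LF]
  congr 1; ext q; rw [pow_mul, pow_succ (4 * q.2 + 1) (2 * j), pow_mul]; ring

lemma rel3 : EE 1 * YY 0 - EE 0 * YY 1 = 0 := by
  have := hex (fun x y => x ^ 2 * y - y ^ 3) (by intros; ring) (by intros; ring)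
  rw [← this, EY, EY, sub_eq_add_neg, ← gs_neg e2_LF, ← gs_add e2_LF]
  congr 1; ext q; ring

lemma rel9 : EE 4 * YY 0 - 28 * (EE 3 * YY 1) + 126 * (EE 2 * YY 2) - 108 * (EE 1 * YY 3)
    + 9 * (EE 0 * YY 4) = 0 := by
  have := hex (fun x y => x ^ 8 * y - 28 * x ^ 6 * y ^ 3 + 126 * x ^ 4 * y ^ 5
    - 108 * x ^ 2 * y ^ 7 + 9 * y ^ 9) (by intros; ring) (by intros; ring)
  have s := @gs_smul _ _ e2_LF
  have s1 := s (-28)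
  have s2 := s 126
  have s3 := s (-108)
  have s4 := s 9
  push_cast at s1 s2 s3 s4
  rw [← this, sub_eq_add_neg, sub_eq_add_neg, ← neg_mul, ← neg_mul, EY, EY, EY, EY, EY,
    ← s1, ← s2, ← s3, ← s4, ← gs_add e2_LF, ← gs_add e2_LF, ← gs_add e2_LF, ← gs_add e2_LF]
  congr 1; ext q; ring

noncomputable def L : ℤ⟦X⟧ := F * θ ℤ E
noncomputable def P : ℤ⟦X⟧ := 1 + 24 * L

lemma E_unit : IsUnit E := IsUnit.of_mul_eq_one F (by rw [mul_comm]; exact F_mul_E)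

lemma θE : θ ℤ E = E * L := by
  unfold L
  linear_combination (-θ ℤ E) * F_mul_E

lemma θnum (R : Type) [CommRing R] (n : ℕ) : θ R (n : R⟦X⟧) = 0 := by
  simp
lemma θofnat (R : Type) [CommRing R] (n : ℕ) [n.AtLeastTwo] : θ R (ofNat(n) : R⟦X⟧) = 0 :=
  θnum R n

lemma num_ne (n : ℕ) [n.AtLeastTwo] : (ofNat(n) : ℤ⟦X⟧) ≠ 0 := by
  intro h
  have := congrArg (coeff 0) h
  have h2 : ((n : ℤ⟦X⟧)) = C (n : ℤ) := by simp
  rw [show (ofNat(n) : ℤ⟦X⟧) = (n : ℤ⟦X⟧) from rfl, h2] at this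
  simp at this
  have := Nat.AtLeastTwo.prop (n := n)
  omega

lemma Y_eq : Y = E ^ 3 := by
  have h := rel3
  rw [EE_succ, YY_succ, EE_zero, YY_zero, θE] at h
  have h1 : θ ℤ Y = 3 * L * Y := by
    have : E * (8 * θ ℤ Y) = E * (8 * (3 * L * Y)) := by linear_combination -h
    have := E_unit.mul_left_cancel this
    exact mul_left_cancel₀ (num_ne _) this
  -- r = Y F^3
  have hF : θ ℤ F = - L * F := by
    have h2 : θ ℤ (F * E) = 0 := by rw [F_mul_E]; simp
    rw [Derivation.leibniz, θE, smul_eq_mul, smul_eq_mul] at h2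
    apply E_unit.mul_left_cancel
    linear_combination h2
  have h3 : θ ℤ (Y * F ^ 3) = 0 := by
    rw [Derivation.leibniz, Derivation.leibniz_pow, h1, hF]
    simp only [smul_eq_mul, nsmul_eq_mul]
    push_cast
    ring
  have h4 : Y * F ^ 3 = C (coeff 0 (Y * F ^ 3)) := by
    ext n
    rcases Nat.eq_zero_or_pos n with h0 | h0
    · subst h0; simp
    · have := congrArg (coeff n) h3
      rw [coeff_θ] at this
      rw [coeff_C, if_neg (by omega)]
      simp at this
      rcases this with h | h
      · omega
      · exact h
  have h5 : coeff 0 (Y * F ^ 3) = 1 := by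
    have a1 : coeff 0 F = 1 := by simp [F]
    have a2 : coeff 0 Y = 1 := by
      unfold Y
      rw [coeff_gs' eY_LF, Finset.sum_eq_single 0]
      · simp
      · intro b hb hb0
        simp at hb
        have := eY_spec b
        rw [hb] at this
        rcases sq_eq_sq_iff_eq_or_eq_neg.mp (show (4 * b + 1) ^ 2 = 1 ^ 2 by rw [← this]; simp)
          with h | h <;> omega
      · simp [eY]
    simp at a1 a2
    simp [a1, a2]
  rw [h5] at h4
  have : Y = (Y * F ^ 3) * E ^ 3 := by
    linear_combination (-Y * (1 + F * E + F ^ 2 * E ^ 2)) * F_mul_E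
  rw [this, h4]; simp

noncomputable def Q : ℤ⟦X⟧ := P ^ 2 - 12 * θ ℤ P
noncomputable def R : ℤ⟦X⟧ := P * Q - 3 * θ ℤ Q

lemma θL : θ ℤ P = 24 * θ ℤ L := by
  unfold P
  simp [Derivation.leibniz, θofnat]

lemma EEstep (A : ℤ⟦X⟧) : 24 * θ ℤ (E * A) + E * A = E * (24 * θ ℤ A + P * A) := by
  rw [Derivation.leibniz, θE]; simp only [smul_eq_mul, P]; ring

lemma YYstep (A : ℤ⟦X⟧) : 8 * θ ℤ (E ^ 3 * A) + E ^ 3 * A = E ^ 3 * (8 * θ ℤ A + P * A) := by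
  rw [Derivation.leibniz, Derivation.leibniz_pow, θE]
  simp only [smul_eq_mul, P, nsmul_eq_mul]; push_cast; ring

lemma chazy0 : 2 * θ ℤ (θ ℤ (θ ℤ P)) - 2 * P * θ ℤ (θ ℤ P) + 3 * (θ ℤ P) ^ 2 = 0 := by
  have h := rel9
  have e0 : EE 0 = E * 1 := by rw [EE_zero]; ring
  have e1 : EE 1 = E * P := by rw [EE_succ, e0, EEstep]; simp
  have e2 : EE 2 = E * (24 * θ ℤ P + P ^ 2) := by rw [EE_succ, e1, EEstep]; ring
  have e3 : EE 3 = E * (576 * θ ℤ (θ ℤ P) + 72 * P * θ ℤ P + P ^ 3) := by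
    rw [EE_succ, e2, EEstep]
    simp only [Derivation.leibniz, Derivation.leibniz_pow, θofnat, map_add, map_sub,
      smul_eq_mul, nsmul_eq_mul]
    push_cast; ring
  have e4 : EE 4 = E * (13824 * θ ℤ (θ ℤ (θ ℤ P)) + 2304 * P * θ ℤ (θ ℤ P) +
      1728 * (θ ℤ P) ^ 2 + 144 * P ^ 2 * θ ℤ P + P ^ 4) := by
    rw [EE_succ, e3, EEstep]
    simp only [Derivation.leibniz, Derivation.leibniz_pow, θofnat, map_add, map_sub,
      smul_eq_mul, nsmul_eq_mul]
    push_cast; ring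
  have y0 : YY 0 = E ^ 3 * 1 := by rw [YY_zero, Y_eq]; ring
  have y1 : YY 1 = E ^ 3 * P := by rw [YY_succ, y0, YYstep]; simp
  have y2 : YY 2 = E ^ 3 * (8 * θ ℤ P + P ^ 2) := by rw [YY_succ, y1, YYstep]; ring
  have y3 : YY 3 = E ^ 3 * (64 * θ ℤ (θ ℤ P) + 24 * P * θ ℤ P + P ^ 3) := by
    rw [YY_succ, y2, YYstep]
    simp only [Derivation.leibniz, Derivation.leibniz_pow, θofnat, map_add, map_sub,
      smul_eq_mul, nsmul_eq_mul]
    push_cast; ring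
  have y4 : YY 4 = E ^ 3 * (512 * θ ℤ (θ ℤ (θ ℤ P)) + 256 * P * θ ℤ (θ ℤ P) +
      192 * (θ ℤ P) ^ 2 + 48 * P ^ 2 * θ ℤ P + P ^ 4) := by
    rw [YY_succ, y3, YYstep]
    simp only [Derivation.leibniz, Derivation.leibniz_pow, θofnat, map_add, map_sub,
      smul_eq_mul, nsmul_eq_mul]
    push_cast; ring
  rw [e0, e1, e2, e3, e4, y0, y1, y2, y3, y4] at h
  have h' : E ^ 4 * (9216 * (2 * θ ℤ (θ ℤ (θ ℤ P)) - 2 * P * θ ℤ (θ ℤ P) + 3 * (θ ℤ P) ^ 2))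
     = E ^ 4 * (9216 * 0) := by
    linear_combination h
  have := (E_unit.pow 4).mul_left_cancel h'
  exact mul_left_cancel₀ (num_ne _) this

lemma ram1 : 12 * θ ℤ P = P ^ 2 - Q := by unfold Q; ring
lemma ram2 : 3 * θ ℤ Q = P * Q - R := by unfold R; ring
lemma ram3 : 2 * θ ℤ R = P * R - Q ^ 2 := by
  have hq : θ ℤ Q = 2 * P * θ ℤ P - 12 * θ ℤ (θ ℤ P) := by
    unfold Q
    simp only [Derivation.leibniz, Derivation.leibniz_pow, θofnat, map_add, map_sub,
      smul_eq_mul, nsmul_eq_mul]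
    push_cast; ring
  have hR : R = P ^ 3 - 18 * P * θ ℤ P + 36 * θ ℤ (θ ℤ P) := by
    unfold R; rw [hq]; unfold Q; ring
  rw [hR]
  simp only [Derivation.leibniz, Derivation.leibniz_pow, θofnat, map_add, map_sub, smul_eq_mul, nsmul_eq_mul]
  push_cast
  unfold Q
  linear_combination 36 * chazy0

end MP

namespace MP
open PowerSeries

lemma sg_add (a b : ℤ) : sg (a + b) = sg a * sg b := by
  unfold sg
  by_cases ha : Even a <;> by_cases hb : Even b <;> simp [Int.even_add, ha, hb]

lemma sg_sq (a : ℤ) : sg a * sg a = 1 := by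
  rcases sg_cases a with h | h <;> rw [h] <;> ring

lemma sg_one : sg 1 = -1 := by
  unfold sg; simp

lemma sg_neg (a : ℤ) : sg (-a) = sg a := by
  unfold sg; simp

lemma sg_refl (a : ℤ) : sg (-1 - a) = - sg a := by
  rw [sub_eq_add_neg, sg_add, sg_neg, sg_neg, sg_one]; ring

def eT (k : ℤ) : ℕ := (k * (k + 1) / 2).toNat

lemma eT_spec (k : ℤ) : 8 * (eT k : ℤ) + 1 = (2 * k + 1) ^ 2 := by
  unfold eT
  obtain ⟨a, ha⟩ := Int.even_mul_succ_self k
  have h0 : 0 ≤ k * (k + 1) := by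
    rcases le_or_gt 0 k with h | h
    · positivity
    · nlinarith
  rw [Int.toNat_of_nonneg (by omega)]
  have : k * (k + 1) / 2 = a := by omega
  rw [this]
  linear_combination -4 * ha

lemma eT_LF : LF eT := by
  intro n
  refine (Set.finite_Icc (-(8 * n + 1) : ℤ) (8 * n + 1)).subset ?_
  intro k hk
  have h := eT_spec k
  simp only [Set.mem_ofPred_eq] at hk
  rw [hk] at h
  constructor <;> nlinarith

lemma eT_eq (k : ℤ) (a : ℕ) (h : 8 * (a : ℤ) + 1 = (2 * k + 1) ^ 2) : eT k = a := by
  have := eT_spec k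
  omega

noncomputable def M (i : ℕ) : ℤ⟦X⟧ := MPgs eT (fun k => sg k * (2 * k + 1) ^ i)

def rfl1 : ℤ ≃ ℤ where
  toFun k := -1 - k
  invFun k := -1 - k
  left_inv k := by ring
  right_inv k := by ring

lemma eT_refl (k : ℤ) : eT (-1 - k) = eT k := by
  apply eT_eq
  rw [eT_spec]; ring

lemma M_even (i : ℕ) (hi : Even i) : M i = 0 := by
  refine gs_invol eT_LF _ rfl1 (fun k => eT_refl k) ?_
  intro k
  simp only [rfl1, Equiv.coe_fn_mk, sg_refl]
  rw [show 2 * (-1 - k) + 1 = - (2 * k + 1) by ring, hi.neg_pow]; ring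

lemma M_one : M 1 = 2 * E ^ 3 := by
  have h1 : MPgs eT (fun k => if Even k then sg k * (2 * k + 1) else 0) = Y := by
    rw [← gs_inj (fun k : ℤ => 2 * k) (fun a b h => by simpa using h)]
    · unfold Y
      congr 1
      · ext k; apply eT_eq; rw [eY_spec]; ring
      · ext k; simp [sg]; ring
    · intro k hk
      rw [if_neg]
      rintro ⟨a, rfl⟩
      exact hk ⟨a, by simp; ring⟩
  have h2 : MPgs eT (fun k => if Even k then 0 else sg k * (2 * k + 1)) = Y := by
    rw [← gs_inj (fun k : ℤ => -1 - 2 * k) (fun a b h => by simpa using h)]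
    · unfold Y
      congr 1
      · ext k; apply eT_eq; rw [eY_spec]; ring
      · ext k
        have : ¬ Even (-1 - 2 * k) := by
          rw [Int.not_even_iff_odd]; exact ⟨-1 - k, by ring⟩
        simp only [if_neg this]
        simp only [sg, if_neg this]; ring
    · intro k hk
      by_cases h : Even k
      · rw [if_pos h]
      · exfalso
        obtain ⟨a, rfl⟩ := Int.not_even_iff_odd.mp h
        exact hk ⟨-1 - a, by simp; ring⟩
  rw [← Y_eq, two_mul]
  nth_rewrite 1 [← h1]
  rw [← h2, ← gs_add eT_LF]
  unfold M
  congr 1; ext k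
  split_ifs <;> ring

abbrev e3 (q : ℤ × ℤ × ℤ) : ℕ := eT q.1 + (eT q.2.1 + eT q.2.2)
lemma e3_LF : LF e3 := eT_LF.prod (eT_LF.prod eT_LF)

lemma e3_spec (q : ℤ × ℤ × ℤ) : 8 * (e3 q : ℤ) + 3 =
    (2 * q.1 + 1) ^ 2 + (2 * q.2.1 + 1) ^ 2 + (2 * q.2.2 + 1) ^ 2 := by
  have h1 := eT_spec q.1
  have h2 := eT_spec q.2.1
  have h3 := eT_spec q.2.2
  push_cast [e3]
  linarith

lemma MMM (a b c : ℕ) : M a * (M b * M c) = MPgs e3 (fun q => sg (q.1 + q.2.1 + q.2.2) *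
    ((2 * q.1 + 1) ^ a * (2 * q.2.1 + 1) ^ b * (2 * q.2.2 + 1) ^ c)) := by
  unfold M
  rw [gs_mul eT_LF eT_LF, gs_mul eT_LF (eT_LF.prod eT_LF)]
  congr 1; ext q; rw [sg_add, sg_add]; ring

def w3 (q : ℤ × ℤ × ℤ) : ℤ := sg (q.1 + q.2.1 + q.2.2) *
  ((4 * q.1 - 2 * q.2.1 - 2 * q.2.2) * (4 * q.2.1 - 2 * q.1 - 2 * q.2.2) *
    (4 * q.2.2 - 2 * q.1 - 2 * q.2.1))

lemma w3_sum : MPgs e3 w3 = 96 * E ^ 9 := by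
  have s := @gs_smul _ _ e3_LF
  have s1 := s 12
  have s2 := s (-3)
  have s3 := s 2
  push_cast at s1 s2 s3
  have : MPgs e3 w3 = 12 * (M 1 * (M 1 * M 1)) + (-3) * (M 2 * (M 1 * M 0)) +
      (-3) * (M 2 * (M 0 * M 1)) + (-3) * (M 1 * (M 2 * M 0)) + (-3) * (M 1 * (M 0 * M 2)) +
      (-3) * (M 0 * (M 1 * M 2)) + (-3) * (M 0 * (M 2 * M 1)) + 2 * (M 3 * (M 0 * M 0))
      + 2 * (M 0 * (M 3 * M 0)) + 2 * (M 0 * (M 0 * M 3)) := by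
    simp only [MMM, ← s1, ← s2, ← s3, ← gs_add e3_LF]
    congr 1; ext q; unfold w3; ring
  rw [this, M_one, M_even 0 (by decide), M_even 2 (by decide)]
  ring

def eG (l : ℤ × ℤ) : ℕ := (l.1 ^ 2 + l.1 * l.2 + l.2 ^ 2 + l.1 + l.2).toNat

lemma eG_spec (l : ℤ × ℤ) : (eG l : ℤ) = l.1 ^ 2 + l.1 * l.2 + l.2 ^ 2 + l.1 + l.2 := by
  unfold eG
  rw [Int.toNat_of_nonneg]
  obtain ⟨a, b⟩ := l
  simp only
  have h : 0 ≤ (2 * (3 * a + 1) + (3 * b + 1)) ^ 2 + 3 * (3 * b + 1) ^ 2 := by positivity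
  have : (2 * (3 * a + 1) + (3 * b + 1)) ^ 2 + 3 * (3 * b + 1) ^ 2
    = 36 * (a ^ 2 + a * b + b ^ 2 + a + b) + 12 := by ring
  omega

lemma eG_LF : LF eG := by
  intro n
  refine ((Set.finite_Icc (-(12 * n + 4) : ℤ) (12 * n + 4)).prod
    (Set.finite_Icc (-(12 * n + 4) : ℤ) (12 * n + 4))).subset ?_
  rintro ⟨a, b⟩ hk
  have h := eG_spec (a, b)
  simp only [Set.mem_ofPred_eq] at hk
  rw [hk] at h
  simp only at h
  have hb : 3 * (3 * b + 1) ^ 2 ≤ 36 * n + 12 := by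
    nlinarith [sq_nonneg (2 * (3 * a + 1) + (3 * b + 1))]
  have ha : 3 * (3 * a + 1) ^ 2 ≤ 36 * n + 12 := by
    nlinarith [sq_nonneg (2 * (3 * b + 1) + (3 * a + 1))]
  refine ⟨⟨?_, ?_⟩, ⟨?_, ?_⟩⟩ <;> simp only <;> nlinarith

noncomputable def G : ℤ⟦X⟧ := MPgs eG (fun l => (3 * l.1 + 1) * (3 * l.2 + 1) *
  (-(3 * l.1 + 1) - (3 * l.2 + 1)))

lemma class2 : MPgs e3 (fun q => if (q.1 + q.2.1 + q.2.2) % 3 = 2 then w3 q else 0)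
    = -8 * (E * G) := by
  rw [← gs_inj (fun p : ℤ × (ℤ × ℤ) => (p.1 + p.2.1, p.1 + p.2.2, p.1 - 1 - p.2.1 - p.2.2))]
  · have s := gs_smul (eE_LF.prod eG_LF) (-8)
    push_cast at s
    unfold E G
    rw [gs_mul eE_LF eG_LF, ← s]
    congr 1
    · ext ⟨t, a, b⟩
      have h1 := e3_spec (t + a, t + b, t - 1 - a - b)
      have h2 := eE_spec t
      have h3 := eG_spec (a, b)
      simp only at h1 h2 h3 ⊢
      have : (24 : ℤ) * (e3 (t + a, t + b, t - 1 - a - b) : ℤ)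
        = 24 * ((eE t : ℤ) + (eG (a, b) : ℤ)) := by
        linear_combination 3 * h1 - h2 - 24 * h3
      omega
    · ext ⟨t, a, b⟩
      simp only
      rw [if_pos (by omega)]
      unfold w3
      simp only
      rw [show t + a + (t + b) + (t - 1 - a - b) = t + (t + (-1 - -t)) by ring, sg_add, sg_add,
        sg_refl, sg_neg]
      linear_combination ((- sg t) *
        ((4 * (t + a) - 2 * (t + b) - 2 * (t - 1 - a - b)) *
          (4 * (t + b) - 2 * (t + a) - 2 * (t - 1 - a - b)) *
        (4 * (t - 1 - a - b) - 2 * (t + a) - 2 * (t + b)))) * sg_sq t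
  · rintro ⟨t, a, b⟩ ⟨t', a', b'⟩ h
    simp only [Prod.mk.injEq] at h ⊢
    omega
  · rintro ⟨a, b, c⟩ h
    simp only
    rw [if_neg]
    intro h2
    apply h
    refine ⟨((a + b + c + 1) / 3, (a - (a + b + c + 1) / 3, b - (a + b + c + 1) / 3)), ?_⟩
    simp only [Prod.mk.injEq]
    omega

lemma class0 : MPgs e3 (fun q => if (q.1 + q.2.1 + q.2.2) % 3 = 0 then w3 q else 0) = 0 := by
  have hinj : Function.Injective (fun p : ℤ × (ℤ × ℤ) =>
      (p.1 + p.2.1, p.1 + p.2.2, p.1 - p.2.1 - p.2.2)) := by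
    rintro ⟨t, a, b⟩ ⟨t', a', b'⟩ h
    simp only [Prod.mk.injEq] at h ⊢
    omega
  have hLF : LF (fun p : ℤ × (ℤ × ℤ) => e3 (p.1 + p.2.1, p.1 + p.2.2, p.1 - p.2.1 - p.2.2)) := by
    intro n
    exact Set.Finite.preimage (s := {i | e3 i = n}) hinj.injOn (e3_LF n)
  rw [← gs_inj _ hinj]
  · refine gs_invol hLF _
      (Equiv.prodCongr (Equiv.refl ℤ) (Equiv.neg (ℤ × ℤ))) ?_ ?_
    · rintro ⟨t, a, b⟩
      have h1 := e3_spec (t + a, t + b, t - a - b)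
      have h2 := e3_spec (t + -a, t + -b, t - -a - -b)
      simp only at h1 h2
      change e3 (t + -a, t + -b, t - -a - -b) = e3 (t + a, t + b, t - a - b)
      have : (8 : ℤ) * (e3 (t + a, t + b, t - a - b) : ℤ)
         = 8 * (e3 (t + -a, t + -b, t - -a - -b) : ℤ) := by
        linear_combination h1 - h2
      omega
    · rintro ⟨t, a, b⟩
      simp only [Equiv.prodCongr_apply, Prod.map, Equiv.refl_apply, Equiv.neg_apply,
        Prod.fst_neg, Prod.snd_neg]
      rw [if_pos (by omega), if_pos (by omega)]
      unfold w3
      simp only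
      rw [show t + -a + (t + -b) + (t - -a - -b) = t + a + (t + b) + (t - a - b) by ring]
      ring
  · rintro ⟨a, b, c⟩ h
    simp only
    rw [if_neg]
    intro h2
    apply h
    refine ⟨((a + b + c) / 3, (a - (a + b + c) / 3, b - (a + b + c) / 3)), ?_⟩
    simp only [Prod.mk.injEq]
    omega

lemma class1 : MPgs e3 (fun q => if (q.1 + q.2.1 + q.2.2) % 3 = 1 then w3 q else 0)
    = -8 * (E * G) := by
  rw [← class2, ← gs_equiv (Equiv.prodCongr rfl1 (Equiv.prodCongr rfl1 rfl1)) e3]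
  congr 1
  · ext ⟨a, b, c⟩
    simp [e3, rfl1, eT_refl]
  · ext ⟨a, b, c⟩
    simp only [rfl1, Equiv.prodCongr_apply, Prod.map, Equiv.coe_fn_mk]
    have : (-1 - a + (-1 - b) + (-1 - c)) % 3 = 1 ↔ (a + b + c) % 3 = 2 := by omega
    simp only [this]
    split_ifs with h
    · unfold w3
      simp only
      rw [show -1 - a + (-1 - b) + (-1 - c) = -1 - (1 + (1 + (a + b + c))) by ring, sg_refl,
        sg_add 1, sg_add 1, sg_one]
      ring
    · rfl

lemma E8 : 6 * E ^ 8 = - G := by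
  have h : MPgs e3 w3 = 0 + -8 * (E * G) + -8 * (E * G) := by
    nth_rewrite 1 [← class1]
    rw [← class2, ← class0, ← gs_add e3_LF, ← gs_add e3_LF]
    congr 1; ext q
    have : (q.1 + q.2.1 + q.2.2) % 3 = 0 ∨ (q.1 + q.2.1 + q.2.2) % 3 = 1 ∨
      (q.1 + q.2.1 + q.2.2) % 3 = 2 := by omega
    rcases this with h | h | h <;> simp [h]
  rw [w3_sum] at h
  apply E_unit.mul_left_cancel
  apply mul_left_cancel₀ (num_ne 16)
  linear_combination h

lemma E8_div (n : ℕ) : (121 : ℤ) ∣ coeff (11 * n + 7) (E ^ 8) := by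
  have h := congrArg (coeff (11 * n + 7)) E8
  rw [show (6 : ℤ⟦X⟧) = C 6 from (map_ofNat C 6).symm, coeff_C_mul, map_neg] at h
  have h2 : (121 : ℤ) ∣ coeff (11 * n + 7) G := by
    unfold G
    rw [coeff_gs' eG_LF]
    apply Finset.dvd_sum
    rintro ⟨a, b⟩ hab
    simp at hab
    have hs := eG_spec (a, b)
    rw [hab] at hs
    simp only at hs ⊢
    have key : ∀ x y : ZMod 11, x ^ 2 + x * y + y ^ 2 = 0 → x = 0 ∧ y = 0 := by decide
    have h0 : ((3 * a + 1 : ℤ) : ZMod 11) ^ 2 + ((3 * a + 1 : ℤ) : ZMod 11) *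
        ((3 * b + 1 : ℤ) : ZMod 11) + ((3 * b + 1 : ℤ) : ZMod 11) ^ 2 = 0 := by
      have : (3 * a + 1) ^ 2 + (3 * a + 1) * (3 * b + 1) + (3 * b + 1) ^ 2
        = 11 * (9 * (n : ℤ) + 6) := by
        push_cast at hs
        linear_combination -9 * hs
      have := congrArg (Int.cast : ℤ → ZMod 11) this
      rw [Int.cast_mul 11] at this
      push_cast at this ⊢
      rw [this, show (11 : ZMod 11) = 0 from by decide, zero_mul]
    obtain ⟨ha, hb⟩ := key _ _ h0
    rw [ZMod.intCast_zmod_eq_zero_iff_dvd] at ha hb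
    exact Dvd.dvd.mul_right (mul_dvd_mul ha hb) _
  have h3 : (121 : ℤ) ∣ 6 * coeff (11 * n + 7) (E ^ 8) := by
    rw [h]; exact h2.neg_right
  omega

end MP

namespace MP
open PowerSeries

lemma h11 : (11 : (ZMod 11)⟦X⟧) = 0 := by
  have : (11 : (ZMod 11)⟦X⟧) = C (11 : ZMod 11) := (map_ofNat C 11).symm
  rw [this, show (11 : ZMod 11) = 0 from by decide, map_zero]

lemma B_calc (p q r : (ZMod 11)⟦X⟧) (hp : θ (ZMod 11) p = p ^ 2 - q)
    (hq : θ (ZMod 11) q = 4 * (p * q - r)) (hr : θ (ZMod 11) r = 6 * (p * r - q ^ 2))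
    (B : ℕ → (ZMod 11)⟦X⟧) (h0 : B 0 = 1)
    (hB : ∀ i, B (i + 1) = 8 * θ (ZMod 11) (B i) + p * B i) : B 5 = q * r := by
  have b1 : B 1 = p := by rw [hB, h0]; simp
  have b2 : B 2 = 3 * q + 9 * p ^ 2 := by
    rw [hB, b1]
    simp only [Derivation.leibniz, Derivation.leibniz_pow, θofnat, map_add, smul_eq_mul,
      nsmul_eq_mul, Derivation.map_one_eq_zero, hp, hq, hr]
    push_cast
    linear_combination (- 1 * q) * h11
  have b3 : B 3 = 3 * r + 10 * p * q + 10 * p ^ 3 := by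
    rw [hB, b2]
    simp only [Derivation.leibniz, Derivation.leibniz_pow, θofnat, map_add, smul_eq_mul,
      nsmul_eq_mul, Derivation.map_one_eq_zero, hp, hq, hr]
    push_cast
    linear_combination (- 9 * r - 5 * p * q + 13 * p ^ 3) * h11
  have b4 : B 4 = 7 * q ^ 2 + 3 * p * r + 5 * p ^ 2 * q + 8 * p ^ 4 := by
    rw [hB, b3]
    simp only [Derivation.leibniz, Derivation.leibniz_pow, θofnat, map_add, smul_eq_mul,
      nsmul_eq_mul, Derivation.map_one_eq_zero, hp, hq, hr]
    push_cast
    linear_combination (- 21 * q ^ 2 - 16 * p * r + 15 * p ^ 2 * q + 22 * p ^ 4) * h11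
  have b5 : B 5 = 1 * q * r := by
    rw [hB, b4]
    simp only [Derivation.leibniz, Derivation.leibniz_pow, θofnat, map_add, smul_eq_mul,
      nsmul_eq_mul, Derivation.map_one_eq_zero, hp, hq, hr]
    push_cast
    linear_combination (- 43 * q * r + 21 * p * q ^ 2 + 1 * p ^ 2 * r - 1 * p ^ 3 * q + 24
        * p ^ 5) * h11
  rw [b5]; ring

lemma cert (p q r : (ZMod 11)⟦X⟧) (hp : θ (ZMod 11) p = p ^ 2 - q)
    (hq : θ (ZMod 11) q = 4 * (p * q - r)) (hr : θ (ZMod 11) r = 6 * (p * r - q ^ 2))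
    (hqr : q * r = 1) :
    (∃ k, r = θ (ZMod 11) k + 2 * p * k) ∧
    (∃ k, 5 * (θ (ZMod 11))^[9] p = 6 * ((q ^ 3 - r ^ 2) ^ 7 * r ^ 11)
      + θ (ZMod 11) k + 4 * p * k) := by
  have hz : q * θ (ZMod 11) r + r * θ (ZMod 11) q = 0 := by
    have : θ (ZMod 11) (q * r) = 0 := by rw [hqr]; simp
    rwa [Derivation.leibniz, smul_eq_mul, smul_eq_mul] at this
  have hpe : p = 5 * q ^ 3 + 7 * r ^ 2 := by
    rw [hq, hr] at hz
    linear_combination 10 * p * hqr - hz + (p + q ^ 3 + r ^ 2 - 2 * q ^ 3 - 2 * r ^ 2) * h11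
  have hq2 : θ (ZMod 11) q = 9 * q ^ 4 + 2 * r := by
    rw [hq, hpe]
    linear_combination 28 * r * hqr + (q ^ 4 + 2 * r) * h11
  have hr2 : θ (ZMod 11) r = - r ^ 2 * θ (ZMod 11) q := by
    linear_combination r * hz - (θ (ZMod 11) r) * hqr
  obtain ⟨u, hu⟩ : ∃ u, u = q ^ 5 := ⟨_, rfl⟩
  obtain ⟨v, hv⟩ : ∃ v, v = r ^ 2 := ⟨_, rfl⟩
  have huv : v ^ 5 * u ^ 2 = 1 := by
    rw [hu, hv, show (r ^ 2) ^ 5 * (q ^ 5) ^ 2 = (q * r) ^ 10 by ring, hqr, one_pow]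
  have hq3 : q ^ 3 = v * u := by
    rw [hu, hv, show r ^ 2 * q ^ 5 = q ^ 3 * (q * r) ^ 2 by ring, hqr]; ring
  have hru : r = v ^ 3 * u := by
    rw [hu, hv, show (r ^ 2) ^ 3 * q ^ 5 = r * (q * r) ^ 5 by ring, hqr]; ring
  have hpu : p = 5 * v * u + 7 * v := by rw [hpe, hq3, ← hv]; ring
  have hdu : θ (ZMod 11) u = v * u * (u - 1) := by
    have e1 : q ^ 8 = v * u ^ 2 := by
      rw [hu, hv, show r ^ 2 * (q ^ 5) ^ 2 = q ^ 8 * (q * r) ^ 2 by ring, hqr]; ring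
    have e2 : q ^ 4 * r = v * u := by
      rw [← hq3]
      linear_combination q ^ 3 * hqr
    have : θ (ZMod 11) u = 5 * q ^ 4 * θ (ZMod 11) q := by
      rw [hu, Derivation.leibniz_pow]
      simp only [smul_eq_mul, nsmul_eq_mul]; push_cast; ring
    rw [this, hq2]
    linear_combination 45 * e1 + 10 * e2 + (4 * v * u ^ 2 + v * u) * h11
  have hdv : θ (ZMod 11) v = v ^ 2 * (4 * u + 7) := by
    have e1 : r ^ 3 * q ^ 4 = v ^ 2 * u := by
      rw [hu, hv, show r ^ 3 * q ^ 4 = q * (q * r) ^ 3 by ring,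
        show (r ^ 2) ^ 2 * q ^ 5 = q * (q * r) ^ 4 by ring, hqr]; ring
    have e2 : r ^ 4 = v ^ 2 := by rw [hv]; ring
    have : θ (ZMod 11) v = 2 * r * θ (ZMod 11) r := by
      rw [hv, Derivation.leibniz_pow]
      simp only [smul_eq_mul, nsmul_eq_mul]; push_cast; ring
    rw [this, hr2, hq2]
    linear_combination (-18) * e1 + (-4) * e2 - (2 * v ^ 2 * u + v ^ 2) * h11
  constructor
  · refine ⟨9 * v ^ 2 * u + 4 * v ^ 2 * u ^ 2 + 10 * v ^ 2 * u ^ 3 + 5 * v ^ 2 * u ^ 4, ?_⟩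
    rw [hpu]
    nth_rewrite 1 [hru]
    simp only [Derivation.leibniz, Derivation.leibniz_pow, θofnat, map_add, smul_eq_mul,
      nsmul_eq_mul, Derivation.map_one_eq_zero, hdu, hdv]
    push_cast
    linear_combination (- 22 * v ^ 3 * u - 25 * v ^ 3 * u ^ 2 - 30 * v ^ 3 * u ^ 3 - 30 *
        v ^ 3 * u ^ 4 - 10 * v ^ 3 * u ^ 5) * h11
  · refine ⟨7 * v ^ 14 * u + 6 * v ^ 14 * u ^ 2 + 1 * v ^ 14 * u ^ 3 + 7 * v ^ 14 * u ^ 4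
      + 10 * v ^ 14 * u ^ 5 + 8 * v ^ 14 * u ^ 6 + 6 * v ^ 14 * u ^ 7 + 9 * v ^ 14 * u ^ 8 + 5
      * v ^ 14 * u ^ 9 + 1 * v ^ 14 * u ^ 10 + 6 * v ^ 14 * u ^ 11, ?_⟩
    have f0 : (θ (ZMod 11))^[0] p = 5 * v * u + 7 * v := hpu
    have f1 : (θ (ZMod 11))^[1] p = 5 * v ^ 2 + 3 * v ^ 2 * u + 3 * v ^ 2 * u ^ 2 := by
      rw [Function.iterate_succ_apply', f0]
      simp only [Derivation.leibniz, Derivation.leibniz_pow, θofnat, map_add, smul_eq_mul,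
        nsmul_eq_mul, Derivation.map_one_eq_zero, hdu, hdv]
      push_cast
      linear_combination (4 * v ^ 2 + 5 * v ^ 2 * u + 2 * v ^ 2 * u ^ 2) * h11
    have f2 : (θ (ZMod 11))^[2] p = 4 * v ^ 3 + 2 * v ^ 3 * u + 8 * v ^ 3 * u ^ 2 + 8 * v
        ^ 3 * u ^ 3 := by
      rw [Function.iterate_succ_apply', f1]
      simp only [Derivation.leibniz, Derivation.leibniz_pow, θofnat, map_add, smul_eq_mul,
        nsmul_eq_mul, Derivation.map_one_eq_zero, hdu, hdv]
      push_cast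
      linear_combination (6 * v ^ 3 + 7 * v ^ 3 * u + 5 * v ^ 3 * u ^ 2 + 2 * v ^ 3 * u ^ 3) * h11
    have f3 : (θ (ZMod 11))^[3] p = 7 * v ^ 4 + 2 * v ^ 4 * u ^ 2 + 3 * v ^ 4 * u ^ 3 + 10
        * v ^ 4 * u ^ 4 := by
      rw [Function.iterate_succ_apply', f2]
      simp only [Derivation.leibniz, Derivation.leibniz_pow, θofnat, map_add, smul_eq_mul,
        nsmul_eq_mul, Derivation.map_one_eq_zero, hdu, hdv]
      push_cast
      linear_combination (7 * v ^ 4 + 8 * v ^ 4 * u + 16 * v ^ 4 * u ^ 2 + 23 * v ^ 4 * u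
          ^ 3 + 10 * v ^ 4 * u ^ 4) * h11
    have f4 : (θ (ZMod 11))^[4] p = 9 * v ^ 5 + 2 * v ^ 5 * u + 8 * v ^ 5 * u ^ 2 + 1 * v
        ^ 5 * u ^ 3 + 2 * v ^ 5 * u ^ 5 := by
      rw [Function.iterate_succ_apply', f3]
      simp only [Derivation.leibniz, Derivation.leibniz_pow, θofnat, map_add, smul_eq_mul,
        nsmul_eq_mul, Derivation.map_one_eq_zero, hdu, hdv]
      push_cast
      linear_combination (17 * v ^ 5 + 10 * v ^ 5 * u + 4 * v ^ 5 * u ^ 2 + 10 * v ^ 5 * u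
          ^ 3 + 27 * v ^ 5 * u ^ 4 + 18 * v ^ 5 * u ^ 5) * h11
    have f5 : (θ (ZMod 11))^[5] p = 7 * v ^ 6 + 6 * v ^ 6 * u + 9 * v ^ 6 * u ^ 2 + 10 * v
        ^ 6 * u ^ 3 + 1 * v ^ 6 * u ^ 4 + 5 * v ^ 6 * u ^ 5 + 6 * v ^ 6 * u ^ 6 := by
      rw [Function.iterate_succ_apply', f4]
      simp only [Derivation.leibniz, Derivation.leibniz_pow, θofnat, map_add, smul_eq_mul,
        nsmul_eq_mul, Derivation.map_one_eq_zero, hdu, hdv]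
      push_cast
      linear_combination (28 * v ^ 6 + 22 * v ^ 6 * u + 27 * v ^ 6 * u ^ 2 + 18 * v ^ 6 *
          u ^ 3 + 2 * v ^ 6 * u ^ 4 + 5 * v ^ 6 * u ^ 5 + 4 * v ^ 6 * u ^ 6) * h11
    have f6 : (θ (ZMod 11))^[6] p = 8 * v ^ 7 + 7 * v ^ 7 * u + 4 * v ^ 7 * u ^ 2 + 8 * v
        ^ 7 * u ^ 3 + 4 * v ^ 7 * u ^ 5 + 9 * v ^ 7 * u ^ 6 + 4 * v ^ 7 * u ^ 7 := by
      rw [Function.iterate_succ_apply', f5]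
      simp only [Derivation.leibniz, Derivation.leibniz_pow, θofnat, map_add, smul_eq_mul,
        nsmul_eq_mul, Derivation.map_one_eq_zero, hdu, hdv]
      push_cast
      linear_combination (26 * v ^ 7 + 37 * v ^ 7 * u + 46 * v ^ 7 * u ^ 2 + 56 * v ^ 7 *
          u ^ 3 + 28 * v ^ 7 * u ^ 4 + 19 * v ^ 7 * u ^ 5 + 32 * v ^ 7 * u ^ 6 + 16 * v ^ 7 *
          u ^ 7) * h11
    have f7 : (θ (ZMod 11))^[7] p = 7 * v ^ 8 + 10 * v ^ 8 * u + 6 * v ^ 8 * u ^ 2 + 4 * v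
        ^ 8 * u ^ 3 + 6 * v ^ 8 * u ^ 4 + 2 * v ^ 8 * u ^ 6 + 1 * v ^ 8 * u ^ 7 + 8 * v ^ 8 *
        u ^ 8 := by
      rw [Function.iterate_succ_apply', f6]
      simp only [Derivation.leibniz, Derivation.leibniz_pow, θofnat, map_add, smul_eq_mul,
        nsmul_eq_mul, Derivation.map_one_eq_zero, hdu, hdv]
      push_cast
      linear_combination (35 * v ^ 8 + 50 * v ^ 8 * u + 35 * v ^ 8 * u ^ 2 + 44 * v ^ 8 *
          u ^ 3 + 22 * v ^ 8 * u ^ 4 + 16 * v ^ 8 * u ^ 5 + 47 * v ^ 8 * u ^ 6 + 43 * v ^ 8 *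
          u ^ 7 + 12 * v ^ 8 * u ^ 8) * h11
    have f8 : (θ (ZMod 11))^[8] p = 7 * v ^ 9 + 4 * v ^ 9 * u + 5 * v ^ 9 * u ^ 2 + 9 * v
        ^ 9 * u ^ 3 + 1 * v ^ 9 * u ^ 4 + 7 * v ^ 9 * u ^ 5 + 1 * v ^ 9 * u ^ 6 + 4 * v ^ 9 *
        u ^ 7 + 5 * v ^ 9 * u ^ 8 + 1 * v ^ 9 * u ^ 9 := by
      rw [Function.iterate_succ_apply', f7]
      simp only [Derivation.leibniz, Derivation.leibniz_pow, θofnat, map_add, smul_eq_mul,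
        nsmul_eq_mul, Derivation.map_one_eq_zero, hdu, hdv]
      push_cast
      linear_combination (35 * v ^ 9 + 70 * v ^ 9 * u + 59 * v ^ 9 * u ^ 2 + 37 * v ^ 9 *
          u ^ 3 + 41 * v ^ 9 * u ^ 4 + 19 * v ^ 9 * u ^ 5 + 9 * v ^ 9 * u ^ 6 + 11 * v ^ 9 * u
          ^ 7 + 38 * v ^ 9 * u ^ 8 + 29 * v ^ 9 * u ^ 9) * h11
    have f9 : (θ (ZMod 11))^[9] p = 1 * v ^ 10 + 5 * v ^ 10 * u + 2 * v ^ 10 * u ^ 2 + 4 *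
        v ^ 10 * u ^ 3 + 3 * v ^ 10 * u ^ 4 + 6 * v ^ 10 * u ^ 5 + 3 * v ^ 10 * u ^ 6 + 2 * v
        ^ 10 * u ^ 7 + 7 * v ^ 10 * u ^ 8 + 10 * v ^ 10 * u ^ 9 + 1 * v ^ 10 * u ^ 10 := by
      rw [Function.iterate_succ_apply', f8]
      simp only [Derivation.leibniz, Derivation.leibniz_pow, θofnat, map_add, smul_eq_mul,
        nsmul_eq_mul, Derivation.map_one_eq_zero, hdu, hdv]
      push_cast
      linear_combination (40 * v ^ 10 + 45 * v ^ 10 * u + 41 * v ^ 10 * u ^ 2 + 66 * v ^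
          10 * u ^ 3 + 37 * v ^ 10 * u ^ 4 + 40 * v ^ 10 * u ^ 5 + 31 * v ^ 10 * u ^ 6 + 24 *
          v ^ 10 * u ^ 7 + 40 * v ^ 10 * u ^ 8 + 24 * v ^ 10 * u ^ 9 + 4 * v ^ 10 * u ^ 10) *
          h11
    have hd : (q ^ 3 - r ^ 2) ^ 7 * r ^ 11 = v ^ 15 * u * (u - 1) ^ 7 := by
      rw [hq3, ← hv, hru]
      rw [show (v * u - v) ^ 7 * (v ^ 3 * u) ^ 11 =
        v ^ 15 * u * (u - 1) ^ 7 * (v ^ 5 * u ^ 2) ^ 5 by ring, huv]; ring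
    rw [f9, hd, hpu]
    simp only [Derivation.leibniz, Derivation.leibniz_pow, θofnat, map_add, smul_eq_mul,
      nsmul_eq_mul, Derivation.map_one_eq_zero, hdu, hdv]
    push_cast
    linear_combination (- 79 * v ^ 15 * u - 120 * v ^ 15 * u ^ 2 - 40 * v ^ 15 * u ^ 3 -
        103 * v ^ 15 * u ^ 4 - 140 * v ^ 15 * u ^ 5 - 171 * v ^ 15 * u ^ 6 - 118 * v ^ 15 * u
        ^ 7 - 141 * v ^ 15 * u ^ 8 - 121 * v ^ 15 * u ^ 9 - 46 * v ^ 15 * u ^ 10 - 66 * v ^ 15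
        * u ^ 11 - 47 * v ^ 15 * u ^ 12) * h11 - 5 * (1 * v ^ 10 + 5 * v ^ 10 * u + 2 * v ^ 10
        * u ^ 2 + 4 * v ^ 10 * u ^ 3 + 3 * v ^ 10 * u ^ 4 + 6 * v ^ 10 * u ^ 5 + 3 * v ^ 10 *
        u ^ 6 + 2 * v ^ 10 * u ^ 7 + 7 * v ^ 10 * u ^ 8 + 10 * v ^ 10 * u ^ 9 + 1 * v ^ 10 * u
        ^ 10) * huv

end MP

namespace MP
open PowerSeries

noncomputable def π : ℤ⟦X⟧ →+* (ZMod 11)⟦X⟧ := PowerSeries.map (Int.castRingHom (ZMod 11))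

lemma coeff_π (f : ℤ⟦X⟧) (n : ℕ) : coeff n (π f) = ((coeff n f : ℤ) : ZMod 11) := by
  simp [π]

lemma π_θ (f : ℤ⟦X⟧) : π (θ ℤ f) = θ (ZMod 11) (π f) := by
  ext n
  rw [coeff_π, coeff_θ, coeff_θ, coeff_π]
  push_cast; ring

lemma exists_mul (m : ℤ) (f : ℤ⟦X⟧) (h : ∀ n, m ∣ coeff n f) : ∃ g : ℤ⟦X⟧, f = C m * g := by
  choose g hg using h
  refine ⟨PowerSeries.mk g, ?_⟩
  ext n
  rw [coeff_C_mul, coeff_mk, hg]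

lemma π_zero (f : ℤ⟦X⟧) (h : π f = 0) : ∃ g : ℤ⟦X⟧, f = 11 * g := by
  obtain ⟨g, hg⟩ := exists_mul 11 f (fun n => by
    have := congrArg (coeff n) h
    rw [coeff_π, map_zero, ZMod.intCast_zmod_eq_zero_iff_dvd] at this
    exact_mod_cast this)
  exact ⟨g, by rw [hg, map_ofNat]⟩

lemma frob (f : (ZMod 11)⟦X⟧) : f ^ 11 = expand 11 (by norm_num) f := by
  have : Fact (Nat.Prime 11) := ⟨by norm_num⟩
  have h := MvPowerSeries.map_frobenius_expand (σ := Unit) (R := ZMod 11) 11 (by norm_num) (f := f)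
  rw [ZMod.frobenius_zmod, MvPowerSeries.map_id] at h
  exact h.symm

lemma coeff_expand_mul_add {R : Type} [CommRing R] (g f : R⟦X⟧) (n r : ℕ) (hr : r < 11) :
    coeff (11 * n + r) (expand 11 (by norm_num) g * f) =
      coeff n (g * PowerSeries.mk fun m => coeff (11 * m + r) f) := by
  rw [coeff_mul, coeff_mul]
  symm
  refine Finset.sum_of_injOn (fun p => (11 * p.1, 11 * p.2 + r)) ?_ ?_ ?_ ?_
  · rintro ⟨a, b⟩ _ ⟨c, d⟩ _ h
    simp only [Prod.mk.injEq] at h ⊢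
    omega
  · rintro ⟨a, b⟩ h
    simp at h ⊢
    omega
  · rintro ⟨a, b⟩ h h2
    rw [Finset.HasAntidiagonal.mem_antidiagonal] at h
    simp only at h ⊢
    rw [coeff_expand_of_not_dvd, zero_mul]
    rintro ⟨c, rfl⟩
    apply h2
    refine ⟨(c, n - c), ?_, ?_⟩
    · simp; omega
    · simp only [Prod.mk.injEq, true_and]; omega
  · rintro ⟨a, b⟩ h
    simp

lemma θF : θ ℤ F = - L * F := by
  have h2 : θ ℤ (F * E) = 0 := by rw [F_mul_E]; simp
  rw [Derivation.leibniz, θE, smul_eq_mul, smul_eq_mul] at h2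
  apply E_unit.mul_left_cancel
  linear_combination h2

lemma delta : Q ^ 3 - R ^ 2 = 1728 * X * E ^ 24 := by
  have hD : θ ℤ (Q ^ 3 - R ^ 2) = P * (Q ^ 3 - R ^ 2) := by
    rw [map_sub, Derivation.leibniz_pow, Derivation.leibniz_pow]
    simp only [smul_eq_mul, nsmul_eq_mul]
    push_cast
    linear_combination Q ^ 2 * ram2 - R * ram3
  have h3 : θ ℤ ((Q ^ 3 - R ^ 2) * F ^ 24) = (Q ^ 3 - R ^ 2) * F ^ 24 := by
    rw [Derivation.leibniz, hD, Derivation.leibniz_pow, θF]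
    simp only [smul_eq_mul, nsmul_eq_mul, P]
    push_cast
    ring
  have h5 : coeff 1 ((Q ^ 3 - R ^ 2) * F ^ 24) = 1728 := by
    have F0 : constantCoeff F = 1 := by
      rw [← coeff_zero_eq_constantCoeff_apply]; simp [F]
    have F1 : coeff 1 F = 1 := by simp [F]
    have E0 : constantCoeff E = 1 := by
      have := congrArg constantCoeff F_mul_E
      simpa [F0] using this
    have E1 : coeff 1 E = -1 := by
      have := congrArg (coeff 1) F_mul_E
      rw [coeff_one_mul, F0, F1, E0, coeff_one] at this
      simp at this
      omega
    have t0 : ∀ f, constantCoeff (θ ℤ f) = 0 := by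
      intro f
      rw [← coeff_zero_eq_constantCoeff_apply, coeff_θ]; simp
    have t1 : ∀ f, coeff 1 (θ ℤ f) = coeff 1 f := by
      intro f
      rw [coeff_θ]; simp
    have n1 : ∀ (n : ℕ) [n.AtLeastTwo], coeff 1 (ofNat(n) : ℤ⟦X⟧) = 0 := by
      intro n _
      rw [show (ofNat(n) : ℤ⟦X⟧) = C (n : ℤ) from (map_natCast C n).symm, coeff_C]
      simp
    have n24 : constantCoeff (24 : ℤ⟦X⟧) = 24 := map_ofNat _ _
    have n12 : constantCoeff (12 : ℤ⟦X⟧) = 12 := map_ofNat _ _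
    have n3 : constantCoeff (3 : ℤ⟦X⟧) = 3 := map_ofNat _ _
    have L0 : constantCoeff L = 0 := by simp [L, t0]
    have L1 : coeff 1 L = -1 := by
      unfold L; rw [coeff_one_mul, t0, t1, E1, F0]; simp
    have P0 : constantCoeff P = 1 := by simp [P, L0]
    have P1 : coeff 1 P = -24 := by
      unfold P; rw [map_add, coeff_one_mul, L0, L1, coeff_one, n1, n24]; simp
    have Q0 : constantCoeff Q = 1 := by simp [Q, P0, t0]
    have Q1 : coeff 1 Q = 240 := by
      unfold Q; rw [map_sub, coeff_one_mul, t0, t1, coeff_one_pow, n1, P0, P1, n12]; simp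
    have R0 : constantCoeff R = 1 := by simp [R, P0, Q0, t0]
    have R1 : coeff 1 R = -504 := by
      unfold R; rw [map_sub, coeff_one_mul, coeff_one_mul, t0, t1, n1, P0, P1, Q0, Q1, n3]; simp
    rw [coeff_one_mul, map_sub (coeff 1), coeff_one_pow, coeff_one_pow, coeff_one_pow,
      map_sub constantCoeff, map_pow constantCoeff, map_pow constantCoeff, map_pow constantCoeff,
      Q0, Q1, R0, R1, F0]
    norm_num
  have h4 : (Q ^ 3 - R ^ 2) * F ^ 24 = C 1728 * X := by
    ext n
    rw [coeff_C_mul, coeff_X]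
    by_cases hn : n = 1
    · subst hn; rw [h5]; simp
    · have := congrArg (coeff n) h3
      rw [coeff_θ] at this
      rw [if_neg hn]
      have h6 : ((n : ℤ) - 1) * coeff n ((Q ^ 3 - R ^ 2) * F ^ 24) = 0 := by
        linear_combination this
      rcases mul_eq_zero.mp h6 with h | h
      · omega
      · rw [h]; simp
  have h6 : F ^ 24 * E ^ 24 = 1 := by rw [← mul_pow, F_mul_E, one_pow]
  rw [map_ofNat] at h4
  linear_combination E ^ 24 * h4 - (Q ^ 3 - R ^ 2) * h6

noncomputable def BB : ℕ → ℤ⟦X⟧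
  | 0 => 1
  | (i + 1) => 8 * θ ℤ (BB i) + P * BB i

lemma YY_BB (i : ℕ) : YY i = E ^ 3 * BB i := by
  induction i with
  | zero => rw [YY_zero, Y_eq, BB]; ring
  | succ i ih => rw [YY_succ, ih, YYstep, BB]

lemma YY5 : π (YY 5) = π (YY 0) := by
  ext n
  rw [coeff_π, coeff_π]
  unfold YY
  rw [coeff_gs' eY_LF, coeff_gs' eY_LF]
  push_cast
  apply Finset.sum_congr rfl
  intro k _
  generalize (4 * (k : ZMod 11) + 1) = x
  revert x
  decide

lemma BB5 : π (BB 5) = 1 := by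
  have h := YY5
  rw [YY_BB, YY_BB, map_mul, map_mul] at h
  have := ((E_unit.pow 3).map π).mul_left_cancel h
  rw [this]; simp [BB]

lemma mram1 : θ (ZMod 11) (π P) = π P ^ 2 - π Q := by
  have h := congrArg π ram1
  simp only [map_mul, map_sub, map_pow, π_θ, map_ofNat] at h
  linear_combination h - θ (ZMod 11) (π P) * h11

lemma mram2 : θ (ZMod 11) (π Q) = 4 * (π P * π Q - π R) := by
  have h := congrArg π ram2
  simp only [map_mul, map_sub, map_pow, π_θ, map_ofNat] at h
  linear_combination 4 * h - θ (ZMod 11) (π Q) * h11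

lemma mram3 : θ (ZMod 11) (π R) = 6 * (π P * π R - π Q ^ 2) := by
  have h := congrArg π ram3
  simp only [map_mul, map_sub, map_pow, π_θ, map_ofNat] at h
  linear_combination 6 * h - θ (ZMod 11) (π R) * h11

lemma QR : π Q * π R = 1 := by
  rw [← BB5]
  symm
  apply B_calc (π P) (π Q) (π R) mram1 mram2 mram3 (fun i => π (BB i))
  · simp [BB]
  · intro i
    simp only [BB, map_add, map_mul, π_θ, map_ofNat]

lemma mdelta : π Q ^ 3 - π R ^ 2 = X * π E ^ 24 := by
  have h := congrArg π delta
  have hX : π X = X := by simp [π]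
  simp only [map_mul, map_sub, map_pow, map_ofNat, hX] at h
  linear_combination h + 157 * X * π E ^ 24 * h11

lemma mP : π P = 1 + 2 * π L := by
  unfold P
  simp only [map_add, map_mul, map_one, map_ofNat]
  linear_combination 2 * π L * h11

lemma mθE : θ (ZMod 11) (π E) = π E * π L := by
  rw [← π_θ, θE, map_mul]

lemma coeff_smul_zero (f : (ZMod 11)⟦X⟧) (k n : ℕ) [k.AtLeastTwo]
    (h : ((n + k : ℕ) : ZMod 11) = 0) :
    coeff n (θ (ZMod 11) f + ofNat(k) * f) = 0 := by
  rw [show (ofNat(k) : (ZMod 11)⟦X⟧) = C (k : ZMod 11) from (map_natCast C k).symm, map_add,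
    coeff_C_mul, coeff_θ, ← add_mul]
  push_cast at h
  rw [h, zero_mul]

lemma nat_zero (a b : ℕ) (h : b = 11 * a) : (b : ZMod 11) = 0 := by
  rw [h, Nat.cast_mul, show ((11 : ℕ) : ZMod 11) = 0 from by decide, zero_mul]

lemma E4R (n : ℕ) : coeff (11 * n + 9) (π E ^ 4 * π R) = 0 := by
  obtain ⟨⟨k, hk⟩, _⟩ := cert _ _ _ mram1 mram2 mram3 QR
  have : π E ^ 4 * π R = θ (ZMod 11) (π E ^ 4 * k) + 2 * (π E ^ 4 * k) := by
    rw [Derivation.leibniz, Derivation.leibniz_pow, mθE]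
    simp only [smul_eq_mul, nsmul_eq_mul]
    push_cast
    rw [mP] at hk
    linear_combination π E ^ 4 * hk
  rw [this]
  exact coeff_smul_zero _ 2 _ (nat_zero (n + 1) _ (by ring))

lemma E8T (n : ℕ) : coeff (11 * n + 7) (π E ^ 8 * (5 * (θ (ZMod 11))^[9] (π P)))
    = 6 * coeff n (π E ^ 16 * π R) := by
  obtain ⟨_, ⟨k, hk⟩⟩ := cert _ _ _ mram1 mram2 mram3 QR
  have : π E ^ 8 * (5 * (θ (ZMod 11))^[9] (π P)) =
      C 6 * (X ^ 7 * expand 11 (by norm_num) (π E ^ 16 * π R)) +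
      (θ (ZMod 11) (π E ^ 8 * k) + 4 * (π E ^ 8 * k)) := by
    rw [Derivation.leibniz, Derivation.leibniz_pow, mθE, hk, mdelta, ← frob, mP, map_ofNat]
    simp only [smul_eq_mul, nsmul_eq_mul]
    push_cast
    ring
  rw [this, map_add, coeff_smul_zero _ 4 _ (nat_zero (n + 1) _ (by ring)), coeff_C_mul,
    coeff_X_pow_mul, coeff_expand_mul, add_zero]

lemma coeff_iter (f : (ZMod 11)⟦X⟧) (k n : ℕ) :
    coeff n ((θ (ZMod 11))^[k] f) = (n : ZMod 11) ^ k * coeff n f := by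
  induction k with
  | zero => simp
  | succ k ih => rw [Function.iterate_succ_apply', coeff_θ, ih]; ring

lemma exS : ∃ S : ℤ⟦X⟧, expand 11 (by norm_num) E = E ^ 11 * (1 + 11 * S) := by
  obtain ⟨g, hg⟩ := π_zero (expand 11 (by norm_num) E - E ^ 11) (by
    rw [map_sub, map_pow, frob]
    unfold π
    rw [map_expand, sub_self])
  refine ⟨F ^ 11 * g, ?_⟩
  have h6 : F ^ 11 * E ^ 11 = 1 := by rw [← mul_pow, F_mul_E, one_pow]
  linear_combination hg - 11 * g * h6

lemma θ_expand (f : ℤ⟦X⟧) :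
    θ ℤ (expand 11 (by norm_num) f) = 11 * expand 11 (by norm_num) (θ ℤ f) := by
  ext n
  rw [show (11 : ℤ⟦X⟧) = C 11 from (map_ofNat C 11).symm, coeff_C_mul, coeff_θ]
  by_cases h : 11 ∣ n
  · obtain ⟨m, rfl⟩ := h
    rw [coeff_expand_mul, coeff_expand_mul, coeff_θ]
    push_cast; ring
  · rw [coeff_expand_of_not_dvd _ _ _ h, coeff_expand_of_not_dvd _ _ _ h]; simp

lemma θS (S : ℤ⟦X⟧) (hS : expand 11 (by norm_num) E = E ^ 11 * (1 + 11 * S)) :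
    θ (ZMod 11) (π S) = π L ^ 11 - π L := by
  have h := congrArg (θ ℤ) hS
  rw [θ_expand, θE, map_mul, Derivation.leibniz, Derivation.leibniz_pow, map_add,
    Derivation.leibniz, θofnat ℤ 11, θE, hS] at h
  simp only [smul_eq_mul, nsmul_eq_mul, Derivation.map_one_eq_zero] at h
  push_cast at h
  have h2 : E ^ 11 * (11 * ((1 + 11 * S) * expand 11 (by norm_num) L)) =
      E ^ 11 * (11 * (θ ℤ S + L * (1 + 11 * S))) := by
    linear_combination h
  have h3 := mul_left_cancel₀ (num_ne 11) ((E_unit.pow 11).mul_left_cancel h2)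
  have h4 := congrArg π h3
  have h5 : π (expand 11 (by norm_num) L) = π L ^ 11 := by
    rw [frob]; unfold π; rw [map_expand]
  simp only [map_mul, map_add, map_one, map_ofNat, π_θ, h5] at h4
  linear_combination -h4 + (π S * π L ^ 11 - π S * π L) * h11

lemma coeff_T (S : ℤ⟦X⟧) (hS : expand 11 (by norm_num) E = E ^ 11 * (1 + 11 * S)) (n : ℕ) :
    coeff n (5 * (θ (ZMod 11))^[9] (π P)) = (n : ZMod 11) ^ 10 * coeff n (π S) := by
  have h := congrArg (coeff n) (θS S hS)
  rw [coeff_θ, map_sub, frob] at h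
  have h1 : (n : ZMod 11) ^ 9 * coeff n (expand 11 (by norm_num) (π L)) = 0 := by
    by_cases h : 11 ∣ n
    · obtain ⟨m, rfl⟩ := h
      rw [nat_zero m _ rfl]; simp
    · rw [coeff_expand_of_not_dvd _ _ _ h, mul_zero]
  have h2 : (n : ZMod 11) ^ 9 * coeff n (1 : (ZMod 11)⟦X⟧) = 0 := by
    rw [coeff_one]
    split_ifs with h
    · rw [h]; simp
    · simp
  rw [show (5 : (ZMod 11)⟦X⟧) = C 5 from (map_ofNat C 5).symm, coeff_C_mul, coeff_iter, mP,
    show (2 : (ZMod 11)⟦X⟧) = C 2 from (map_ofNat C 2).symm, map_add, coeff_C_mul]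
  have h11' : (11 : ZMod 11) = 0 := by decide
  linear_combination 5 * h2 - (n : ZMod 11) ^ 9 * h - h1 + (n : ZMod 11) ^ 9 * coeff n (π L) * h11'

lemma E8S (S : ℤ⟦X⟧) (hS : expand 11 (by norm_num) E = E ^ 11 * (1 + 11 * S)) (n : ℕ) :
    coeff (11 * n + 7) (π E ^ 8 * π S) = 6 * coeff n (π E ^ 16 * π R) := by
  rw [← E8T, coeff_mul, coeff_mul]
  apply Finset.sum_congr rfl
  rintro ⟨a, b⟩ hab
  rw [Finset.HasAntidiagonal.mem_antidiagonal] at hab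
  simp only at hab ⊢
  rw [coeff_T S hS]
  by_cases h : 11 ∣ b
  · obtain ⟨m, rfl⟩ := h
    have : coeff a (π E ^ 8) = 0 := by
      rw [← map_pow, coeff_π, show a = 11 * (n - m) + 7 by omega,
        ZMod.intCast_zmod_eq_zero_iff_dvd]
      exact dvd_trans (by norm_num) (E8_div _)
    rw [this, zero_mul, zero_mul]
  · have : (b : ZMod 11) ^ 10 = 1 := by
      have hb : (b : ZMod 11) ≠ 0 := by
        rwa [Ne, ZMod.natCast_eq_zero_iff]
      revert hb
      generalize (b : ZMod 11) = x
      revert x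
      decide
    rw [this, one_mul]

lemma E15R (n : ℕ) : (11 : ℤ) ∣ coeff (11 * n + 9) (E ^ 15 * R) := by
  have h : ((coeff (11 * n + 9) (E ^ 15 * R) : ℤ) : ZMod 11) = 0 := by
    rw [← coeff_π, map_mul, map_pow, show π E ^ 15 * π R = π E ^ 11 * (π E ^ 4 * π R) by ring,
      frob, coeff_expand_mul_add _ _ _ _ (by norm_num)]
    simp only [E4R]
    have : (PowerSeries.mk fun _ => 0 : (ZMod 11)⟦X⟧) = 0 := by ext; simp
    rw [this]; simp
  rw [ZMod.intCast_zmod_eq_zero_iff_dvd] at h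
  exact_mod_cast h

lemma main (n : ℕ) : (121 : ℤ) ∣ coeff (121 * n + 106) (F ^ 3) := by
  obtain ⟨S, hS⟩ := exS
  set U : ℤ⟦X⟧ := PowerSeries.mk fun m => coeff (11 * m + 7) (F ^ 3) with hU
  have h1 : ∀ m, (121 : ℤ) ∣ coeff m (E * U - 66 * (E ^ 16 * R)) := by
    intro m
    have e1 : expand 11 (by norm_num) E * F ^ 3 = E ^ 8 + C 11 * (E ^ 8 * S) := by
      have h6 : E ^ 3 * F ^ 3 = 1 := by rw [← mul_pow, mul_comm, F_mul_E, one_pow]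
      rw [hS, map_ofNat]
      linear_combination E ^ 8 * (1 + 11 * S) * h6
    have e2 := coeff_expand_mul_add E (F ^ 3) m 7 (by norm_num)
    rw [e1, map_add, coeff_C_mul, ← hU] at e2
    rw [map_sub, ← e2, show (66 : ℤ⟦X⟧) = C 66 from (map_ofNat C 66).symm, coeff_C_mul]
    have e3 := E8S S hS m
    have e4 : (11 : ℤ) ∣ coeff (11 * m + 7) (E ^ 8 * S) - 6 * coeff m (E ^ 16 * R) := by
      have : ((coeff (11 * m + 7) (E ^ 8 * S) - 6 * coeff m (E ^ 16 * R) : ℤ) : ZMod 11) = 0 := by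
        push_cast
        rw [← coeff_π, ← coeff_π, map_mul π, map_mul π, map_pow π, map_pow π, e3, sub_self]
      rw [ZMod.intCast_zmod_eq_zero_iff_dvd] at this
      exact_mod_cast this
    have e5 := E8_div m
    omega
  obtain ⟨W, hW⟩ := exists_mul 121 _ h1
  have h2 : U = C 66 * (E ^ 15 * R) + C 121 * (F * W) := by
    rw [show (C 66 : ℤ⟦X⟧) = 66 from map_ofNat C 66]
    linear_combination F * hW - (U - 66 * E ^ 15 * R) * F_mul_E
  have h3 := congrArg (coeff (11 * n + 9)) h2
  rw [hU, coeff_mk, map_add, coeff_C_mul, coeff_C_mul,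
    show 11 * (11 * n + 9) + 7 = 121 * n + 106 by ring] at h3
  have h4 := E15R n
  omega

end MP

theorem multipartition_three_onetwentyone (n : ℕ) : 121 ∣ multipartition 3 (121 * n + 106) := by
  have h := MP.main n
  rw [← MP.multi_eq] at h
  exact_mod_cast h
end

section
/- For every nonnegative integer n, p_4(7n + 6) ≡ 0 (mod 7). -/
namespace MP47

open PowerSeries Finset

section gen
variable {A : Type*} [CommRing A] (x : A)

def bb (x : A) : ℕ → ℕ → A
  | 0, 0 => 1
  | 0, _ + 1 => 0
  | n + 1, 0 => (1 + x ^ (n + 1) + x ^ (2 * (n + 1))) * bb x n 0 - x ^ (n + 1) * bb x n 1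
  | n + 1, k + 1 => (1 + x ^ (2 * (n + 1))) * bb x n (k + 1)
      - x ^ (n + 1) * (bb x n k + bb x n (k + 2))

def Q (x : A) (n : ℕ) : A := ∏ i ∈ range n, (1 - x ^ (i + 1))

def tri (k : ℕ) : ℕ := ∑ i ∈ range (k + 1), i

lemma tri_succ (k : ℕ) : tri (k + 1) = tri k + (k + 1) := by
  simp [tri, sum_range_succ]

lemma tri_zero : tri 0 = 0 := by simp [tri]

lemma le_tri (k : ℕ) : k ≤ tri k := by
  cases k with
  | zero => simp
  | succ k => rw [tri_succ]; omega

lemma two_tri (k : ℕ) : 2 * tri k = k * (k + 1) := by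
  induction k with
  | zero => simp [tri_zero]
  | succ k ih => rw [tri_succ, mul_add, ih]; ring

lemma Q_succ (n : ℕ) : Q x (n + 1) = Q x n * (1 - x ^ (n + 1)) := by
  simp [Q, prod_range_succ]

lemma Q_zero : Q x 0 = 1 := by simp [Q]

lemma bb_zero : ∀ (n k : ℕ), n < k → bb x n k = 0
  | 0, 0, h => by omega
  | 0, k + 1, _ => by simp [bb]
  | n + 1, 0, h => by omega
  | n + 1, k + 1, h => by
      rw [bb, bb_zero n (k + 1) (by omega), bb_zero n k (by omega), bb_zero n (k + 2) (by omega)]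
      simp

lemma bb_closed (n : ℕ) : ∀ d k, d + k = n →
    bb x n k * Q x d * Q x (d + 2 * k + 1) = (-1) ^ k * x ^ tri k * Q x (2 * n + 1) := by
  induction n with
  | zero =>
    intro d k h
    obtain ⟨rfl, rfl⟩ : d = 0 ∧ k = 0 := by omega
    simp [bb, Q_zero, tri_zero]
  | succ n ih =>
    have L : ∀ d k, d + k = n → bb x n (k + 1) * Q x d * Q x (d + 2 * k + 2) =
        (-1) ^ (k + 1) * x ^ tri (k + 1) * (1 - x ^ d) * Q x (2 * n + 1) := by
      intro d k h
      cases d with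
      | zero => rw [bb_zero x n (k + 1) (by omega)]; simp
      | succ e =>
        have := ih e (k + 1) (by omega)
        rw [show e + 2 * (k + 1) + 1 = e + 1 + 2 * k + 2 by ring] at this
        rw [Q_succ]
        linear_combination (1 - x ^ (e + 1)) * this
    have hQ : Q x (2 * (n + 1) + 1) =
        Q x (2 * n + 1) * (1 - x ^ (2 * n + 2)) * (1 - x ^ (2 * n + 3)) := by
      rw [show 2 * (n + 1) + 1 = 2 * n + 1 + 1 + 1 by ring, Q_succ, Q_succ]
    intro d k h
    rw [hQ]
    cases k with
    | zero =>
      obtain rfl : d = n + 1 := by omega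
      have h0 := ih n 0 rfl
      have h1 := L n 0 rfl
      simp only [tri_succ, tri_zero, mul_zero, add_zero, zero_add, pow_zero, pow_one] at h0 h1 ⊢
      rw [bb, Q_succ x (n + 1)]
      rw [Q_succ x (n + 1)] at h1
      rw [Q_succ x n] at h0 h1 ⊢
      linear_combination (1 + x ^ (n + 1) + x ^ (2 * (n + 1))) * (1 - x ^ (n + 1)) *
        (1 - x ^ (n + 2)) * h0 - x ^ (n + 1) * (1 - x ^ (n + 1)) * h1
    | succ k =>
      have hd : d + k = n := by omega
      have h0 := ih d k hd
      have h1 := L d k hd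
      have h2 : bb x n (k + 2) * Q x d * Q x (d + 2 * k + 3) =
        (-1) ^ k * x ^ tri (k + 2) * ((1 - x ^ d) * (1 - x ^ (d - 1))) * Q x (2 * n + 1) := by
        cases d with
        | zero => rw [bb_zero x n (k + 2) (by omega)]; simp
        | succ e =>
          have := L e (k + 1) (by omega)
          rw [show e + 2 * (k + 1) + 2 = e + 1 + 2 * k + 3 by ring] at this
          rw [Q_succ]
          simp only [Nat.add_sub_cancel]
          linear_combination (1 - x ^ (e + 1)) * this
      have h3 : x ^ (d + 1) * ((1 - x ^ d) * (1 - x ^ (d - 1))) =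
          (1 - x ^ d) * (x ^ (d + 1) - x ^ (2 * d)) := by
        cases d with
        | zero => simp
        | succ e => simp only [Nat.add_sub_cancel]; ring
      rw [show d + 2 * (k + 1) + 1 = d + 2 * k + 3 by ring, bb]
      rw [Q_succ x (d + 2 * k + 2)] at h2 ⊢
      rw [Q_succ x (d + 2 * k + 1)] at h1 h2 ⊢
      rw [tri_succ (k + 1)] at h2
      rw [tri_succ k] at h1 h2 ⊢
      subst hd
      linear_combination (1 + x ^ (2 * (d + k + 1))) * (1 - x ^ (d + 2 * k + 3)) * h1
        - x ^ (d + k + 1) * (1 - x ^ (d + 2 * k + 2)) * (1 - x ^ (d + 2 * k + 3)) * h0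
        - x ^ (d + k + 1) * h2
        - (-1) ^ k * x ^ (tri k + 3 * k + 3) * Q x (2 * (d + k) + 1) * h3

lemma moment_step (n M : ℕ) :
    ∑ k ∈ range (M + 1), (2 * (k : A) + 1) * bb x (n + 1) k =
      (1 - x ^ (n + 1)) ^ 2 * ∑ k ∈ range (M + 1), (2 * (k : A) + 1) * bb x n k
      + x ^ (n + 1) * ((2 * M + 3) * bb x n M - (2 * M + 1) * bb x n (M + 1)) := by
  induction M with
  | zero => simp [bb]; ring
  | succ M ih =>
    rw [sum_range_succ, ih, sum_range_succ _ (M + 1), bb]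
    push_cast
    ring

lemma moment (n : ℕ) : ∀ M, n < M →
    ∑ k ∈ range M, (2 * (k : A) + 1) * bb x n k = Q x n ^ 2 := by
  induction n with
  | zero =>
    intro M hM
    rw [sum_eq_single 0]
    · simp [bb, Q_zero]
    · intro b _ hb
      rw [bb_zero x 0 b (by omega), mul_zero]
    · simp; omega
  | succ n ih =>
    intro M hM
    obtain ⟨M, rfl⟩ : ∃ M', M = M' + 1 := ⟨M - 1, by omega⟩
    rw [moment_step, ih _ (by omega), bb_zero x n M (by omega), bb_zero x n (M + 1) (by omega),
      Q_succ]
    ring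

lemma Q_dvd (d m : ℕ) : x ^ (d + 1) ∣ Q x (d + m) - Q x d := by
  induction m with
  | zero => simp
  | succ m ih =>
    rw [← add_assoc, Q_succ]
    have : x ^ (d + 1) ∣ Q x (d + m) * x ^ (d + m + 1) :=
      Dvd.dvd.mul_left (pow_dvd_pow x (by omega)) _
    convert dvd_sub ih this using 1
    ring

lemma Q_dvd' {d m : ℕ} (h : d ≤ m) : x ^ (d + 1) ∣ Q x m - Q x d := by
  obtain ⟨e, rfl⟩ := Nat.exists_eq_add_of_le h
  exact Q_dvd x d e

end gen

variable {R : Type*} [CommRing R]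

lemma Q_unit (n : ℕ) : IsUnit (Q (X : R⟦X⟧) n) := by
  rw [PowerSeries.isUnit_iff_constantCoeff]
  simp [Q, map_prod]

lemma jacobi (n : ℕ) : (X : R⟦X⟧) ^ (n + 1) ∣ Q X n ^ 3 -
    ∑ k ∈ range (n + 1), (2 * (k : R⟦X⟧) + 1) * ((-1) ^ k * X ^ tri k) := by
  have : Q (X : R⟦X⟧) n ^ 3 = ∑ k ∈ range (n + 1), (2 * (k : R⟦X⟧) + 1) * (bb X n k * Q X n) := by
    simp_rw [← mul_assoc]
    rw [← sum_mul, moment X n (n + 1) (by omega)]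
    ring
  rw [this, ← sum_sub_distrib]
  refine dvd_sum fun k hk => ?_
  rw [← mul_sub]
  refine Dvd.dvd.mul_left ?_ _
  obtain ⟨d, hd⟩ : ∃ d, d + k = n := ⟨n - k, by simp at hk; omega⟩
  have hu : IsUnit (Q (X : R⟦X⟧) d * Q X (d + 2 * k + 1)) := (Q_unit _).mul (Q_unit _)
  rw [← hu.dvd_mul_right]
  have hc := bb_closed (X : R⟦X⟧) n d k hd
  have h1 : (X : R⟦X⟧) ^ (d + 1) ∣ Q X (2 * n + 1) * Q X n - Q X d * Q X (d + 2 * k + 1) := by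
    have e1 := Q_dvd' (X : R⟦X⟧) (show d ≤ 2 * n + 1 by omega)
    have e2 := Q_dvd' (X : R⟦X⟧) (show d ≤ n by omega)
    have e3 := Q_dvd' (X : R⟦X⟧) (show d ≤ d + 2 * k + 1 by omega)
    have := dvd_sub (dvd_add (e1.mul_right (Q X n)) (e2.mul_left (Q X d))) (e3.mul_left (Q X d))
    convert this using 1
    ring
  have h2 : (X : R⟦X⟧) ^ (n + 1) ∣ X ^ tri k * X ^ (d + 1) := by
    rw [← pow_add]
    exact pow_dvd_pow _ (by have := le_tri k; omega)
  have h3 := (h2.trans (mul_dvd_mul_left (X ^ tri k) h1)).mul_left ((-1) ^ k)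
  convert h3 using 1
  linear_combination Q X n * hc

instance : Fact (Nat.Prime 7) := ⟨by norm_num⟩

lemma coeff_Q3 {m n : ℕ} (h : 7 * m + 6 ≤ n) :
    coeff (7 * m + 6) (Q (X : (ZMod 7)⟦X⟧) n ^ 3) = 0 := by
  have hj := X_pow_dvd_iff.1 (jacobi (R := ZMod 7) n) (7 * m + 6) (by omega)
  rw [map_sub, sub_eq_zero] at hj
  rw [hj, map_sum]
  refine sum_eq_zero fun k _ => ?_
  have e : (2 * (k : (ZMod 7)⟦X⟧) + 1) * ((-1) ^ k * X ^ tri k) =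
      C ((2 * (k : ZMod 7) + 1) * (-1) ^ k) * X ^ tri k := by
    have h2 : (C (2 : ZMod 7) : (ZMod 7)⟦X⟧) = 2 := map_ofNat C 2
    simp [mul_assoc, h2]
  rw [e, coeff_C_mul, coeff_X_pow]
  split_ifs with ht
  · have h2 := two_tri k
    rw [← ht] at h2
    have : (2 * k + 1) ^ 2 = 7 * (8 * m + 7) := by linarith
    have h7 : 7 ∣ 2 * k + 1 :=
      Nat.Prime.dvd_of_dvd_pow (n := 2) (by norm_num) (this ▸ Dvd.intro _ rfl)
    have := (ZMod.natCast_eq_zero_iff (2 * k + 1) 7).2 h7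
    push_cast at this
    rw [this]; simp
  · simp

lemma Q7 (n : ℕ) : Q (X : (ZMod 7)⟦X⟧) n ^ 7 = expand 7 (by norm_num) (Q X n) := by
  have : CharP (ZMod 7)⟦X⟧ 7 := charP_of_injective_algebraMap (R := ZMod 7) C_injective 7
  rw [Q, map_prod, ← prod_pow]
  refine prod_congr rfl fun i _ => ?_
  rw [sub_pow_char, map_sub, map_pow, expand_X, map_one, one_pow, ← pow_mul, ← pow_mul, mul_comm]

noncomputable def P : (ZMod 7)⟦X⟧ := PowerSeries.mk fun n => (Fintype.card (Nat.Partition n) : ZMod 7)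

open scoped PowerSeries.WithPiTopology in
lemma P_mul : P * pentagonalSeries (ZMod 7) = 1 := by
  let : TopologicalSpace (ZMod 7) := ⊥
  have : DiscreteTopology (ZMod 7) := ⟨rfl⟩
  have h1 := Nat.Partition.hasProd_powerSeriesMk_card_restricted (ZMod 7) (fun _ => True)
  have h2 := PowerSeries.WithPiTopology.hasProd_one_sub_X_pow (ZMod 7)
  have h3 := h1.mul h2
  have hP : (PowerSeries.mk fun n ↦ (#(Nat.Partition.restricted n (fun _ => True)) : ZMod 7)) = P := by
    simp [P, Nat.Partition.restricted]
  rw [hP] at h3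
  refine h3.unique ?_
  convert hasProd_one using 2 with i
  simp only [if_true, pow_mul]
  rw [WithPiTopology.tsum_pow_mul_one_sub_of_constantCoeff_eq_zero (by simp)]

lemma pent_dvd (n : ℕ) : (X : (ZMod 7)⟦X⟧) ^ (n + 1) ∣ pentagonalSeries (ZMod 7) - Q X n := by
  rw [X_pow_dvd_iff]
  intro m hm
  obtain ⟨s, hs⟩ := Filter.eventually_atTop.1 (coeff_prod_one_sub_X_pow_eventually_eq (ZMod 7) m)
  obtain ⟨M, hM⟩ := s.exists_nat_subset_range
  have h1 := hs (range (n + M)) (hM.trans (range_subset_range.2 (by omega)))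
  have h2 := X_pow_dvd_iff.1 (Q_dvd (X : (ZMod 7)⟦X⟧) n M) m hm
  rw [map_sub] at h2 ⊢
  rw [← h1]
  exact h2

lemma P4 (N : ℕ) : (X : (ZMod 7)⟦X⟧) ^ (N + 1) ∣ P ^ 4 * Q X N ^ 7 - Q X N ^ 3 := by
  have h := (pent_dvd N).mul_left P
  rw [mul_sub, P_mul] at h
  have h2 : (1 - P * Q X N) ∣ P ^ 4 * Q X N ^ 7 - Q X N ^ 3 :=
    ⟨-(Q X N ^ 3 * (1 + P * Q X N + (P * Q X N) ^ 2 + (P * Q X N) ^ 3)), by ring⟩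
  exact h.trans h2

lemma P4_coeff (n : ℕ) : coeff (7 * n + 6) (P ^ 4) = 0 := by
  induction n using Nat.strong_induction_on with
  | _ n ih =>
    have h := X_pow_dvd_iff.1 (P4 (7 * n + 6)) (7 * n + 6) (by omega)
    rw [map_sub, coeff_Q3 le_rfl, sub_zero, Q7, coeff_mul,
      sum_eq_single (7 * n + 6, 0)] at h
    · simpa [Q, constantCoeff_expand] using h
    · rintro ⟨i, j⟩ hij hne
      simp only [HasAntidiagonal.mem_antidiagonal] at hij
      dsimp only
      by_cases hj : 7 ∣ j
      · obtain ⟨t, rfl⟩ := hj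
        have ht : t ≠ 0 := by
          rintro rfl
          exact hne (by simp; omega)
        obtain rfl : i = 7 * (n - t) + 6 := by omega
        rw [ih (n - t) (by omega), zero_mul]
      · rw [coeff_expand_of_not_dvd _ _ _ hj, mul_zero]
    · simp

lemma cast_mp (r n : ℕ) : (multipartition r n : ZMod 7) = coeff n (P ^ r) := by
  have : P ^ r = ∏ _i : Fin r, P := by simp
  rw [this, coeff_prod, multipartition]
  push_cast
  symm
  refine sum_equiv Finsupp.equivFunOnFinite ?_ ?_
  · intro l
    simp [Finset.Nat.mem_antidiagonalTuple]
  · intro l _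
    simp [P]

end MP47

theorem multipartition_four_seven (n : ℕ) : 7 ∣ multipartition 4 (7 * n + 6) := by
  rw [← ZMod.natCast_eq_zero_iff, MP47.cast_mp, MP47.P4_coeff]
end

section
/- For every nonnegative integer n, p_4(49n + 41) ≡ 0 (mod 49). -/
open PowerSeries Finset

namespace MP49

/-- q-Pochhammer -/
noncomputable def qp (n : ℕ) : ℤ⟦X⟧ := ∏ i ∈ range n, (1 - X ^ (i + 1))

lemma qp_succ (n : ℕ) : qp (n + 1) = qp n * (1 - X ^ (n + 1)) := prod_range_succ _ _

noncomputable def gb : ℕ → ℕ → ℤ⟦X⟧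
  | _, 0 => 1
  | 0, _ + 1 => 0
  | n + 1, k + 1 => gb n k + X ^ (k + 1) * gb n (k + 1)

lemma gb_zero (n : ℕ) : gb n 0 = 1 := by cases n <;> rfl
lemma gb_succ (n k : ℕ) : gb (n + 1) (k + 1) = gb n k + X ^ (k + 1) * gb n (k + 1) := rfl
lemma gb_lt : ∀ (n k : ℕ), n < k → gb n k = 0
  | 0, k + 1, _ => rfl
  | n + 1, k + 1, h => by
    rw [gb_succ, gb_lt n k (by omega), gb_lt n (k + 1) (by omega)]; simp

lemma gb_mul : ∀ (m k : ℕ), gb (m + k) k * qp k * qp m = qp (m + k)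
  | m, 0 => by simp [gb_zero, qp]
  | 0, k + 1 => by
    have h1 := gb_mul 0 k
    rw [Nat.zero_add] at h1
    rw [Nat.zero_add, gb_succ, gb_lt k (k + 1) (by omega), qp_succ]
    linear_combination (1 - X ^ (k + 1)) * h1
  | m + 1, k + 1 => by
    have h1 := gb_mul (m + 1) k
    have h2 := gb_mul m (k + 1)
    rw [show m + 1 + k = m + (k + 1) by ring] at h1
    rw [show m + 1 + (k + 1) = (m + (k + 1)) + 1 by ring, gb_succ, qp_succ (m + (k + 1))]
    have e1 := qp_succ k
    have e2 := qp_succ m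
    rw [e1] at h2 ⊢
    rw [e2] at h1 ⊢
    have : (X : ℤ⟦X⟧) ^ (m + (k + 1) + 1) = X ^ (m + 1) * X ^ (k + 1) := by
      rw [← pow_add]; congr 1; ring
    rw [this]
    linear_combination (1 - X ^ (k + 1)) * h1 + (X ^ (k + 1) * (1 - X ^ (m + 1))) * h2

/-- exponent -/
def tri (j : ℕ) : ℕ := ∑ i ∈ range j, i
lemma tri_succ (j : ℕ) : tri (j + 1) = tri j + j := sum_range_succ _ _
lemma two_tri (j : ℕ) : 2 * tri (j+1) = j * (j + 1) := by
  induction j with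
  | zero => simp [tri]
  | succ j ih => rw [tri_succ, mul_add, ih]; ring

open Polynomial in
lemma qbinom (N : ℕ) : ∀ (y : ℤ⟦X⟧),
    ∏ i ∈ range N, ((Polynomial.X : Polynomial ℤ⟦X⟧) - Polynomial.C (y * PowerSeries.X ^ i)) =
    ∑ j ∈ range (N + 1), Polynomial.C ((-1) ^ j * PowerSeries.X ^ tri j * gb N j * y ^ j) *
      Polynomial.X ^ (N - j) := by
  induction N with
  | zero => intro y; simp [tri, gb_zero]
  | succ N ih =>
    intro y
    have h : ∏ i ∈ range N, ((Polynomial.X : Polynomial ℤ⟦X⟧)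
        - Polynomial.C (y * PowerSeries.X ^ (i + 1))) = ∑ j ∈ range (N + 1), Polynomial.C ((-1) ^ j * PowerSeries.X ^ tri j * gb N j * (y * PowerSeries.X) ^ j) *
      Polynomial.X ^ (N - j) := by
      rw [← ih (y * PowerSeries.X)]
      refine prod_congr rfl fun i _ => ?_
      congr 2; ring
    rw [prod_range_succ', h, mul_sub, pow_zero, mul_one, sum_mul, sum_mul]
    rw [sum_range_succ' _ (N + 1)]
    simp only [gb_succ]
    have h1 : ∑ i ∈ range (N + 1), Polynomial.C ((-1) ^ i * PowerSeries.X ^ tri i * gb N i * (y * PowerSeries.X) ^ i) *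
      (Polynomial.X : Polynomial ℤ⟦X⟧) ^ (N - i) * Polynomial.X =
      ∑ i ∈ range (N + 1), Polynomial.C ((-1) ^ i * PowerSeries.X ^ tri i * (PowerSeries.X ^ i * gb N i) * y ^ i) *
      Polynomial.X ^ (N + 1 - i) := by
      refine sum_congr rfl fun i hi => ?_
      have : N + 1 - i = N - i + 1 := by have := mem_range.1 hi; omega
      rw [this, pow_succ, mul_assoc]; congr 2; ring
    have h2 : ∑ i ∈ range (N + 1), Polynomial.C ((-1) ^ i * PowerSeries.X ^ tri i * (PowerSeries.X ^ i * gb N i) * y ^ i) *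
      (Polynomial.X : Polynomial ℤ⟦X⟧) ^ (N + 1 - i) = 
      ∑ i ∈ range (N + 1), Polynomial.C ((-1) ^ (i+1) * PowerSeries.X ^ tri (i+1) * (PowerSeries.X ^ (i+1) * gb N (i+1)) * y ^ (i+1)) *
      (Polynomial.X : Polynomial ℤ⟦X⟧) ^ (N + 1 - (i+1)) + Polynomial.X ^ (N+1) := by
      have := sum_range_succ' (fun i => Polynomial.C ((-1) ^ i * PowerSeries.X ^ tri i * (PowerSeries.X ^ i * gb N i) * y ^ i) *
      (Polynomial.X : Polynomial ℤ⟦X⟧) ^ (N + 1 - i)) (N+1)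
      rw [sum_range_succ] at this
      simpa [gb_lt N (N+1) (by omega), gb_zero, tri] using this
    rw [h1, h2, add_sub_right_comm, ← sum_sub_distrib]
    congr 1
    · refine sum_congr rfl fun i hi => ?_
      rw [Nat.add_sub_add_right, mul_right_comm _ (Polynomial.X ^ (N - i)) (Polynomial.C y), ← Polynomial.C_mul, ← sub_mul, ← Polynomial.C_sub]
      congr 2
      rw [tri_succ]; ring
    · simp [tri, gb_zero]

/-- derivative at X^n, N = 2n+1 -/
lemma fin_jac0 (n : ℕ) : (-1) ^ n * X ^ (tri n + n * n) * qp n ^ 2 =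
    ∑ j ∈ range (2 * n + 2), (-1) ^ j * X ^ tri j * gb (2 * n + 1) j *
      (((2 * n + 1 - j : ℕ) : ℤ⟦X⟧) * X ^ (n * (2 * n + 1 - j - 1))) := by
  have h := congrArg (fun p => (Polynomial.derivative p).eval (X ^ n)) (qbinom (2 * n + 1) 1)
  simp only [one_mul, one_pow, mul_one] at h
  rw [Polynomial.derivative_sum, Polynomial.eval_finsetSum] at h
  simp only [Polynomial.derivative_C_mul_X_pow, Polynomial.eval_mul, Polynomial.eval_C,
    Polynomial.eval_pow, Polynomial.eval_X, ← pow_mul] at h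
  have h2 : ∏ i ∈ range (2 * n + 1), ((Polynomial.X : Polynomial ℤ⟦X⟧) - Polynomial.C (X ^ i)) =
     (Polynomial.X - Polynomial.C (X ^ n)) *
      ((∏ i ∈ range n, (Polynomial.X - Polynomial.C (X ^ i))) *
     (∏ i ∈ range n, (Polynomial.X - Polynomial.C (X ^ (n + 1 + i))))) := by
    rw [show 2 * n + 1 = n + 1 + n by ring, prod_range_add, prod_range_succ]; ring
  rw [h2] at h
  simp only [Polynomial.derivative_mul, Polynomial.eval_add, Polynomial.eval_mul,
    Polynomial.derivative_sub, Polynomial.derivative_X, Polynomial.derivative_C, sub_zero,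
    Polynomial.eval_sub, Polynomial.eval_X, Polynomial.eval_C, sub_self,
    zero_mul, add_zero, one_mul, Polynomial.eval_prod] at h
  have a1 : ∏ i ∈ range n, ((X : ℤ⟦X⟧) ^ n - X ^ i) = (-1) ^ n * X ^ tri n * qp n := by
    have e1 : ∀ i ∈ range n, ((X : ℤ⟦X⟧) ^ n - X ^ i) = (-1) * X ^ i * (1 - X ^ (n - 1 - i + 1)) := by
      intro i hi
      have := mem_range.1 hi
      have e : (X : ℤ⟦X⟧) ^ n = X ^ i * X ^ (n - 1 - i + 1) := by rw [← pow_add]; congr 1; omega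
      rw [e]; ring
    rw [prod_congr rfl e1, prod_mul_distrib, prod_mul_distrib, prod_const, card_range,
      prod_range_reflect (fun i => (1 - (X : ℤ⟦X⟧) ^ (i + 1))) n, prod_pow_eq_pow_sum]
    rfl
  have a2 : ∏ i ∈ range n, ((X : ℤ⟦X⟧) ^ n - X ^ (n + 1 + i)) = X ^ (n * n) * qp n := by
    have e1 : ∀ i ∈ range n, ((X : ℤ⟦X⟧) ^ n - X ^ (n + 1 + i)) = X ^ n * (1 - X ^ (i + 1)) := by
      intro i hi
      rw [mul_sub, ← pow_add, mul_one]; congr 2; ring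
    rw [prod_congr rfl e1, prod_mul_distrib, prod_const, card_range, ← pow_mul]
    rfl
  rw [a1, a2] at h
  rw [← Nat.add_assoc (2*n) 1 1] 
  calc _ = _ := by ring
    _ = _ := h
    _ = _ := by
      refine sum_congr rfl fun j _ => ?_
      ring

lemma gb_symm (m k : ℕ) : gb (m + k) k = gb (m + k) m := by
  have h1 := gb_mul m k
  have h2 := gb_mul k m
  rw [add_comm k m] at h2
  have hq : ∀ n, qp n ≠ 0 := fun n h => by
    have := congrArg (PowerSeries.constantCoeff (R := ℤ)) h
    simp [qp] at this
  have h3 : gb (m + k) k * (qp k * qp m) = gb (m + k) m * (qp k * qp m) := by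
    linear_combination h1 - h2
  exact mul_right_cancel₀ (mul_ne_zero (hq _) (hq _)) h3

lemma fin_jac (n : ℕ) : qp n ^ 2 =
    ∑ k ∈ range (n + 1), ((-1) ^ k * (2 * k + 1 : ℤ⟦X⟧)) * X ^ tri (k + 1) * gb (2 * n + 1) (n - k) := by
  have h := fin_jac0 n
  rw [show 2 * n + 2 = (n + 1) + (n + 1) by ring, sum_range_add _ (n+1) (n+1),
    ← sum_range_reflect _ (n + 1), ← sum_add_distrib] at h
  have key : ∀ k ∈ range (n + 1), ((-1) ^ (n + 1 - 1 - k) * X ^ tri (n + 1 - 1 - k) * gb (2 * n + 1) (n + 1 - 1 - k) *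
      (((2 * n + 1 - (n + 1 - 1 - k) : ℕ) : ℤ⟦X⟧) * X ^ (n * (2 * n + 1 - (n + 1 - 1 - k) - 1)))
      + (-1) ^ (n + 1 + k) * X ^ tri (n + 1 + k) * gb (2 * n + 1) (n + 1 + k) *
      (((2 * n + 1 - (n + 1 + k) : ℕ) : ℤ⟦X⟧) * X ^ (n * (2 * n + 1 - (n + 1 + k) - 1))))
      = (-1) ^ n * X ^ (tri n + n * n) * (((-1) ^ k * (2 * k + 1 : ℤ⟦X⟧)) * X ^ tri (k + 1) * gb (2 * n + 1) (n - k)) := by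
    intro k hk
    obtain ⟨m, rfl⟩ : ∃ m, n = k + m := ⟨n - k, by have := mem_range.1 hk; omega⟩
    have i1 : k + m + 1 - 1 - k = m := by omega
    have i2 : 2 * (k + m) + 1 - m = 2 * k + m + 1 := by omega
    have i3 : 2 * (k + m) + 1 - (k + m + 1 + k) = m := by omega
    have i4 : k + m - k = m := by omega
    have g1 : gb (2 * (k + m) + 1) (k + m + 1 + k) = gb (2 * (k + m) + 1) m := by
      have := gb_symm m (k + m + 1 + k)
      rwa [show m + (k + m + 1 + k) = 2 * (k + m) + 1 by ring] at this
    have t1 : tri m + (k + m) * (2 * k + m + 1 - 1) = tri (k + m) + (k + m) * (k + m) + tri (k + 1) := by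
      have ht : ∀ j, 2 * tri j + j = j * j := by
        intro j
        cases j with
        | zero => simp [tri]
        | succ j => rw [two_tri]; ring
      have a := ht m
      have b := ht (k + m)
      have c := two_tri k
      rw [Nat.add_sub_cancel]
      nlinarith
    have t2 : m = 0 ∨ tri (k + m + 1 + k) + (k + m) * (m - 1) = tri (k + m) + (k + m) * (k + m) + tri (k + 1) := by
      rcases m with _ | m
      · left; rfl
      right
      have ht : ∀ j, 2 * tri j + j = j * j := by
        intro j
        cases j with
        | zero => simp [tri]
        | succ j => rw [two_tri]; ring
      have a := ht (k + (m + 1) + 1 + k)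
      have b := ht (k + (m + 1))
      have c := two_tri k
      rw [Nat.add_sub_cancel]
      nlinarith
    rw [i1, i2, i3, i4, g1]
    have s1 : ((-1 : ℤ⟦X⟧)) ^ m = (-1) ^ (k + m) * (-1) ^ k := by
      rw [pow_add]; have : ((-1 : ℤ⟦X⟧)) ^ k * (-1) ^ k = 1 := by rw [← mul_pow]; simp
      linear_combination (-(-1 : ℤ⟦X⟧) ^ m) * this
    have p1 : (X : ℤ⟦X⟧) ^ tri m * X ^ ((k + m) * (2 * k + m + 1 - 1)) = X ^ (tri (k + m) + (k + m) * (k + m)) * X ^ tri (k + 1) := by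
      rw [← pow_add, ← pow_add, t1]
    have p2 : (m : ℤ⟦X⟧) * ((X : ℤ⟦X⟧) ^ tri (k + m + 1 + k) * (X : ℤ⟦X⟧) ^ ((k + m) * (m - 1))) = (m : ℤ⟦X⟧) * ((X : ℤ⟦X⟧) ^ (tri (k + m) + (k + m) * (k + m)) * (X : ℤ⟦X⟧) ^ tri (k + 1)) := by
      rcases t2 with h | h
      · rw [h]; simp
      · rw [← pow_add, ← pow_add, h]
    have s2 : ((-1 : ℤ⟦X⟧)) ^ (k + m + 1 + k) = - ((-1) ^ (k + m) * (-1) ^ k) := by ring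
    rw [Nat.add_sub_cancel] at p1
    rw [s2, s1]
    push_cast
    linear_combination ((-1) ^ (k + m) * (-1) ^ k * gb (2 * (k + m) + 1) m) * ((2 * k + m + 1) * p1 - p2)
  rw [sum_congr rfl key, ← mul_sum] at h
  refine mul_left_cancel₀ ?_ h
  have hX : (X : ℤ⟦X⟧) ≠ 0 := PowerSeries.X_ne_zero
  have h1 : (-1 : ℤ⟦X⟧) ≠ 0 := neg_ne_zero.2 one_ne_zero
  exact mul_ne_zero (pow_ne_zero _ h1) (pow_ne_zero _ hX)


noncomputable def E : ℤ⟦X⟧ := pentagonalSeries ℤ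

lemma coeff_qp_stable (d n m : ℕ) (h : d ≤ n) (hm : n ≤ m) : coeff d (qp m) = coeff d (qp n) := by
  induction m, hm using Nat.le_induction with
  | base => rfl
  | succ m hm ih =>
    rw [qp_succ, mul_sub, mul_one, map_sub, ih, PowerSeries.coeff_mul_X_pow', if_neg (by omega), sub_zero]

lemma coeff_qp (d n : ℕ) (h : d ≤ n) : coeff d (qp n) = coeff d E := by
  obtain ⟨s, hs⟩ := Filter.eventually_atTop.1 (coeff_prod_one_sub_X_pow_eventually_eq ℤ d)
  obtain ⟨M, hM⟩ := s.exists_nat_subset_range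
  have := hs (range (max M n)) (hM.trans (range_mono (le_max_left _ _)))
  rw [← coeff_qp_stable d n (max M n) h (le_max_right _ _)]
  exact this

lemma constE : constantCoeff E = 1 := by
  rw [← coeff_zero_eq_constantCoeff_apply, ← coeff_qp 0 0 le_rfl]; simp [qp]

lemma qp_E (d n : ℕ) (h : d ≤ n) : (X : ℤ⟦X⟧) ^ (d + 1) ∣ qp n - E := by
  rw [X_pow_dvd_iff]
  intro m hm
  rw [map_sub, coeff_qp m n (by omega), sub_self]

lemma unitE : IsUnit E := by
  rw [isUnit_iff_constantCoeff, constE]; exact isUnit_one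

lemma gb_E (d n k : ℕ) (h1 : k + d ≤ n) : (X : ℤ⟦X⟧) ^ (d + 1) ∣ gb (2 * n + 1) (n - k) * E - 1 := by
  have h := gb_mul (n + k + 1) (n - k)
  rw [show n + k + 1 + (n - k) = 2 * n + 1 by omega] at h
  let φ := Ideal.Quotient.mk (Ideal.span {(X : ℤ⟦X⟧) ^ (d + 1)})
  have hφ : ∀ m, d ≤ m → φ (qp m) = φ E := fun m hm => by
    rw [Ideal.Quotient.eq, Ideal.mem_span_singleton]; exact qp_E d m hm
  have h3 := congrArg φ h
  rw [map_mul, map_mul, hφ _ (by omega), hφ _ (by omega), hφ _ (by omega)] at h3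
  rw [← Ideal.mem_span_singleton, ← Ideal.Quotient.eq]
  have hu : IsUnit (φ E) := unitE.map φ
  refine hu.mul_right_cancel ?_
  change φ _ * φ E = φ 1 * φ E
  rw [map_mul, map_one, one_mul, h3]

lemma jacobi (d : ℕ) : coeff d (E ^ 3) =
    ∑ k ∈ range (2 * d + 1), if tri (k + 1) = d then (-1) ^ k * (2 * k + 1 : ℤ) else 0 := by
  have h : (X : ℤ⟦X⟧) ^ (d + 1) ∣ E ^ 3 -
      ∑ k ∈ range (2 * d + 1), ((-1) ^ k * (2 * k + 1 : ℤ⟦X⟧)) * X ^ tri (k + 1) := by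
    have a : E ^ 3 - ∑ k ∈ range (2 * d + 1), ((-1) ^ k * (2 * k + 1 : ℤ⟦X⟧)) * X ^ tri (k + 1)
      = - (qp (2 * d) - E) * (qp (2 * d) + E) * E + ∑ k ∈ range (2 * d + 1), ((-1) ^ k * (2 * k + 1 : ℤ⟦X⟧)) * (X ^ tri (k + 1) * (gb (2 * (2 * d) + 1) (2 * d - k) * E - 1)) := by
      have := fin_jac (2 * d)
      have e : ∑ k ∈ range (2 * d + 1), ((-1) ^ k * (2 * k + 1 : ℤ⟦X⟧)) * (X ^ tri (k + 1) * (gb (2 * (2 * d) + 1) (2 * d - k) * E - 1)) = qp (2 * d) ^ 2 * E - ∑ k ∈ range (2 * d + 1), ((-1) ^ k * (2 * k + 1 : ℤ⟦X⟧)) * X ^ tri (k + 1) := by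
        rw [this, sum_mul, ← sum_sub_distrib]
        refine sum_congr rfl fun k _ => ?_
        ring
      rw [e]; ring
    rw [a]
    refine dvd_add ?_ (dvd_sum fun k hk => ?_)
    · exact ((dvd_neg.2 (qp_E d _ (by omega))).mul_right _).mul_right _
    · refine Dvd.dvd.mul_left ?_ _
      by_cases hk : k ≤ d
      · exact (gb_E d _ _ (by omega)).mul_left _
      · refine (pow_dvd_pow _ ?_).mul_right _
        have := two_tri k
        push Not at hk
        nlinarith
  have h2 := X_pow_dvd_iff.1 h d (by omega)
  rw [map_sub, sub_eq_zero] at h2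
  rw [h2, map_sum]
  refine sum_congr rfl fun k _ => ?_
  have : ((-1) ^ k * (2 * k + 1 : ℤ⟦X⟧)) = C ((-1) ^ k * (2 * k + 1 : ℤ)) := by simp
  rw [this, coeff_C_mul, coeff_X_pow]
  simp [eq_comm]

end MP49
open PowerSeries Finset
namespace MP49

lemma alg {R K : Type*} [CommRing R] [CommRing K] [Algebra R K] [IsDomain K] (h7 : (7 : K) = 0)
    (θ : Derivation R K K) (e x P : K) (he : e ≠ 0) (hθ : θ e = 5 * (P - 1) * e) (hx : θ x = x)
    (D D5 : K → K) (hD : ∀ f, D f = θ f + f) (hD5 : ∀ f, D5 f = θ f + 5 * f)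
    (k2 : D (D (D (e ^ 3))) = e ^ 3) (k3 : D5 (D5 (D5 e)) + e = - (x ^ 2 * e ^ 49)) :
    e ^ 3 * θ (θ (θ (θ (θ P)))) - D (D (D (D (D (D (e ^ 3 * θ (θ (θ (θ (θ P)))))))))) =
      3 * x ^ 6 * e ^ 147 := by
  have hn : ∀ (n : ℕ) [n.AtLeastTwo], θ (OfNat.ofNat n : K) = 0 := fun n _ => θ.map_natCast n
  have hDe0 : ∀ p, D (e ^ 3 * p) = e ^ 3 * (P * p + θ p) := by
    intro p
    rw [hD]
    simp only [Derivation.leibniz, Derivation.leibniz_pow, hθ, smul_eq_mul, nsmul_eq_mul]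
    push_cast
    linear_combination (2 * (P - 1) * e ^ 3 * p) * h7
  have hD5e : ∀ p, D5 (e * p) = e * (5 * P * p + θ p) := by
    intro p
    rw [hD5]
    simp only [Derivation.leibniz, hθ, smul_eq_mul]
    ring
  have r1 : θ (θ P) = 1 - 3 * P * θ P - P ^ 3 := by
    have a := hDe0 1
    rw [mul_one, mul_one, Derivation.map_one_eq_zero, add_zero] at a
    rw [a, hDe0, hDe0] at k2
    have b : P * (P * P + θ P) + θ (P * P + θ P) = 1 :=
      mul_left_cancel₀ (pow_ne_zero 3 he) (by rw [k2, mul_one])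
    simp only [map_add, Derivation.leibniz, smul_eq_mul] at b
    linear_combination b
  have s1 : e * (P ^ 3 + 4 * P * θ P + 6) = - (x ^ 2 * e ^ 49) := by
    have a := hD5e 1
    rw [mul_one, mul_one, Derivation.map_one_eq_zero, add_zero] at a
    rw [a, hD5e, hD5e] at k3
    simp only [map_add, Derivation.leibniz, smul_eq_mul, hn, map_zero] at k3
    rw [r1] at k3
    linear_combination k3 - e * h7 * (17 * P ^ 3 + 8 * P * θ P )
  have r2 : (P ^ 2 + 2 * θ P) ^ 2 = P := by
    have a := hD5e (P ^ 3 + 4 * P * θ P + 6)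
    rw [s1, hD5] at a
    simp only [map_neg, map_add, Derivation.leibniz, Derivation.leibniz_pow, smul_eq_mul, hn, r1, hx, hθ, nsmul_eq_mul] at a
    push_cast at a
    have b : e * ((P ^ 2 + 2 * θ P) ^ 2) = e * P := by
      linear_combination - a - h7 * (x ^ 2 * e ^ 49 + 35 * x^2 * e^49 * (P - 1) + e * (P * 5 + P ^ 2 * θ P))
    exact mul_left_cancel₀ he b
  obtain ⟨Q, hQ⟩ : ∃ Q, Q = P ^ 2 + 2 * θ P := ⟨_, rfl⟩
  rw [← hQ] at r2
  have hQ0 : Q ≠ 0 := by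
    rintro rfl
    have hP : P = 0 := by rw [← r2]; ring
    rw [hP] at r1
    simp at r1
  have hQ' : θ Q = 2 - 2 * Q ^ 3 := by
    have a := congrArg θ r2
    simp only [Derivation.leibniz_pow, smul_eq_mul, nsmul_eq_mul] at a
    push_cast at a
    have b : Q * θ Q = Q * (2 - 2 * Q ^ 3) := by
      linear_combination 4 * a - 2 * hQ + 2 * (Q ^ 2 + P) * r2 - Q * θ Q * h7
    exact mul_left_cancel₀ hQ0 b
  have hP1 : θ P = 4 * Q + 3 * Q ^ 4 := by
    linear_combination (-4 : K) * hQ + 4 * (P + Q ^ 2) * r2 - (θ P + Q ^ 4) * h7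
  have hdel : x ^ 2 * e ^ 48 = 1 - 2 * Q ^ 3 + Q ^ 6 := by
    have a : e * (x ^ 2 * e ^ 48) = e * (1 - 2 * Q ^ 3 + Q ^ 6) := by
      rw [hP1, ← r2] at s1
      linear_combination s1 - e * h7 * (1 + 2 * Q ^ 3 + 2 * Q ^ 6)
    exact mul_left_cancel₀ he a
  have hDe : ∀ p, D (e ^ 3 * p) = e ^ 3 * (Q ^ 2 * p + θ p) := by rw [r2]; exact hDe0
  have f1 : θ (Q ^ 2) = 4 * Q ^ 1 + 3 * Q ^ 4 := by
    simp [Derivation.leibniz, Derivation.leibniz_pow, hn, hQ']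
    linear_combination ((-1) * Q ^ 4) * h7
  have f2 : θ (4 * Q ^ 1 + 3 * Q ^ 4) = 1 + 2 * Q ^ 3 + 4 * Q ^ 6 := by
    simp [Derivation.leibniz, Derivation.leibniz_pow, hn, hQ']
    linear_combination ((1) + (2) * Q ^ 3 + (-4) * Q ^ 6) * h7
  have f3 : θ (1 + 2 * Q ^ 3 + 4 * Q ^ 6) = 5 * Q ^ 2 + Q ^ 5 + Q ^ 8 := by
    simp [Derivation.leibniz, Derivation.leibniz_pow, hn, hQ']
    linear_combination ((1) * Q ^ 2 + (5) * Q ^ 5 + (-7) * Q ^ 8) * h7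
  have f4 : θ (5 * Q ^ 2 + Q ^ 5 + Q ^ 8) = 6 * Q ^ 1 + 4 * Q ^ 4 + 6 * Q ^ 7 + 5 * Q ^ 10 := by
    simp [Derivation.leibniz, Derivation.leibniz_pow, hn, hQ']
    linear_combination ((2) * Q ^ 1 + (-2) * Q ^ 4 + (-3) * Q ^ 10) * h7
  have f5 : θ (6 * Q ^ 1 + 4 * Q ^ 4 + 6 * Q ^ 7 + 5 * Q ^ 10) = 5 + 6 * Q ^ 3 + 3 * Q ^ 6 + 2 * Q ^ 9 + 5 * Q ^ 12 := by
    simp [Derivation.leibniz, Derivation.leibniz_pow, hn, hQ']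
    linear_combination ((1) + (2) * Q ^ 3 + (7) * Q ^ 6 + (2) * Q ^ 9 + (-15) * Q ^ 12) * h7
  have g1 : D (e ^ 3 * (5 + 6 * Q ^ 3 + 3 * Q ^ 6 + 2 * Q ^ 9 + 5 * Q ^ 12)) = e ^ 3 * (6 * Q ^ 2 + 6 * Q ^ 5 + 3 * Q ^ 8 + 2 * Q ^ 11 + 4 * Q ^ 14) := by
    rw [hDe]
    congr 1
    simp [Derivation.leibniz, Derivation.leibniz_pow, hn, hQ']
    linear_combination ((5) * Q ^ 2 + (12) * Q ^ 11 + (-17) * Q ^ 14) * h7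
  have g2 : D (e ^ 3 * (6 * Q ^ 2 + 6 * Q ^ 5 + 3 * Q ^ 8 + 2 * Q ^ 11 + 4 * Q ^ 14)) = e ^ 3 * (3 * Q ^ 1 + Q ^ 7 + 6 * Q ^ 10 + 4 * Q ^ 16) := by
    rw [hDe]
    congr 1
    simp [Derivation.leibniz, Derivation.leibniz_pow, hn, hQ']
    linear_combination ((3) * Q ^ 1 + (6) * Q ^ 4 + (-1) * Q ^ 7 + (-1) * Q ^ 10 + (10) * Q ^ 13 + (-16) * Q ^ 16) * h7
  have g3 : D (e ^ 3 * (3 * Q ^ 1 + Q ^ 7 + 6 * Q ^ 10 + 4 * Q ^ 16)) = e ^ 3 * (6 + 4 * Q ^ 3 + 2 * Q ^ 9 + 5 * Q ^ 12 + 2 * Q ^ 15 + 2 * Q ^ 18) := by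
    rw [hDe]
    congr 1
    simp [Derivation.leibniz, Derivation.leibniz_pow, hn, hQ']
    linear_combination ((-1) * Q ^ 3 + (2) * Q ^ 6 + (15) * Q ^ 9 + (-17) * Q ^ 12 + (18) * Q ^ 15 + (-18) * Q ^ 18) * h7
  have g4 : D (e ^ 3 * (6 + 4 * Q ^ 3 + 2 * Q ^ 9 + 5 * Q ^ 12 + 2 * Q ^ 15 + 2 * Q ^ 18)) = e ^ 3 * (2 * Q ^ 2 + Q ^ 5 + Q ^ 8 + 2 * Q ^ 11 + Q ^ 14) := by
    rw [hDe]
    congr 1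
    simp [Derivation.leibniz, Derivation.leibniz_pow, hn, hQ']
    linear_combination ((4) * Q ^ 2 + (-3) * Q ^ 5 + (5) * Q ^ 8 + (12) * Q ^ 11 + (-8) * Q ^ 14 + (2) * Q ^ 17 + (-10) * Q ^ 20) * h7
  have g5 : D (e ^ 3 * (2 * Q ^ 2 + Q ^ 5 + Q ^ 8 + 2 * Q ^ 11 + Q ^ 14)) = e ^ 3 * (Q ^ 1 + 4 * Q ^ 4 + Q ^ 10 + Q ^ 16) := by
    rw [hDe]
    congr 1
    simp [Derivation.leibniz, Derivation.leibniz_pow, hn, hQ']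
    linear_combination ((1) * Q ^ 1 + (1) * Q ^ 7 + (4) * Q ^ 10 + (-2) * Q ^ 13 + (-4) * Q ^ 16) * h7
  have g6 : D (e ^ 3 * (Q ^ 1 + 4 * Q ^ 4 + Q ^ 10 + Q ^ 16)) = e ^ 3 * (2 + 3 * Q ^ 3 + 6 * Q ^ 9 + 2 * Q ^ 12 + 4 * Q ^ 15 + 4 * Q ^ 18) := by
    rw [hDe]
    congr 1
    simp [Derivation.leibniz, Derivation.leibniz_pow, hn, hQ']
    linear_combination ((4) * Q ^ 3 + (-4) * Q ^ 6 + (2) * Q ^ 9 + (-3) * Q ^ 12 + (4) * Q ^ 15 + (-5) * Q ^ 18) * h7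
  have final : e ^ 3 * (5 + 6 * Q ^ 3 + 3 * Q ^ 6 + 2 * Q ^ 9 + 5 * Q ^ 12) - e ^ 3 * (2 + 3 * Q ^ 3 + 6 * Q ^ 9 + 2 * Q ^ 12 + 4 * Q ^ 15 + 4 * Q ^ 18) = 3 * x ^ 6 * e ^ 147 := by
    have h2 : x ^ 6 * e ^ 144 = (1 - 2 * Q ^ 3 + Q ^ 6) ^ 3 := by rw [← hdel]; ring
    linear_combination e ^ 3 * ((3) * Q ^ 3 + (-6) * Q ^ 6 + (8) * Q ^ 9 + (-6) * Q ^ 12 + (2) * Q ^ 15 + (-1) * Q ^ 18) * h7 - 3 * e ^ 3 * h2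
  rw [← r2, f1, f2, f3, f4, f5, g1, g2, g3, g4, g5, g6]
  exact final

end MP49
open PowerSeries Finset
namespace MP49

lemma tri_inj {a b : ℕ} (h : tri (a + 1) = tri (b + 1)) : a = b := by
  have h1 := two_tri a
  have h2 := two_tri b
  rw [h, h2] at h1
  rcases lt_trichotomy a b with h | h | h <;> nlinarith

lemma jac_tri (k : ℕ) : coeff (tri (k + 1)) (E ^ 3) = (-1) ^ k * (2 * k + 1 : ℤ) := by
  rw [jacobi, sum_eq_single k]
  · simp
  · intro b _ hb
    rw [if_neg fun h => hb (tri_inj h)]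
  · intro h
    exfalso; apply h
    rw [mem_range]
    have := two_tri k
    rcases k with _ | k
    · omega
    · nlinarith

lemma jac_not (n : ℕ) (h : ∀ k, tri (k + 1) ≠ n) : coeff n (E ^ 3) = 0 := by
  rw [jacobi]
  exact sum_eq_zero fun k _ => if_neg (h k)

noncomputable abbrev ex {R : Type*} [CommRing R] : R⟦X⟧ →ₐ[R] R⟦X⟧ := expand 7 (by norm_num)

lemma coeff_exex {R : Type*} [CommRing R] (f : R⟦X⟧) (n : ℕ) :
    coeff n (ex (ex f)) = if 49 ∣ n then coeff (n / 49) f else 0 := by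
  rw [coeff_expand]
  split_ifs with h1 h2 h2
  · rw [coeff_expand, if_pos (by omega), Nat.div_div_eq_div_mul]
  · rw [coeff_expand, if_neg (by omega)]
  · omega
  · rfl

lemma tri7 (j : ℕ) : tri (7 * j + 3 + 1) = 49 * tri (j + 1) + 6 := by
  have h1 := two_tri j
  have h2 := two_tri (7 * j + 3)
  nlinarith

lemma jac6 (n : ℕ) (h : n % 7 = 6) :
    coeff n (E ^ 3) = coeff n (-7 * (X ^ 6 * ex (ex (E ^ 3)))) := by
  have h7 : (-7 : ℤ⟦X⟧) = C (-7) := by simp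
  rw [h7, coeff_C_mul, coeff_X_pow_mul', if_pos (by omega), coeff_exex]
  by_cases hk : ∃ k, tri (k + 1) = n
  · obtain ⟨k, rfl⟩ := hk
    have h1 := two_tri k
    have : k % 7 = 3 := by
      have h2 : (2 * tri (k + 1)) % 7 = 5 := by omega
      rw [h1, Nat.mul_mod, Nat.add_mod] at h2
      have : k % 7 < 7 := Nat.mod_lt _ (by norm_num)
      interval_cases k % 7 <;> simp_all
    obtain ⟨j, rfl⟩ : ∃ j, k = 7 * j + 3 := ⟨k / 7, by omega⟩
    rw [jac_tri, tri7, Nat.add_sub_cancel, if_pos (by omega), Nat.mul_div_cancel_left _ (by norm_num), jac_tri]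
    have : (-1 : ℤ) ^ (7 * j + 3) = - (-1) ^ j := by
      rw [pow_add, pow_mul]; norm_num
    rw [this]; push_cast; ring
  · push Not at hk
    rw [jac_not n hk]
    split_ifs with h2
    · rw [jac_not, mul_zero]
      intro j hj
      apply hk (7 * j + 3)
      rw [tri7, hj]; omega
    · simp

lemma jac_other (n : ℕ) (h : n % 7 = 2 ∨ n % 7 = 4 ∨ n % 7 = 5) : coeff n (E ^ 3) = 0 := by
  apply jac_not
  rintro k rfl
  have h1 := two_tri k
  have h2 : (2 * tri (k + 1)) % 7 = 4 ∨ (2 * tri (k + 1)) % 7 = 1 ∨ (2 * tri (k + 1)) % 7 = 3 := by omega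
  rw [h1, Nat.mul_mod, Nat.add_mod] at h2
  have : k % 7 < 7 := Nat.mod_lt _ (by norm_num)
  interval_cases k % 7 <;> simp_all

lemma pent7 (j : ℤ) : pentagonal (7 * j - 1) = 49 * pentagonal j + 2 := by
  have h1 := two_mul_natCast_pentagonal j
  have h2 := two_mul_natCast_pentagonal (7 * j - 1)
  zify
  nlinarith

lemma pent2 (n : ℕ) (h : n % 7 = 2) : coeff n E = coeff n (-(X ^ 2 * ex (ex E))) := by
  rw [map_neg, coeff_X_pow_mul', if_pos (by omega), coeff_exex]
  by_cases hk : ∃ k, pentagonal k = n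
  · obtain ⟨k, rfl⟩ := hk
    have h1 := two_mul_natCast_pentagonal k
    have : k % 7 = 6 := by
      have h2 : (2 * (pentagonal k : ℤ)) % 7 = 4 := by omega
      rw [h1, Int.mul_emod, Int.sub_emod, Int.mul_emod 3] at h2
      have : k % 7 < 7 := Int.emod_lt_of_pos _ (by norm_num)
      have : 0 ≤ k % 7 := Int.emod_nonneg _ (by norm_num)
      interval_cases k % 7 <;> simp_all
    obtain ⟨j, rfl⟩ : ∃ j, k = 7 * j - 1 := ⟨k / 7 + 1, by omega⟩
    rw [E, coeff_pentagonalSeries_pentagonal, pent7, Nat.add_sub_cancel, if_pos (by omega), Nat.mul_div_cancel_left _ (by norm_num), coeff_pentagonalSeries_pentagonal]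
    have : (7 * j - 1).negOnePow = - j.negOnePow := by
      rw [← Int.negOnePow_succ, Int.negOnePow_eq_iff]
      exact ⟨3 * j - 1, by ring⟩
    rw [this]; simp
  · push Not at hk
    rw [E, coeff_pentagonalSeries_eq_zero ℤ (by rintro ⟨k, hk'⟩; exact hk k hk')]
    split_ifs with h2
    · rw [coeff_pentagonalSeries_eq_zero, neg_zero]
      rintro ⟨j, hj⟩
      apply hk (7 * j - 1)
      rw [pent7, hj]; omega
    · simp

lemma pent_other (n : ℕ) (h : n % 7 = 3 ∨ n % 7 = 4 ∨ n % 7 = 6) : coeff n E = 0 := by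
  rw [E]
  apply coeff_pentagonalSeries_eq_zero
  rintro ⟨k, rfl⟩
  have h1 := two_mul_natCast_pentagonal k
  have h2 : (2 * (pentagonal k : ℤ)) % 7 = 6 ∨ (2 * (pentagonal k : ℤ)) % 7 = 1 ∨ (2 * (pentagonal k : ℤ)) % 7 = 5 := by omega
  rw [h1, Int.mul_emod, Int.sub_emod, Int.mul_emod 3] at h2
  have : k % 7 < 7 := Int.emod_lt_of_pos _ (by norm_num)
  have : 0 ≤ k % 7 := Int.emod_nonneg _ (by norm_num)
  interval_cases k % 7 <;> simp_all

/-! reduction mod 7 -/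
abbrev K := (ZMod 7)⟦X⟧

noncomputable abbrev rho : ℤ⟦X⟧ →+* K := PowerSeries.map (Int.castRingHom (ZMod 7))

noncomputable def e : K := rho E

instance : Fact (Nat.Prime 7) := ⟨by norm_num⟩

lemma ex_eq (f : K) : ex f = f ^ 7 := by
  have h := MvPowerSeries.map_frobenius_expand 7 (by norm_num) (f := f)
  rw [← h]
  have : frobenius (ZMod 7) 7 = RingHom.id _ := ZMod.frobenius_zmod 7
  rw [this]
  ext n
  rfl

lemma rho_ex (f : ℤ⟦X⟧) : rho (ex f) = (rho f) ^ 7 := by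
  rw [← ex_eq]; exact map_expand _ _ _ _

lemma K7 : (7 : K) = 0 := by
  have : (7 : K) = C (7 : ZMod 7) := (map_ofNat C 7).symm
  rw [this, show (7 : ZMod 7) = 0 from rfl, map_zero]

noncomputable def θ : Derivation (ZMod 7) K K := (X : K) • PowerSeries.derivative (ZMod 7)

lemma coeff_θ (f : K) (n : ℕ) : coeff n (θ f) = n * coeff n f := by
  change coeff n (X * d⁄dX (ZMod 7) f) = _
  cases n with
  | zero => simp
  | succ n => rw [coeff_succ_X_mul, coeff_derivative]; push_cast; ring

lemma cast_mod (n : ℕ) : ((n : ℕ) : ZMod 7) = ((n % 7 : ℕ) : ZMod 7) := by simp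

lemma e3_zero (n : ℕ) (h : n % 7 = 2 ∨ n % 7 = 4 ∨ n % 7 = 5 ∨ n % 7 = 6) : coeff n (e ^ 3) = 0 := by
  rw [e, ← map_pow, coeff_map]
  by_cases h6 : n % 7 = 6
  · rw [jac6 n h6]
    have h7 : (-7 : ℤ⟦X⟧) = C (-7) := by simp
    rw [h7, coeff_C_mul, map_mul, show (Int.castRingHom (ZMod 7)) (-7) = 0 from rfl, zero_mul]
  · rw [jac_other n (by omega), map_zero]

lemma k2 (D : K → K) (hD : ∀ f, D f = θ f + f) : D (D (D (e ^ 3))) = e ^ 3 := by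
  ext n
  have hc : ∀ f, coeff n (D f) = (n + 1) * coeff n f := by
    intro f; rw [hD, map_add, coeff_θ]; ring
  rw [hc, hc, hc, cast_mod]
  by_cases h : n % 7 = 2 ∨ n % 7 = 4 ∨ n % 7 = 5 ∨ n % 7 = 6
  · rw [e3_zero n h]; simp
  · have : n % 7 = 0 ∨ n % 7 = 1 ∨ n % 7 = 3 := by omega
    rw [← mul_assoc, ← mul_assoc]
    rcases this with h | h | h <;> rw [h] <;> convert one_mul _ <;> rfl

lemma k3 (D : K → K) (hD : ∀ f, D f = θ f + 5 * f) : D (D (D e)) + e = -(X ^ 2 * e ^ 49) := by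
  ext n
  have h5 : (5 : K) = C 5 := (map_ofNat C 5).symm
  have hc : ∀ f, coeff n (D f) = (n + 5) * coeff n f := by
    intro f; rw [hD, map_add, coeff_θ, h5, coeff_C_mul]; ring
  rw [map_add, hc, hc, hc, cast_mod]
  have r : -(X ^ 2 * e ^ 49) = rho (-(X ^ 2 * ex (ex E))) := by
    rw [map_neg, map_mul, rho_ex, rho_ex, ← pow_mul, map_pow, map_X]; rfl
  by_cases h2 : n % 7 = 2
  · rw [r, coeff_map, ← pent2 n h2, h2, ← coeff_map]
    have : ((2 : ℕ) : ZMod 7) + 5 = 0 := rfl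
    rw [this, zero_mul, zero_add]; rfl
  · have z : coeff n (-(X ^ 2 * e ^ 49)) = 0 := by
      rw [r, coeff_map, map_neg, coeff_X_pow_mul', coeff_exex]
      split_ifs
      · omega
      · simp
      · simp
    rw [z]
    by_cases h : n % 7 = 3 ∨ n % 7 = 4 ∨ n % 7 = 6
    · rw [e, coeff_map, pent_other n h]; simp
    · have : n % 7 = 0 ∨ n % 7 = 1 ∨ n % 7 = 5 := by omega
      rw [← mul_assoc, ← mul_assoc, ← add_one_mul]
      rcases this with h | h | h <;> rw [h] <;> convert zero_mul _ <;> rfl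

end MP49
open PowerSeries Finset
namespace MP49

noncomputable def θZ : Derivation ℤ ℤ⟦X⟧ ℤ⟦X⟧ := (X : ℤ⟦X⟧) • PowerSeries.derivative ℤ

lemma coeff_θZ (f : ℤ⟦X⟧) (n : ℕ) : coeff n (θZ f) = n * coeff n f := by
  change coeff n (X * d⁄dX ℤ f) = _
  cases n with
  | zero => simp
  | succ n => rw [coeff_succ_X_mul, coeff_derivative]; push_cast; ring

lemma rho_θ (f : ℤ⟦X⟧) : rho (θZ f) = θ (rho f) := by
  ext n
  rw [coeff_map, coeff_θ, coeff_θZ, coeff_map]; simp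

lemma θZ_ex (f : ℤ⟦X⟧) : θZ (ex f) = 7 * ex (θZ f) := by
  ext n
  rw [show (7 : ℤ⟦X⟧) = C 7 from (map_ofNat C 7).symm, coeff_C_mul, coeff_θZ, coeff_expand, coeff_expand]
  split_ifs with h
  · obtain ⟨m, rfl⟩ := h
    rw [coeff_θZ, Nat.mul_div_cancel_left _ (by norm_num)]; push_cast; ring
  · simp

lemma exists_F : ∃ F : ℤ⟦X⟧, E ^ 7 = ex E + 7 * F := by
  have h : ∀ n, (7 : ℤ) ∣ coeff n (E ^ 7 - ex E) := by
    intro n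
    have h1 : rho (E ^ 7 - ex E) = 0 := by rw [map_sub, rho_ex, map_pow, sub_self]
    have h2 := congrArg (coeff n) h1
    rw [coeff_map, map_zero] at h2
    exact (ZMod.intCast_zmod_eq_zero_iff_dvd _ 7).mp h2
  choose c hc using h
  refine ⟨mk c, ?_⟩
  rw [← sub_eq_iff_eq_add']
  ext n
  rw [hc, show (7 : ℤ⟦X⟧) = C 7 from (map_ofNat C 7).symm, coeff_C_mul, coeff_mk]

lemma θ_pow7 (g : K) : θ (g ^ 7) = 0 := by
  rw [Derivation.leibniz_pow, nsmul_eq_mul]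
  have := K7
  push_cast
  rw [this, zero_mul]

lemma θ_F (F : ℤ⟦X⟧) (hF : E ^ 7 = ex E + 7 * F) : θ (rho F) = e ^ 6 * θ e - (θ e) ^ 7 := by
  have h : θZ (E ^ 7) = θZ (ex E + 7 * F) := by rw [hF]
  have h7 : θZ (7 * F) = 7 * θZ F := by
    ext n
    rw [show (7 : ℤ⟦X⟧) = C 7 from (map_ofNat C 7).symm, coeff_C_mul, coeff_θZ, coeff_C_mul, coeff_θZ]; ring
  rw [Derivation.leibniz_pow, map_add, θZ_ex, h7, nsmul_eq_mul, smul_eq_mul] at h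
  have h2 : (7 : ℤ⟦X⟧) * (E ^ 6 * θZ E) = 7 * (ex (θZ E) + θZ F) := by
    linear_combination h
  have h3 := mul_left_cancel₀ (by
    rw [show (7 : ℤ⟦X⟧) = C 7 from (map_ofNat C 7).symm, Ne, map_eq_zero_iff _ C_injective]
    norm_num) h2
  have h4 := congrArg rho h3
  rw [map_add, rho_ex, map_mul, map_pow, rho_θ, rho_θ] at h4
  change e ^ 6 * θ e = (θ e) ^ 7 + θ (rho F) at h4
  linear_combination -h4

lemma e_const : constantCoeff e = 1 := by
  rw [← coeff_zero_eq_constantCoeff_apply, e, coeff_map, coeff_zero_eq_constantCoeff_apply, constE]; simp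

lemma e_ne : e ≠ 0 := by
  intro h
  have := e_const
  rw [h, map_zero] at this
  exact zero_ne_one this

noncomputable def P : K := 1 + 3 * θ e * e⁻¹

lemma θe : θ e = 5 * (P - 1) * e := by
  have h : e⁻¹ * e = 1 := PowerSeries.inv_mul_cancel e (by rw [e_const]; exact one_ne_zero)
  rw [P]
  linear_combination (-15 * θ e) * h - 2 * θ e * K7

lemma θX : θ (X : K) = X := by
  ext n
  rw [coeff_θ, coeff_X]
  split_ifs with h
  · rw [h]; simp
  · simp

noncomputable def DD (f : K) : K := θ f + f

lemma coeff_DD (f : K) (n : ℕ) : coeff n (DD f) = (n + 1) * coeff n f := by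
  rw [DD, map_add, coeff_θ]; ring

noncomputable def ff : K := e ^ 3 * θ (θ (θ (θ (θ P))))

lemma main_f : ff - DD (DD (DD (DD (DD (DD ff))))) = 3 * X ^ 6 * e ^ 147 :=
  alg (R := ZMod 7) K7 θ e X P e_ne θe θX DD (fun f => θ f + 5 * f) (fun _ => rfl) (fun _ => rfl)
    (k2 _ fun _ => rfl) (k3 _ fun _ => rfl)

lemma θ_mul7 (g f : K) : θ (g ^ 7 * f) = g ^ 7 * θ f := by
  rw [Derivation.leibniz, θ_pow7]; simp

lemma θ6F (F : ℤ⟦X⟧) (hF : E ^ 7 = ex E + 7 * F) :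
    θ (θ (θ (θ (θ (θ (rho F)))))) = 5 * (e ^ 7 * θ (θ (θ (θ (θ P))))) := by
  have h5 (g : K) : θ (5 * g) = 5 * θ g := by
    ext n
    rw [show (5 : K) = C 5 from (map_ofNat C 5).symm, coeff_C_mul, coeff_θ, coeff_C_mul, coeff_θ]; ring
  have h : e ^ 6 * θ e = 5 * (e ^ 7 * P) - 5 * (e ^ 7 * 1) := by rw [θe]; ring
  rw [θ_F F hF, map_sub, θ_pow7, sub_zero, h, map_sub, h5, h5, θ_mul7, θ_mul7]
  simp only [Derivation.map_one_eq_zero, mul_zero, sub_zero, h5, θ_mul7]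

lemma DD_mul7 (g f : K) : DD (g ^ 7 * f) = g ^ 7 * DD f := by
  rw [DD, DD, θ_mul7]; ring

lemma coeff_mul_zero {R : Type*} [CommRing R] (f g : R⟦X⟧) (n : ℕ)
    (h : ∀ i j, i + j = n → coeff i f = 0 ∨ coeff j g = 0) : coeff n (f * g) = 0 := by
  rw [coeff_mul]
  refine sum_eq_zero fun p hp => ?_
  rcases h p.1 p.2 (mem_antidiagonal.mp hp) with h | h <;> rw [h] <;> simp

lemma zpow6 : ∀ a : ZMod 7, a = 0 ∨ a * (a * (a * (a * (a * a)))) = 1 := by decide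

lemma coeff_e3F (F : ℤ⟦X⟧) (hF : E ^ 7 = ex E + 7 * F) (n : ℕ) (hn : n % 7 = 6) :
    coeff n (e ^ 3 * rho F) = coeff n (X ^ 6 * e ^ 154) := by
  have h1 : coeff n (e ^ 3 * (rho F - θ (θ (θ (θ (θ (θ (rho F)))))))) = 0 := by
    apply coeff_mul_zero
    intro i j hij
    by_cases hj : j % 7 = 0
    · left; apply e3_zero; omega
    · right
      rw [map_sub]
      simp only [coeff_θ]
      rcases zpow6 (j : ZMod 7) with h | h
      · rw [ZMod.natCast_eq_zero_iff] at h; omega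
      · linear_combination (-(coeff j (rho F))) * h
  have h2 : e ^ 3 * θ (θ (θ (θ (θ (θ (rho F)))))) = 5 * (e ^ 7 * ff) := by
    rw [θ6F F hF, ff]; ring
  have h3 : e ^ 7 * ff - DD (DD (DD (DD (DD (DD (e ^ 7 * ff)))))) = 3 * X ^ 6 * e ^ 154 := by
    simp only [DD_mul7]
    linear_combination e ^ 7 * main_f
  have h4 : coeff n (DD (DD (DD (DD (DD (DD (e ^ 7 * ff))))))) = 0 := by
    rw [coeff_DD, cast_mod, hn, show ((6 : ℕ) : ZMod 7) + 1 = 0 from rfl, zero_mul]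
  have h5 : e ^ 3 * rho F = e ^ 3 * (rho F - θ (θ (θ (θ (θ (θ (rho F))))))) + X ^ 6 * e ^ 154 +
      C 5 * DD (DD (DD (DD (DD (DD (e ^ 7 * ff)))))) := by
    rw [show (C 5 : K) = 5 from map_ofNat C 5]
    linear_combination h2 + 5 * h3 + 2 * X ^ 6 * e ^ 154 * K7
  rw [h5, map_add, map_add, h1, coeff_C_mul, h4]; simp

def S (m : ℤ) (f : ℤ⟦X⟧) : Prop := ∀ n, n % 7 = 6 → m ∣ coeff n f

lemma S.add {m f g} (hf : S m f) (hg : S m g) : S m (f + g) := fun n hn => by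
  rw [map_add]; exact dvd_add (hf n hn) (hg n hn)

lemma S.ex_mul {m f} (g : ℤ⟦X⟧) (hf : S m f) : S m (ex g * f) := fun n hn => by
  rw [coeff_mul]
  refine dvd_sum fun p hp => ?_
  rw [HasAntidiagonal.mem_antidiagonal] at hp
  rw [coeff_expand]
  split_ifs with h
  · exact dvd_mul_of_dvd_right (hf _ (by omega)) _
  · simp

lemma S_C (m : ℤ) (f : ℤ⟦X⟧) : S m (C m * f) := fun n _ => by
  rw [coeff_C_mul]; exact dvd_mul_right _ _

lemma S.C_mul {m f} (k : ℤ) (hf : S m f) : S (k * m) (C k * f) := fun n hn => by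
  rw [coeff_C_mul]; exact mul_dvd_mul_left _ (hf n hn)

lemma mainA (A B : ℤ⟦X⟧) (hB : B * E = 1) (hA : A = B ^ 4) :
    S 49 (A + 14 * (X ^ 6 * ex (ex (E ^ 3) * B))) := by
  obtain ⟨F, hF⟩ := exists_F
  have hAE : A * E ^ 7 = E ^ 3 := by
    rw [hA]; linear_combination (E^3 * ((B*E)^3 + (B*E)^2+B*E+1)) * hB
  have s1 : S 7 (E ^ 3 * F - X ^ 6 * ex (ex (E ^ 3)) * ex E) := fun n hn => by
    have h := coeff_e3F F hF n hn
    rw [show X ^ 6 * e ^ 154 = rho (X ^ 6 * ex (ex (E ^ 3)) * ex E) by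
      rw [map_mul, map_mul, rho_ex, rho_ex, rho_ex, map_pow, map_X, map_pow]
      change _ = X ^ 6 * (((e ^ 3) ^ 7) ^ 7) * e ^ 7
      ring, show e ^ 3 * rho F = rho (E ^ 3 * F) by rw [map_mul, map_pow]; rfl, coeff_map, coeff_map] at h
    rw [map_sub, ← Int.modEq_zero_iff_dvd]
    have := (ZMod.intCast_eq_intCast_iff _ _ 7).mp h
    exact (Int.modEq_zero_iff_dvd.mpr (Int.modEq_iff_dvd.mp this.symm))
  have s2 : S 49 (E ^ 3 + 7 * (X ^ 6 * ex (ex (E ^ 3)))) := fun n hn => by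
    have h := jac6 n hn
    have : coeff n (E ^ 3 + 7 * (X ^ 6 * ex (ex (E ^ 3)))) = 0 := by
      rw [map_add, h, ← map_add]
      ring_nf; simp
    rw [this]; simp
  have s3 : S 49 (A * (ex E) ^ 2 + 14 * (X ^ 6 * ex (ex (E ^ 3)) * ex E)) := by
    have s5 : S 49 (C (-7) * (E ^ 3 * F - X ^ 6 * ex (ex (E ^ 3)) * ex E)) := fun n hn => by
      have := s1.C_mul (-7) n hn
      rwa [show (-7 * 7 : ℤ) = -49 by norm_num, Int.neg_dvd] at this
    have := ((S_C 49 (F ^ 2 * A)).add (s2.ex_mul E)).add s5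
    convert this using 1
    rw [show (C 49 : ℤ⟦X⟧) = 49 from map_ofNat C 49, map_neg, show (C 7 : ℤ⟦X⟧) = 7 from map_ofNat C 7]
    linear_combination (ex E - 7 * F) * hAE - A * (ex E - 7 * F) * hF
  have s4 := (s3.ex_mul B).ex_mul B
  have hb : ex B * ex E = 1 := by rw [← map_mul, hB, map_one]
  convert s4 using 1
  rw [map_mul]
  linear_combination (-A * (ex B * ex E + 1) - 14 * X ^ 6 * ex (ex (E ^ 3)) * ex B) * hb

lemma e6_zero (n : ℕ) (h : n % 7 = 5) : coeff n (e ^ 3 * e ^ 3) = 0 := by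
  apply coeff_mul_zero
  intro i j hij
  by_cases hi : i % 7 = 2 ∨ i % 7 = 4 ∨ i % 7 = 5 ∨ i % 7 = 6
  · exact Or.inl (e3_zero i hi)
  · exact Or.inr (e3_zero j (by omega))

lemma last (B : ℤ⟦X⟧) (hB : B * E = 1) (n : ℕ) (h : n % 7 = 5) : (7 : ℤ) ∣ coeff n (ex (E ^ 3) * B) := by
  have hb : rho B * e = 1 := by rw [e, ← map_mul, hB, map_one]
  have h1 : rho (ex (E ^ 3) * B) = ex (e ^ 2) * (e ^ 3 * e ^ 3) := by
    rw [map_mul, rho_ex, ex_eq, map_pow]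
    change (e ^ 3) ^ 7 * _ = _
    linear_combination e ^ 20 * hb
  have h2 : coeff n (ex (e ^ 2) * (e ^ 3 * e ^ 3)) = 0 := by
    apply coeff_mul_zero
    intro i j hij
    by_cases hi : 7 ∣ i
    · right; exact e6_zero j (by omega)
    · left; rw [coeff_expand, if_neg hi]
  rw [← h1, coeff_map] at h2
  exact (ZMod.intCast_zmod_eq_zero_iff_dvd _ 7).mp h2

lemma final (B : ℤ⟦X⟧) (hB : B * E = 1) (n : ℕ) : (49 : ℤ) ∣ coeff (49 * n + 41) (B ^ 4) := by
  have h := mainA (B ^ 4) B hB rfl (49 * n + 41) (by omega)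
  rw [map_add, show (14 : ℤ⟦X⟧) = C 14 from (map_ofNat C 14).symm, coeff_C_mul, coeff_X_pow_mul', if_pos (by omega),
    coeff_expand, if_pos (by omega), show (49 * n + 41 - 6) / 7 = 7 * n + 5 by omega] at h
  have := last B hB (7 * n + 5) (by omega)
  omega

end MP49
open PowerSeries Finset
namespace MP49

noncomputable def Bs : ℤ⟦X⟧ := PowerSeries.mk fun n => (Fintype.card (Nat.Partition n) : ℤ)

open PowerSeries.WithPiTopology in
lemma Bs_mul : Bs * E = 1 := by
  let _ : TopologicalSpace ℤ := ⊥
  have _ : DiscreteTopology ℤ := ⟨rfl⟩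
  have h1 := Nat.Partition.hasProd_powerSeriesMk_card_restricted ℤ (fun _ => True)
  have h2 := hasProd_one_sub_X_pow ℤ
  have h3 := h1.mul h2
  have e1 : (PowerSeries.mk fun n ↦ (#(Nat.Partition.restricted n fun _ => True) : ℤ)) = Bs := by
    ext n
    simp [Bs, Nat.Partition.restricted]
  rw [e1] at h3
  refine h3.unique ?_
  convert hasProd_one using 2 with i
  rw [if_pos trivial]
  simp_rw [pow_mul]
  exact tsum_pow_mul_one_sub_of_constantCoeff_eq_zero (by simp)

lemma coeff_Bs (r n : ℕ) : coeff n (Bs ^ r) = (multipartition r n : ℤ) := by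
  have : Bs ^ r = ∏ _i : Fin r, Bs := by simp
  rw [this, coeff_prod, multipartition]
  push_cast
  refine sum_equiv Finsupp.equivFunOnFinite ?_ ?_
  · intro f
    simp [Finset.Nat.mem_antidiagonalTuple]
  · intro f _
    simp [Bs]

end MP49

theorem multipartition_four_fortynine (n : ℕ) : 49 ∣ multipartition 4 (49 * n + 41) := by
  have h := MP49.final MP49.Bs MP49.Bs_mul n
  rw [MP49.coeff_Bs] at h
  exact_mod_cast h
end

section
/- For every nonnegative integer n, p_5(121n + 96) ≡ 0 (mod 121). -/
namespace MP5

open PowerSeries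

/-- `1 + a Σ σ_k(n) X^n` with constant term `c`. -/
noncomputable def eis (c a : ℤ) (k : ℕ) : ℤ⟦X⟧ :=
  PowerSeries.mk fun n => if n = 0 then c else a * (ArithmeticFunction.sigma k n : ℤ)

section modular
open UpperHalfPlane ModularForm ModularFormClass MatrixGroups EisensteinSeries

lemma map_eis (c a : ℤ) (k m : ℕ) : ((eis c a k).map (Int.castRingHom ℂ)).coeff m =
    if m = 0 then (c : ℂ) else a * (ArithmeticFunction.sigma k m : ℂ) := by
  simp [eis]

lemma qE4 : qExpansion 1 E₄ = (eis 1 240 3).map (Int.castRingHom ℂ) := by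
  ext m
  rw [map_eis, E_qExpansion_coeff _ ⟨2, rfl⟩]
  norm_num [show bernoulli 4 = -1 / 30 by decide +kernel]

lemma qE6 : qExpansion 1 E₆ = (eis 1 (-504) 5).map (Int.castRingHom ℂ) := by
  ext m
  rw [map_eis, E_qExpansion_coeff _ ⟨3, rfl⟩]
  norm_num [show bernoulli 6 = 1 / 42 by decide +kernel]

noncomputable abbrev E10 : ModularForm 𝒮ℒ 10 := E (by norm_num : 3 ≤ 10)
noncomputable abbrev E12 : ModularForm 𝒮ℒ 12 := E (by norm_num : 3 ≤ 12)

lemma qE10 : qExpansion 1 E10 = (eis 1 (-264) 9).map (Int.castRingHom ℂ) := by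
  ext m
  rw [map_eis, E_qExpansion_coeff _ ⟨5, rfl⟩]
  norm_num [show bernoulli 10 = 5 / 66 by decide +kernel]

lemma qE12 : (691 : ℂ) • qExpansion 1 E12 = (eis 691 65520 11).map (Int.castRingHom ℂ) := by
  ext m
  rw [map_eis, PowerSeries.coeff_smul, E_qExpansion_coeff _ ⟨6, rfl⟩]
  norm_num [show bernoulli 12 = -691 / 2730 by decide +kernel]
  split_ifs <;> ring

lemma zmap_inj {A B : ℤ⟦X⟧} (h : A.map (Int.castRingHom ℂ) = B.map (Int.castRingHom ℂ)) : A = B :=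
  PowerSeries.map_injective _ (RingHom.injective_int _) h

noncomputable def f10 : ModularForm 𝒮ℒ ((10 : ℕ) : ℤ) :=
  ModularForm.mcast (by decide) (E₄.mul E₆) - ModularForm.mcast (by decide) E10

lemma qf10 : qExpansion 1 f10 = qExpansion 1 E₄ * qExpansion 1 E₆ - qExpansion 1 E10 := by
  simp only [f10, FunLike.coe_sub, coe_mcast,
    ModularForm.qExpansion_sub one_pos one_mem_strictPeriods_SL,
    ModularForm.qExpansion_mul one_pos one_mem_strictPeriods_SL]

lemma e4e6 : eis 1 240 3 * eis 1 (-504) 5 = eis 1 (-264) 9 := by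
  have h : f10 = 0 := by
    apply sturm_bound_levelOne_nat
    refine lt_of_lt_of_le (b := ((1 : ℕ) : ℕ∞)) (by norm_num) ?_
    refine PowerSeries.nat_le_order _ _ ?_
    intro i hi
    rw [qf10, qE4, qE6, qE10]
    interval_cases i
    rw [map_sub, PowerSeries.coeff_mul]
    simp [PowerSeries.coeff_mul, -PowerSeries.coeff_zero_eq_constantCoeff, map_eis, -PowerSeries.coeff_map]
  have h2 := qf10
  rw [h, FunLike.coe_zero, qExpansion_zero, qE4, qE6, qE10] at h2
  apply zmap_inj
  rw [map_mul, eq_comm, ← sub_eq_zero, ← neg_sub, ← h2, neg_zero]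

noncomputable def f12 : ModularForm 𝒮ℒ ((12 : ℕ) : ℤ) :=
  (441 : ℂ) • ModularForm.mcast (by decide) (E₄.pow 3) +
  (250 : ℂ) • ModularForm.mcast (by decide) (E₆.pow 2) - (691 : ℂ) • ModularForm.mcast (by decide) E12

lemma qf12 : qExpansion 1 f12 = (441 : ℂ) • qExpansion 1 E₄ ^ 3 +
    (250 : ℂ) • qExpansion 1 E₆ ^ 2 - (691 : ℂ) • qExpansion 1 E12 := by
  rw [f12, FunLike.coe_sub, ModularForm.qExpansion_sub one_pos one_mem_strictPeriods_SL, 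
    FunLike.coe_add, ModularForm.qExpansion_add one_pos one_mem_strictPeriods_SL]
  simp only [FunLike.coe_smul, coe_mcast,
    ModularForm.qExpansion_smul one_pos one_mem_strictPeriods_SL,
    ModularForm.qExpansion_pow one_pos one_mem_strictPeriods_SL]

lemma smulmap (n : ℤ) (A : ℤ⟦X⟧) : ((n : ℂ)) • A.map (Int.castRingHom ℂ) =
    (C n * A).map (Int.castRingHom ℂ) := by
  ext m; simp only [PowerSeries.coeff_smul, PowerSeries.coeff_map, PowerSeries.coeff_C_mul]; simp

lemma qf12' : qExpansion 1 f12 = (C 441 * eis 1 240 3 ^ 3 + C 250 * eis 1 (-504) 5 ^ 2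
    - eis 691 65520 11).map (Int.castRingHom ℂ) := by
  rw [qf12, qE12, qE4, qE6, ← map_pow, ← map_pow]
  have := smulmap 441 (eis 1 240 3 ^ 3)
  have h2 := smulmap 250 (eis 1 (-504) 5 ^ 2)
  push_cast at this h2
  rw [this, h2]
  simp only [map_add, map_sub]

lemma e12 : C 441 * eis 1 240 3 ^ 3 + C 250 * eis 1 (-504) 5 ^ 2 = eis 691 65520 11 := by
  have h : f12 = 0 := by
    apply sturm_bound_levelOne_nat
    refine lt_of_lt_of_le (b := ((2 : ℕ) : ℕ∞)) (by norm_num) ?_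
    refine PowerSeries.nat_le_order _ _ ?_
    intro i hi
    rw [qf12']
    interval_cases i
    · rw [PowerSeries.coeff_map]
      simp only [map_sub, map_add, PowerSeries.coeff_C_mul]
      simp [eis]
      norm_num
    · rw [PowerSeries.coeff_map]
      simp only [map_sub, map_add, PowerSeries.coeff_C_mul]
      simp [eis, pow_succ, PowerSeries.coeff_mul, Finset.Nat.antidiagonal_succ]
      norm_num
  have h2 := qf12'
  rw [h, FunLike.coe_zero, qExpansion_zero] at h2
  rw [← sub_eq_zero]
  apply zmap_inj
  rw [← h2, map_zero]

end modular
end MP5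

namespace MP5
open PowerSeries
section disc
open UpperHalfPlane ModularForm ModularFormClass MatrixGroups EisensteinSeries Filter Topology

noncomputable abbrev EC : ℂ⟦X⟧ := pentagonalSeries ℂ

/-- `A` evaluates absolutely to `v` at `q`. -/
def Ev (A : ℂ⟦X⟧) (q v : ℂ) : Prop :=
  Summable (fun n => ‖A.coeff n * q ^ n‖) ∧ HasSum (fun n => A.coeff n * q ^ n) v

lemma Ev.mul {A B : ℂ⟦X⟧} {q a b : ℂ} (hA : Ev A q a) (hB : Ev B q b) : Ev (A * B) q (a * b) := by
  have key : ∀ n, (A * B).coeff n * q ^ n = ∑ kl ∈ Finset.HasAntidiagonal.antidiagonal n,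
      (A.coeff kl.1 * q ^ kl.1) * (B.coeff kl.2 * q ^ kl.2) := by
    intro n
    rw [PowerSeries.coeff_mul, Finset.sum_mul]
    refine Finset.sum_congr rfl fun kl h => ?_
    rw [← Finset.HasAntidiagonal.mem_antidiagonal.mp h, pow_add]; ring
  have hs : Summable (fun n => ‖(A * B).coeff n * q ^ n‖) := by
    have h := summable_norm_sum_mul_antidiagonal_of_summable_norm
      (f := fun n => A.coeff n * q ^ n) (g := fun n => B.coeff n * q ^ n) hA.1 hB.1
    exact h.congr fun n => by rw [key n]
  refine ⟨hs, ?_⟩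
  have := tsum_mul_tsum_eq_tsum_sum_antidiagonal_of_summable_norm
      (f := fun n => A.coeff n * q ^ n) (g := fun n => B.coeff n * q ^ n) hA.1 hB.1
  rw [hA.2.tsum_eq, hB.2.tsum_eq] at this
  rw [this, ← tsum_congr key]
  exact hs.of_norm.hasSum

lemma Ev.one (q : ℂ) : Ev 1 q 1 := by
  constructor
  · apply summable_of_ne_finset_zero (s := {0})
    intro n hn
    simp at hn
    simp [PowerSeries.coeff_one, hn]
  · convert hasSum_ite_eq (0:ℕ) (1:ℂ) using 2 with n
    simp only [PowerSeries.coeff_one]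
    split_ifs with h <;> simp [h]

lemma Ev.X (q : ℂ) : Ev X q q := by
  constructor
  · apply summable_of_ne_finset_zero (s := {1})
    intro n hn
    simp at hn
    simp [PowerSeries.coeff_X, hn]
  · convert hasSum_ite_eq (1:ℕ) (q:ℂ) using 2 with n
    simp only [PowerSeries.coeff_X]
    split_ifs with h <;> simp [h]

lemma Ev.pow {A : ℂ⟦X⟧} {q a : ℂ} (hA : Ev A q a) (n : ℕ) : Ev (A ^ n) q (a ^ n) := by
  induction n with
  | zero => simpa using Ev.one q
  | succ n ih => rw [pow_succ, pow_succ]; exact ih.mul hA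

lemma iter_deriv_tendsto {ι : Type*} {φ : Filter ι} {F : ι → ℂ → ℂ} {f : ℂ → ℂ} {U : Set ℂ}
    (hf : TendstoLocallyUniformlyOn F f φ U) (hF : ∀ n, Differentiable ℂ (F n))
    (hU : IsOpen U) (m : ℕ) :
    TendstoLocallyUniformlyOn (fun n => iteratedDeriv m (F n)) (iteratedDeriv m f) φ U := by
  induction m with
  | zero => simpa using hf
  | succ m ih =>
    simp_rw [iteratedDeriv_succ]
    refine ih.deriv (Eventually.of_forall fun n => ?_) hU
    have : ContDiff ℂ (m + 1) (F n) := (hF n).contDiff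
    exact (this.differentiable_iteratedDeriv m (by exact_mod_cast Nat.lt_succ_self m)).differentiableOn

lemma iter_deriv_poly (p : Polynomial ℂ) (m : ℕ) :
    iteratedDeriv m (fun q => p.eval q) 0 = m.factorial * p.coeff m := by
  have h : ∀ m, iteratedDeriv m (fun q => p.eval q) = fun q => (Polynomial.derivative^[m] p).eval q := by
    intro m
    induction m with
    | zero => simp
    | succ m ih =>
      rw [iteratedDeriv_succ, ih]
      ext q
      rw [Polynomial.deriv, Function.iterate_succ_apply']
  rw [h]
  simp only
  rw [← Polynomial.coeff_zero_eq_eval_zero, Polynomial.coeff_iterate_derivative]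
  simp [Nat.descFactorial_self]

lemma coeff_prod (m : ℕ) :
    ((m.factorial : ℂ))⁻¹ * iteratedDeriv m (fun q : ℂ ↦ ∏' n, (1 - q ^ (n + 1))) 0 = EC.coeff m := by
  have h := multipliableLocallyUniformlyOn_one_sub_pow.hasProdLocallyUniformlyOn
  rw [hasProdLocallyUniformlyOn_iff_tendstoLocallyUniformlyOn] at h
  have h2 := iter_deriv_tendsto h (fun s => by fun_prop) Metric.isOpen_ball m
  have h3 := h2.tendsto_at (Metric.mem_ball_self one_pos : (0:ℂ) ∈ Metric.ball 0 1)
  have h4 : ∀ᶠ s in atTop, iteratedDeriv m (fun q : ℂ => ∏ n ∈ s, (1 - q ^ (n+1))) 0 =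
      m.factorial * EC.coeff m := by
    filter_upwards [coeff_prod_one_sub_X_pow_eventually_eq ℂ m] with s hs
    have := iter_deriv_poly (∏ n ∈ s, (1 - Polynomial.X ^ (n+1))) m
    rw [← Polynomial.coeff_coe] at this
    simp only [Polynomial.eval_prod, Polynomial.eval_sub, Polynomial.eval_one, Polynomial.eval_pow, Polynomial.eval_X] at this
    rw [this, ← hs]
    congr 2
    rw [← Polynomial.coeToPowerSeries.ringHom_apply, map_prod]
    simp
  have h5 := tendsto_nhds_unique (h3.congr' h4) tendsto_const_nhds
  rw [h5, inv_mul_cancel_left₀]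
  exact_mod_cast m.factorial_ne_zero

lemma norm_coeff_EC (m : ℕ) : ‖EC.coeff m‖ ≤ 1 := by
  by_cases h : m ∈ Set.range pentagonal
  · obtain ⟨k, rfl⟩ := h
    rw [coeff_pentagonalSeries_pentagonal]
    rcases Int.even_or_odd k with h | h
    · simp [Int.negOnePow_even k h]
    · simp [Int.negOnePow_odd k h]
  · simp [coeff_pentagonalSeries_eq_zero ℂ h]

lemma Ev_EC {q : ℂ} (hq : ‖q‖ < 1) : Ev EC q (∏' n, (1 - q ^ (n + 1))) := by
  constructor
  · refine Summable.of_nonneg_of_le (fun _ => norm_nonneg _) (fun n => ?_)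
      (summable_geometric_of_lt_one (norm_nonneg q) hq)
    rw [norm_mul, norm_pow]
    exact mul_le_of_le_one_left (by positivity) (norm_coeff_EC n)
  · have := Complex.hasSum_taylorSeries_on_ball (r := 1) (c := 0) (z := q)
      (f := fun q : ℂ ↦ ∏' n, (1 - q ^ (n + 1)))
      (by simpa using differentiableOn_tprod_one_sub_pow) (by simpa using hq)
    convert! this using 2 with n
    rw [← coeff_prod, sub_zero, smul_eq_mul, smul_eq_mul]
    ring

lemma qDisc : qExpansion 1 CuspForm.discriminant = X * EC ^ 24 := by
  ext m
  refine (ModularFormClass.qExpansion_coeff_unique one_pos one_mem_strictPeriods_SL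
    (f := CuspForm.discriminant) (c := fun m => (X * EC ^ 24).coeff m) ?_ m).symm
  intro τ
  have hq : ‖Function.Periodic.qParam 1 τ‖ < 1 := by
    simpa using UpperHalfPlane.norm_qParam_lt_one 1 τ
  have h := ((Ev.X (Function.Periodic.qParam 1 τ)).mul ((Ev_EC hq).pow 24)).2
  simp only [smul_eq_mul]
  convert h using 1
  rw [CuspForm.coe_discriminant, discriminant_eq_q_prod, (multipliable_one_sub_pow hq).tprod_pow]

end disc
end MP5

namespace MP5
open PowerSeries
section disc3
open UpperHalfPlane ModularForm ModularFormClass MatrixGroups EisensteinSeries Filter Topology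

noncomputable abbrev EZ : ℤ⟦X⟧ := pentagonalSeries ℤ

lemma map_pent {R S : Type*} [CommRing R] [CommRing S] (f : R →+* S) :
    (pentagonalSeries R).map f = pentagonalSeries S := by
  ext m
  rw [PowerSeries.coeff_map]
  by_cases h : m ∈ Set.range pentagonal
  · obtain ⟨k, rfl⟩ := h
    rw [coeff_pentagonalSeries_pentagonal, coeff_pentagonalSeries_pentagonal]
    simp
  · simp [coeff_pentagonalSeries_eq_zero _ h]

lemma eDisc : eis 1 240 3 ^ 3 - eis 1 (-504) 5 ^ 2 = C 1728 * (X * EZ ^ 24) := by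
  apply zmap_inj
  rw [← smulmap]
  simp only [map_sub, map_pow, map_mul, PowerSeries.map_X, map_pent]
  rw [← qDisc, ← qE4, ← qE6]
  push_cast
  rw [← ModularForm.qExpansion_pow one_pos one_mem_strictPeriods_SL,
    ← ModularForm.qExpansion_pow one_pos one_mem_strictPeriods_SL,
    ← coe_mcast (show ((3:ℕ):ℤ) * 4 = 12 by decide), 
    ← coe_mcast (show ((2:ℕ):ℤ) * 6 = 12 by decide), 
    ← ModularForm.qExpansion_sub one_pos one_mem_strictPeriods_SL,
    ← ModularForm.qExpansion_smul one_pos one_mem_strictPeriods_SL]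
  congr 1
  ext z
  have := ModularForm.discriminant_eq_E₄_cube_sub_E₆_sq z
  have h1 : (E₄.pow 3) z = E₄ z ^ 3 := congrFun (ModularForm.coe_pow E₄ 3) z
  have h2 : (E₆.pow 2) z = E₆ z ^ 2 := congrFun (ModularForm.coe_pow E₆ 2) z
  simp [CuspForm.coe_discriminant, this, coe_mcast, h1, h2]
  ring

end disc3
end MP5

namespace MP5
open PowerSeries
section B
open Filter

/-- finite product -/
noncomputable def Pf (R : Type*) [CommRing R] (N : ℕ) : R⟦X⟧ := ∏ n ∈ Finset.range N, (1 - X ^ (n + 1))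

lemma evP (R : Type*) [CommRing R] (m : ℕ) :
    ∀ᶠ N in atTop, ∀ k ≤ m, (Pf R N).coeff k = (pentagonalSeries R).coeff k := by
  have h : ∀ k, ∀ᶠ N in atTop, (Pf R N).coeff k = (pentagonalSeries R).coeff k := fun k =>
    tendsto_finset_range.eventually (coeff_prod_one_sub_X_pow_eventually_eq R k)
  have := (Set.finite_Iic m).eventually_all (l := atTop) (p := fun k N => (Pf R N).coeff k = (pentagonalSeries R).coeff k)
  exact this.mpr fun k _ => h k

/-- X d/dX -/
noncomputable def th (R : Type*) [CommRing R] : Derivation R R⟦X⟧ R⟦X⟧ := (X : R⟦X⟧) • PowerSeries.derivative R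

lemma coeff_th {R : Type*} [CommRing R] (A : R⟦X⟧) (n : ℕ) : (th R A).coeff n = n * A.coeff n := by
  cases n with
  | zero => simp [th]
  | succ n => simp [th, PowerSeries.coeff_succ_X_mul, PowerSeries.coeff_derivative]; ring

/-- generating function of sigma -/
noncomputable def S1 (R : Type*) [CommRing R] : R⟦X⟧ := PowerSeries.mk fun n => (ArithmeticFunction.sigma 1 n : R)

noncomputable def Lf (R : Type*) [CommRing R] (n : ℕ) : R⟦X⟧ :=
  PowerSeries.mk fun k => if k ≠ 0 ∧ (n + 1) ∣ k then ((n : R) + 1) else 0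

lemma Lf_mul (R : Type*) [CommRing R] (n : ℕ) :
    (1 - X ^ (n + 1)) * Lf R n = ((n : R⟦X⟧) + 1) * X ^ (n + 1) := by
  have : ((n : R⟦X⟧) + 1) = C ((n : R) + 1) := by simp
  ext k
  rw [this, sub_mul, one_mul, map_sub, PowerSeries.coeff_X_pow_mul', PowerSeries.coeff_C_mul, PowerSeries.coeff_X_pow]
  simp only [Lf, PowerSeries.coeff_mk]
  rcases lt_trichotomy k (n + 1) with h | h | h
  · have h1 : ¬ (n + 1 ≤ k) := by omega
    have h2 : ¬ (k ≠ 0 ∧ (n + 1) ∣ k) := fun ⟨a, b⟩ => h1 (Nat.le_of_dvd (by omega) b)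
    simp [h1, h2, h.ne]
  · subst h; simp
  · have h3 : (n + 1 ∣ k - (n + 1)) ↔ (n + 1 ∣ k) := 
      (Nat.dvd_sub_iff_left h.le (dvd_refl _))
    have h4 : k - (n + 1) ≠ 0 := by omega
    have h5 : k ≠ 0 := by omega
    simp only [h3, h4, h5, h.le, h.ne', if_true, if_false, ne_eq, not_false_eq_true, true_and]
    simp

lemma th_Pf (R : Type*) [CommRing R] (N : ℕ) :
    th R (Pf R N) = - (Pf R N * ∑ n ∈ Finset.range N, Lf R n) := by
  induction N with
  | zero => simp [Pf]
  | succ N ih =>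
    have e : Pf R (N + 1) = Pf R N * (1 - X ^ (N + 1)) := by simp [Pf, Finset.prod_range_succ]
    rw [e, Derivation.leibniz, ih, Finset.sum_range_succ]
    have : th R (1 - X ^ (N + 1)) = - (((N : R⟦X⟧) + 1) * X ^ (N + 1)) := by
      simp [th, Derivation.leibniz_pow]; ring
    rw [this, ← Lf_mul]
    simp only [smul_eq_mul]
    ring

lemma coeff_sumLf (R : Type*) [CommRing R] {N k : ℕ} (h : k ≤ N) :
    (∑ n ∈ Finset.range N, Lf R n).coeff k = (S1 R).coeff k := by
  rw [map_sum]
  simp only [Lf, S1, PowerSeries.coeff_mk]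
  by_cases hk : k = 0
  · simp [hk]
  · simp only [hk, ne_eq, not_false_eq_true, true_and]
    rw [ArithmeticFunction.sigma_one_apply, Nat.cast_sum, ← Finset.sum_filter]
    refine Finset.sum_bij (fun n _ => n + 1) ?_ ?_ ?_ ?_
    · intro a ha
      simp only [Finset.mem_filter] at ha
      simp [ha.2, hk]
    · intro a _ b _ h; omega
    · intro d hd
      have h1 := Nat.pos_of_mem_divisors hd
      have h2 := Nat.divisor_le hd
      have h3 := Nat.dvd_of_mem_divisors hd
      refine ⟨d - 1, ?_, by omega⟩
      simp only [Finset.mem_filter, Finset.mem_range]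
      exact ⟨by omega, by rwa [Nat.sub_add_cancel h1]⟩
    · intro a _; simp

lemma coeff_mul_congr {R : Type*} [CommRing R] {A B C D : R⟦X⟧} {m : ℕ}
    (h1 : ∀ k ≤ m, A.coeff k = B.coeff k) (h2 : ∀ k ≤ m, C.coeff k = D.coeff k) :
    (A * C).coeff m = (B * D).coeff m := by
  rw [PowerSeries.coeff_mul, PowerSeries.coeff_mul]
  refine Finset.sum_congr rfl fun x hx => ?_
  have := Finset.HasAntidiagonal.mem_antidiagonal.mp hx
  rw [h1 _ (by omega), h2 _ (by omega)]

lemma th_E (R : Type*) [CommRing R] :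
    th R (pentagonalSeries R) = - (S1 R * pentagonalSeries R) := by
  ext m
  obtain ⟨N, hN, hm⟩ := ((evP R m).and (eventually_ge_atTop m)).exists
  rw [coeff_th, ← hN m le_rfl, ← coeff_th, th_Pf, map_neg, map_neg, mul_comm]
  congr 1
  exact coeff_mul_congr (fun k hk => coeff_sumLf R (hk.trans hm)) hN

/-- partition generating function -/
noncomputable def PZ : ℤ⟦X⟧ := PowerSeries.mk fun n => (Fintype.card (Nat.Partition n) : ℤ)

open PowerSeries.WithPiTopology in
lemma PZ_mul : PZ * pentagonalSeries ℤ = 1 := by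
  let _ : TopologicalSpace ℤ := ⊥
  have _h0 : DiscreteTopology ℤ := ⟨rfl⟩
  have h1 := Nat.Partition.hasProd_genFun (fun _ _ => (1 : ℤ))
  have h2 := PowerSeries.WithPiTopology.hasProd_one_sub_X_pow ℤ
  have h3 := h1.mul h2
  have h4 : Nat.Partition.genFun (fun _ _ => (1 : ℤ)) = PZ := by
    ext n
    simp [PZ, Finsupp.prod]
  rw [h4] at h3
  refine h3.unique ?_
  convert! hasProd_one using 1
  ext1 i
  have hs : Summable (fun j => (X ^ (i + 1) : ℤ⟦X⟧) ^ j) :=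
    summable_pow_of_constantCoeff_eq_zero (by simp)
  have h5 : (1 : ℤ⟦X⟧) + ∑' j, (1 : ℤ) • X ^ ((i + 1) * (j + 1)) = ∑' j, (X ^ (i + 1) : ℤ⟦X⟧) ^ j := by
    rw [hs.tsum_eq_zero_add, pow_zero]
    congr 2; ext1 j; rw [one_smul, pow_mul]
  refine (congrArg (· * (1 - X ^ (i + 1) : ℤ⟦X⟧)) h5).trans ?_
  exact tsum_pow_mul_one_sub_of_constantCoeff_eq_zero (by simp)

/-- generating function of 5-multipartitions -/
noncomputable def GZ : ℤ⟦X⟧ := PowerSeries.mk fun n => (multipartition 5 n : ℤ)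

lemma GZ_eq : GZ = PZ ^ 5 := by
  ext n
  have h := PowerSeries.coeff_prod (fun _ : Fin 5 => PZ) n Finset.univ
  rw [Finset.prod_const, Finset.card_univ, Fintype.card_fin] at h
  rw [h, GZ, PowerSeries.coeff_mk, multipartition]
  push_cast
  refine Finset.sum_bij (fun c _ => Finsupp.equivFunOnFinite.symm c) ?_ ?_ ?_ ?_
  · intro c hc
    rw [Finset.Nat.mem_antidiagonalTuple] at hc
    simp [Finset.mem_finsuppAntidiag, hc]
  · intro a _ b _ h; exact Finsupp.equivFunOnFinite.symm.injective h
  · intro l hl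
    refine ⟨l, ?_, by ext; simp⟩
    rw [Finset.Nat.mem_antidiagonalTuple]
    simpa [Finset.mem_finsuppAntidiag] using hl
  · intro c _
    simp [PZ]

lemma GZ_mul : GZ * pentagonalSeries ℤ ^ 5 = 1 := by
  rw [GZ_eq, ← mul_pow, PZ_mul, one_pow]

end B
end MP5

namespace MP5
open PowerSeries
section Jac
open Filter

def Tn (j : ℕ) : ℕ := ∑ i ∈ Finset.range (j + 1), i

lemma Tn_succ (j : ℕ) : Tn (j + 1) = Tn j + (j + 1) := by
  rw [Tn, Finset.sum_range_succ]; rfl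

lemma Tn_two (j : ℕ) : 2 * Tn j = j * (j + 1) := by
  induction j with
  | zero => rfl
  | succ j ih => rw [Tn_succ, mul_add, ih]; ring

lemma le_Tn (j : ℕ) : j ≤ Tn j := by
  cases j with
  | zero => simp
  | succ j => rw [Tn_succ]; omega

/-- Gaussian binomials `[2n+1 choose n-j]` -/
noncomputable def gb : ℕ → ℕ → ℤ⟦X⟧
  | 0, 0 => 1
  | 0, _ + 1 => 0
  | n + 1, 0 => (X ^ (n + 1) + 1 + X ^ (2 * n + 2)) * gb n 0 + X ^ (n + 2) * gb n 1
  | n + 1, j + 1 => X ^ (n - j) * gb n j + (1 + X ^ (2 * n + 2)) * gb n (j + 1) +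
      X ^ (n + 3 + j) * gb n (j + 2)

lemma gb_zero (n j : ℕ) (h : n < j) : gb n j = 0 := by
  induction n generalizing j with
  | zero => obtain ⟨j, rfl⟩ := Nat.exists_eq_succ_of_ne_zero h.ne'; simp [gb]
  | succ n ih =>
    obtain ⟨j, rfl⟩ := Nat.exists_eq_succ_of_ne_zero (by omega : j ≠ 0)
    simp only [Nat.succ_eq_add_one, gb]
    rw [ih j (by omega), ih (j + 1) (by omega), ih (j + 2) (by omega)]; simp

lemma Pf_succ (R : Type*) [CommRing R] (N : ℕ) : Pf R (N + 1) = Pf R N * (1 - X ^ (N + 1)) := by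
  simp [Pf, Finset.prod_range_succ]

lemma gb_prod (n j i : ℕ) (h : n = j + i) :
    gb n j * Pf ℤ i * Pf ℤ (2 * j + i + 1) = Pf ℤ (2 * n + 1) := by
  induction n generalizing i j with
  | zero =>
    obtain ⟨rfl, rfl⟩ : j = 0 ∧ i = 0 := by omega
    simp [gb, Pf]
  | succ n ih =>
    have e0 : Pf ℤ (2 * (n + 1) + 1) = Pf ℤ (2 * n + 1) * (1 - X ^ (2 * n + 2)) * (1 - X ^ (2 * n + 3)) := by
      rw [show 2 * (n + 1) + 1 = (2 * n + 1) + 1 + 1 by ring, Pf_succ, Pf_succ]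
    rw [e0]
    have t2 : (gb n j * Pf ℤ i * Pf ℤ (2 * j + i + 1)) = Pf ℤ (2 * n + 1) * (1 - X ^ i) * (1 - X ^ (2 * j + i + 1)) := by
      rcases i with _ | i
      · rw [gb_zero n j (by omega)]; simp
      · rw [← ih j i (by omega), Pf_succ, show 2 * j + (i + 1) + 1 = (2 * j + i + 1) + 1 by ring, Pf_succ]
        ring
    have t3 : (X * (gb n (j+1) * Pf ℤ i * Pf ℤ (2 * j + i + 1))) = Pf ℤ (2 * n + 1) * (X - X ^ i) * (1 - X ^ i) := by
      rcases i with _ | _ | i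
      · rw [gb_zero n (j + 1) (by omega)]; simp
      · rw [gb_zero n (j + 1) (by omega)]; simp
      · rw [← ih (j + 1) i (by omega), Pf_succ, Pf_succ, show 2 * j + (i + 1 + 1) + 1 = (2 * (j + 1) + i + 1) by ring]
        ring
    rcases j with _ | j
    · obtain rfl : i = n + 1 := by omega
      simp only [gb]
      linear_combination (X ^ (n + 1) + 1 + X ^ (2 * n + 2)) * t2 + X ^ (n + 1) * t3
    · have t1 : (gb n j * Pf ℤ i * Pf ℤ (2 * (j + 1) + i + 1)) = Pf ℤ (2 * n + 1) * (1 - X ^ (2 * j + i + 2)) * (1 - X ^ (2 * j + i + 3)) := by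
        rw [← ih j i (by omega), show 2 * (j + 1) + i + 1 = (2 * j + i + 1) + 1 + 1 by ring, Pf_succ, Pf_succ]
        ring
      obtain rfl : n = j + i := by omega
      simp only [gb]
      rw [Nat.add_sub_cancel_left]
      linear_combination (X ^ i) * t1 + (1 + X ^ (2 * (j + i) + 2)) * t2 + X ^ (2 * j + i + 2) * t3

noncomputable def cj (j : ℕ) : ℤ⟦X⟧ := (-1) ^ j * (2 * (j : ℤ⟦X⟧) + 1) * X ^ Tn j

lemma sum_rec (n M : ℕ) : ∑ j ∈ Finset.range (M + 1), cj j * gb (n + 1) j =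
    (1 - X ^ (n + 1)) ^ 2 * ∑ j ∈ Finset.range (M + 1), cj j * gb n j +
    cj M * X ^ (n + 2 + M) * gb n (M + 1) +
    (-1) ^ M * (2 * (M : ℤ⟦X⟧) + 3) * X ^ (Tn M + n + 1) * gb n M := by
  induction M with
  | zero => simp [cj, gb, Tn]; ring
  | succ M ih =>
    rw [Finset.sum_range_succ, ih, Finset.sum_range_succ _ (M + 1)]
    have h : X ^ Tn (M + 1) * X ^ (n - M) * gb n M = X ^ (Tn M + n + 1) * gb n M := by
      by_cases hM : M ≤ n
      · rw [← pow_add, Tn_succ]; congr 2; omega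
      · rw [gb_zero n M (by omega)]; simp
    simp only [gb, cj]
    push_cast
    rw [Tn_succ] at h ⊢
    linear_combination (-1) ^ (M + 1) * (2 * ((M : ℤ⟦X⟧) + 1) + 1) * h

lemma sum_gb (n : ℕ) : ∀ M, n ≤ M → ∑ j ∈ Finset.range (M + 1), cj j * gb n j = Pf ℤ n ^ 2 := by
  induction n with
  | zero =>
    intro M _
    rw [Finset.sum_eq_single 0]
    · simp [cj, gb, Pf, Tn]
    · intro j _ hj; rw [gb_zero 0 j (by omega)]; simp
    · simp
  | succ n ih =>
    intro M hM
    rw [sum_rec, gb_zero n (M + 1) (by omega), gb_zero n M (by omega), ih M (by omega), Pf_succ]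
    ring

noncomputable def JZ : ℤ⟦X⟧ := PowerSeries.mk fun a =>
  ∑ j ∈ Finset.range (a + 1), if Tn j = a then (-1 : ℤ) ^ j * (2 * j + 1) else 0

lemma coeff_cj (j m : ℕ) : (cj j).coeff m = if Tn j = m then (-1 : ℤ) ^ j * (2 * j + 1) else 0 := by
  have : cj j = C ((-1 : ℤ) ^ j * (2 * j + 1)) * X ^ Tn j := by simp [cj]
  rw [this, PowerSeries.coeff_C_mul, PowerSeries.coeff_X_pow]
  simp [eq_comm]

lemma jacobi : pentagonalSeries ℤ ^ 3 = JZ := by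
  ext m
  obtain ⟨N, hN⟩ := eventually_atTop.mp (evP ℤ m)
  set I : Ideal ℤ⟦X⟧ := Ideal.span {X ^ (m + 1)}
  have hmk : ∀ A B : ℤ⟦X⟧, Ideal.Quotient.mk I A = Ideal.Quotient.mk I B ↔ ∀ k ≤ m, A.coeff k = B.coeff k := by
    intro A B
    rw [Ideal.Quotient.eq, Ideal.mem_span_singleton, PowerSeries.X_pow_dvd_iff]
    simp only [map_sub, sub_eq_zero, Nat.lt_succ_iff]
  refine (hmk _ _).mp ?_ m le_rfl
  set φ := Ideal.Quotient.mk I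
  have hP : ∀ n ≥ N, φ (Pf ℤ n) = φ (pentagonalSeries ℤ) := fun n hn => (hmk _ _).mpr (hN n hn)
  have hE : φ PZ * φ (pentagonalSeries ℤ) = 1 := by rw [← map_mul, PZ_mul, map_one]
  have hb : ∀ j ≤ m, φ (gb (N + m) j) * φ (pentagonalSeries ℤ) = 1 := by
    intro j hj
    have := congrArg φ (gb_prod (N + m) j (N + m - j) (by omega))
    rw [map_mul, map_mul, hP _ (by omega), hP _ (by omega), hP _ (by omega)] at this
    linear_combination φ PZ * this + (1 - φ (gb (N + m) j) * φ (pentagonalSeries ℤ)) * hE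
  have hc : ∀ j, m < j → φ (cj j) = 0 := by
    intro j hj
    rw [← map_zero φ]
    refine (hmk _ _).mpr fun k hk => ?_
    rw [coeff_cj, if_neg, map_zero]
    have := le_Tn j
    omega
  have hS := congrArg (fun A => φ (A * pentagonalSeries ℤ)) (sum_gb (N + m) (N + m) le_rfl)
  simp only [Finset.sum_mul, map_sum, map_mul, map_pow] at hS
  rw [hP _ (by omega)] at hS
  have hJ : φ JZ = ∑ j ∈ Finset.range (N + m + 1), φ (cj j) := by
    rw [← map_sum]
    refine (hmk _ _).mpr fun k hk => ?_
    rw [map_sum, JZ, PowerSeries.coeff_mk]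
    simp only [coeff_cj]
    refine Finset.sum_subset (fun x => by simp; omega) fun j _ hj => if_neg ?_
    have := le_Tn j
    simp at hj
    omega
  rw [hJ, map_pow, pow_succ, ← hS]
  refine Finset.sum_congr rfl fun j _ => ?_
  by_cases hj : j ≤ m
  · rw [mul_assoc, hb j hj, mul_one]
  · rw [hc j (by omega)]; simp

lemma coeff_E6 (m : ℕ) : (121 : ℤ) ∣ (pentagonalSeries ℤ ^ 6).coeff (11 * m + 8) := by
  rw [show 6 = 3 * 2 by rfl, pow_mul, jacobi, pow_two, PowerSeries.coeff_mul]
  refine Finset.dvd_sum fun x hx => ?_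
  have hx := Finset.HasAntidiagonal.mem_antidiagonal.mp hx
  simp only [JZ, PowerSeries.coeff_mk, Finset.sum_mul_sum]
  refine Finset.dvd_sum fun i _ => Finset.dvd_sum fun j _ => ?_
  split_ifs with h1 h2
  · have e1 := Tn_two i
    have e2 := Tn_two j
    have key : ((2 * i + 1 : ℕ) : ZMod 11) ^ 2 + ((2 * j + 1 : ℕ) : ZMod 11) ^ 2 = 0 := by
      have : (2 * i + 1) ^ 2 + (2 * j + 1) ^ 2 = 11 * (8 * m + 6) := by
        nlinarith
      have := congrArg (Nat.cast (R := ZMod 11)) this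
      rw [Nat.cast_mul (11 : ℕ), show ((11 : ℕ) : ZMod 11) = 0 by rfl, zero_mul] at this
      exact_mod_cast this
    have dec : ∀ x y : ZMod 11, x ^ 2 + y ^ 2 = 0 → x = 0 ∧ y = 0 := by decide
    obtain ⟨a, b⟩ := dec _ _ key
    rw [ZMod.natCast_eq_zero_iff] at a b
    have a' : (11 : ℤ) ∣ 2 * i + 1 := by exact_mod_cast a
    have b' : (11 : ℤ) ∣ 2 * j + 1 := by exact_mod_cast b
    exact mul_dvd_mul (a := (11 : ℤ)) (c := 11) (a'.mul_left _) (b'.mul_left _)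
  all_goals simp

end Jac
end MP5

namespace MP5
open PowerSeries
section D

abbrev F := ZMod 11
instance : Fact (Nat.Prime 11) := ⟨by norm_num⟩
noncomputable abbrev EF : F⟦X⟧ := pentagonalSeries F
noncomputable abbrev red : ℤ⟦X⟧ →+* F⟦X⟧ := PowerSeries.map (Int.castRingHom F)
noncomputable def QF : F⟦X⟧ := red (eis 1 240 3)
noncomputable def RF : F⟦X⟧ := red (eis 1 (-504) 5)
noncomputable def PF : F⟦X⟧ := 1 - 2 * S1 F
noncomputable def tF : F⟦X⟧ := QF ^ 5
noncomputable def rF : F⟦X⟧ := RF ^ 2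

lemma eleven : (11 : F⟦X⟧) = 0 := by
  have : (11 : F⟦X⟧) = C (11 : F) := (map_ofNat C 11).symm
  rw [this, show (11 : F) = 0 by rfl, map_zero]

lemma QR : QF * RF = 1 := by
  rw [QF, RF, ← map_mul, e4e6]
  ext n
  simp only [PowerSeries.coeff_map, eis, PowerSeries.coeff_mk, PowerSeries.coeff_one]
  split_ifs
  · simp
  · rw [map_mul, show (Int.castRingHom F) (-264) = 0 by rfl, zero_mul]

lemma QRdisc : QF ^ 3 - RF ^ 2 = X * EF ^ 24 := by
  have := congrArg red eDisc
  simp only [map_sub, map_pow, map_mul, PowerSeries.map_X, map_pent, PowerSeries.map_C] at this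
  rw [QF, RF, this, show (Int.castRingHom F) 1728 = 1 by rfl, map_one, one_mul]

lemma sigma_eleven (n : ℕ) : ((ArithmeticFunction.sigma 11 n : ℕ) : F) = (ArithmeticFunction.sigma 1 n : ℕ) := by
  rw [ArithmeticFunction.sigma_apply, ArithmeticFunction.sigma_apply]
  push_cast
  refine Finset.sum_congr rfl fun d _ => ?_
  rw [pow_one]
  exact ZMod.pow_card (p := 11) (d : F)

lemma QRP : QF ^ 3 + 8 * RF ^ 2 = 9 * PF := by
  have := congrArg red e12
  simp only [map_add, map_pow, map_mul, PowerSeries.map_C] at this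
  rw [show (Int.castRingHom F) 441 = 1 by rfl, show (Int.castRingHom F) 250 = 8 by rfl, map_one, one_mul] at this
  have h8 : (C (8 : F)) = 8 := map_ofNat C 8
  rw [h8] at this
  rw [QF, RF, this]
  have h9 : (9 : F⟦X⟧) * PF = C (9 : F) + C (4 : F) * S1 F := by
    rw [PF, show (C (9 : F)) = 9 from map_ofNat C 9, show (C (4 : F)) = 4 from map_ofNat C 4]
    linear_combination -2 * S1 F * eleven
  rw [h9]
  ext n
  simp only [PowerSeries.coeff_map, eis, PowerSeries.coeff_mk, map_add, PowerSeries.coeff_C, PowerSeries.coeff_C_mul, S1]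
  split_ifs with h
  · subst h; simp; rfl
  · rw [map_mul, show (Int.castRingHom F) 65520 = 4 by rfl, ← sigma_eleven]; simp

lemma th_pow {R : Type*} [CommRing R] (A : R⟦X⟧) (n : ℕ) : th R (A ^ n) = n * A ^ (n - 1) * th R A := by
  rw [Derivation.leibniz_pow]; simp [mul_assoc]

lemma th_mul {R : Type*} [CommRing R] (A B : R⟦X⟧) : th R (A * B) = A * th R B + B * th R A := by
  rw [Derivation.leibniz]; rfl

lemma th_X {R : Type*} [CommRing R] : th R X = X := by simp [th]

lemma th_disc : th F (X * EF ^ 24) = PF * (X * EF ^ 24) := by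
  rw [th_mul, th_pow, th_X, th_E, PF]
  norm_num
  linear_combination -2 * X * EF ^ 24 * S1 F * eleven

lemma PF_ne : PF ≠ 0 := by
  intro h
  have := congrArg (PowerSeries.coeff 0) h
  simp [PF, S1] at this

lemma th_Q : th F QF = -2 * QF * (QF ^ 3 - RF ^ 2) := by
  have h1 := th_disc
  rw [← QRdisc, map_sub, th_pow, th_pow] at h1
  have h2 := congrArg (th F) QR
  rw [th_mul, Derivation.map_one_eq_zero] at h2
  have hP := QRP
  norm_num at h1
  refine mul_left_cancel₀ PF_ne ?_
  set a := th F QF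
  set b := th F RF
  -- h1 : 3 Q^2 a - 2 R b = P (Q^3-R^2);  h2 : Q b + R a = 0
  have h3 : (3 * QF ^ 3 + 2 * RF ^ 2) * a = QF * PF * (QF ^ 3 - RF ^ 2) := by
    linear_combination QF * h1 + 2 * RF * h2
  have h4 : 27 * PF * a = QF * PF * (QF ^ 3 - RF ^ 2) := by
    linear_combination h3 - 3 * a * hP + 2 * RF ^ 2 * a * eleven
  linear_combination 9 * h4 - 22 * PF * a * eleven + PF * QF * (QF ^ 3 - RF ^ 2) * eleven

lemma rt : rF * tF = QF ^ 3 := by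
  rw [rF, tF]; linear_combination QF ^ 3 * (QF * RF + 1) * QR

lemma disc_rt : X * EF ^ 24 = rF * (tF - 1) := by
  rw [mul_sub, rt, ← QRdisc, rF, mul_one]

lemma P_rt : PF = rF * (5 * tF + 7) := by
  have h1 := rt
  have h2 := QRP
  rw [rF] at *
  linear_combination -5 * h2 - 5 * h1 + (3 * RF ^ 2 - 4 * PF) * eleven

lemma th_t : th F tF = rF * tF * (tF - 1) := by
  have h1 := rt
  rw [tF, th_pow, th_Q]
  rw [tF] at h1
  rw [rF] at *
  norm_num
  linear_combination - (QF ^ 5) * h1 - (QF ^ 5 * (QF ^ 3 - RF ^ 2)) * eleven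

lemma th_r : th F rF = 4 * rF ^ 2 * (tF - 1) := by
  have h2 := congrArg (th F) QR
  rw [th_mul, Derivation.map_one_eq_zero, th_Q] at h2
  have h1 := rt
  have h3 := QR
  have h4 : th F RF = 2 * RF * (QF ^ 3 - RF ^ 2) := by
    linear_combination RF * h2 - (th F RF - 2 * RF * (QF ^ 3 - RF ^ 2)) * h3
  rw [rF, th_pow, h4]
  rw [rF] at h1
  norm_num
  linear_combination - 4 * RF ^ 2 * h1

lemma rt_one : rF ^ 5 * tF ^ 2 = 1 := by
  rw [rF, tF, ← pow_mul, ← pow_mul, ← mul_pow, mul_comm, QR, one_pow]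

lemma Q_rt : QF = rF ^ 2 * tF := by
  rw [rF, tF]
  linear_combination - QF * ((QF * RF) ^ 3 + (QF * RF) ^ 2 + QF * RF + 1) * QR

end D
end MP5

namespace MP5
open PowerSeries
section D2

noncomputable abbrev ex (R : Type*) [CommRing R] : R⟦X⟧ →ₐ[R] R⟦X⟧ := PowerSeries.expand 11 (by norm_num)

/-- coefficients at `11 m + 8` -/
noncomputable def U {R : Type*} [CommRing R] (A : R⟦X⟧) : R⟦X⟧ := PowerSeries.mk fun m => A.coeff (11 * m + 8)

lemma coeff_U {R : Type*} [CommRing R] (A : R⟦X⟧) (m : ℕ) : (U A).coeff m = A.coeff (11 * m + 8) := by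
  simp [U]

lemma U_add {R : Type*} [CommRing R] (A B : R⟦X⟧) : U (A + B) = U A + U B := by
  ext; simp [coeff_U]
lemma U_sub {R : Type*} [CommRing R] (A B : R⟦X⟧) : U (A - B) = U A - U B := by
  ext; simp [coeff_U]
lemma U_neg {R : Type*} [CommRing R] (A : R⟦X⟧) : U (-A) = - U A := by
  ext; simp [coeff_U]
lemma U_C {R : Type*} [CommRing R] (c : R) (A : R⟦X⟧) : U (C c * A) = C c * U A := by
  ext; simp [coeff_U, PowerSeries.coeff_C_mul]

lemma U_red (A : ℤ⟦X⟧) : red (U A) = U (red A) := by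
  ext; simp [coeff_U]

lemma U_mul_ex {R : Type*} [CommRing R] (A B : R⟦X⟧) : U (A * ex R B) = U A * B := by
  ext m
  rw [coeff_U, PowerSeries.coeff_mul, PowerSeries.coeff_mul]
  symm
  refine Finset.sum_of_injOn (fun x => (11 * x.1 + 8, 11 * x.2)) ?_ ?_ ?_ ?_
  · intro a _ b _ h
    simp at h
    ext <;> omega
  · intro a ha
    have := Finset.HasAntidiagonal.mem_antidiagonal.mp ha
    exact Finset.HasAntidiagonal.mem_antidiagonal.mpr (by simp; omega)
  · intro x hx hx'
    have hx := Finset.HasAntidiagonal.mem_antidiagonal.mp hx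
    rw [PowerSeries.coeff_expand_of_not_dvd, mul_zero]
    rintro ⟨l, hl⟩
    apply hx'
    refine ⟨(m - l, l), ?_, ?_⟩
    · exact Finset.HasAntidiagonal.mem_antidiagonal.mpr (by simp; omega)
    · ext <;> simp <;> omega
  · intro x _
    rw [coeff_U, PowerSeries.coeff_expand_mul]

lemma ex_pow (A : F⟦X⟧) : ex F A = A ^ 11 := by
  have h : (MvPowerSeries.expand 11 (by norm_num) A).map (frobenius F 11) = A ^ 11 :=
    MvPowerSeries.map_frobenius_expand 11 (by norm_num)
  rw [ZMod.frobenius_zmod, MvPowerSeries.map_id] at h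
  exact h

lemma th_ex {R : Type*} [CommRing R] (A : R⟦X⟧) : th R (ex R A) = 11 * ex R (th R A) := by
  ext n
  have : (11 : R⟦X⟧) = C (11 : R) := (map_ofNat C 11).symm
  rw [this, PowerSeries.coeff_C_mul, coeff_th, PowerSeries.coeff_expand, PowerSeries.coeff_expand]
  split_ifs with h
  · obtain ⟨k, rfl⟩ := h
    rw [Nat.mul_div_cancel_left _ (by norm_num), coeff_th]
    push_cast; ring
  · simp

/-- `θ + 3` -/
noncomputable def DD (A : F⟦X⟧) : F⟦X⟧ := th F A + 3 * A

lemma coeff_DD (A : F⟦X⟧) (n : ℕ) : (DD A).coeff n = ((n : F) + 3) * A.coeff n := by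
  rw [DD, map_add, coeff_th, show (3 : F⟦X⟧) = C (3 : F) from (map_ofNat C 3).symm, PowerSeries.coeff_C_mul]
  ring

lemma coeff_DD_iter (A : F⟦X⟧) (n m : ℕ) : (DD^[m] A).coeff n = ((n : F) + 3) ^ m * A.coeff n := by
  induction m with
  | zero => simp
  | succ m ih => rw [Function.iterate_succ_apply', coeff_DD, ih]; ring

lemma coeff_th_iter (A : F⟦X⟧) (n m : ℕ) : ((th F)^[m] A).coeff n = (n : F) ^ m * A.coeff n := by
  induction m with
  | zero => simp
  | succ m ih => rw [Function.iterate_succ_apply', coeff_th, ih]; ring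

lemma pow_ten (x : F) : x ^ 10 = if x = 0 then 0 else 1 := by
  revert x; decide

lemma proj_DD (A : F⟦X⟧) : A - DD^[10] A = X ^ 8 * ex F (U A) := by
  ext n
  rw [map_sub, coeff_DD_iter, pow_ten, PowerSeries.coeff_X_pow_mul', PowerSeries.coeff_expand]
  have h : ((n : F) + 3 = 0) ↔ 11 ∣ n + 3 := by
    rw [← ZMod.natCast_eq_zero_iff]; push_cast; rfl
  by_cases hn : 11 ∣ n + 3
  · rw [if_pos (h.mpr hn), if_pos (by omega), if_pos (by omega), coeff_U,
      show 11 * ((n - 8) / 11) + 8 = n by omega]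
    simp
  · rw [if_neg (fun e => hn (h.mp e))]
    split_ifs
    · omega
    · simp
    · simp

lemma proj_th (A : F⟦X⟧) : A - (th F)^[10] A = ex F (PowerSeries.mk fun n => A.coeff (11 * n)) := by
  ext n
  rw [map_sub, coeff_th_iter, pow_ten, PowerSeries.coeff_expand]
  have h : ((n : F) = 0) ↔ 11 ∣ n := ZMod.natCast_eq_zero_iff _ _
  by_cases hn : 11 ∣ n
  · rw [if_pos (h.mpr hn), if_pos hn, PowerSeries.coeff_mk, Nat.mul_div_cancel' hn]
    simp
  · rw [if_neg (fun e => hn (h.mp e)), if_neg hn]; simp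

/-- evaluation of a coefficient list -/
noncomputable def ev : List F → F⟦X⟧
  | [] => 0
  | a :: l => C a + tF * ev l

def stepL (k c : F) : ℕ → F → List F → List F
  | n, prev, [] => [(4 * k + n - 1 + 15 * c) * prev]
  | n, prev, a :: l => ((4 * k + n - 1 + 15 * c) * prev + (-4 * k - n + 21 * c) * a) ::
      stepL k c (n + 1) a l

lemma th_C (a : F) : th F (C a) = 0 := by simp [th]

lemma stepL_ev (k c : F) (l : List F) (n : ℕ) (prev : F) :
    rF * (4 * C k * (tF - 1) + C c * (15 * tF + 21)) * (tF ^ n * ev l) + th F (tF ^ n * ev l)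
      + rF * tF ^ n * C ((4 * k + n - 1 + 15 * c) * prev) = rF * tF ^ n * ev (stepL k c n prev l) := by
  induction l generalizing n prev with
  | nil => simp [ev, stepL]
  | cons a l ih =>
    have h := ih (n + 1) a
    simp only [ev, stepL]
    have ht : th F (tF ^ n * C a) = n * tF ^ n * C a * rF * (tF - 1) := by
      rw [th_mul, th_C, th_pow, th_t]
      rcases n with _ | n
      · simp
      · simp; ring
    have e : tF ^ n * (C a + tF * ev l) = tF ^ n * C a + tF ^ (n + 1) * ev l := by ring
    rw [e, map_add, ht]
    simp only [map_add, map_mul, map_sub, map_one, map_neg, map_natCast, map_ofNat, Nat.cast_add, Nat.cast_one] at h ⊢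
    linear_combination h

def itL (c : F) : ℕ → F → List F → List F
  | 0, _, l => l
  | m + 1, k, l => itL c m (k + 1) (stepL k c 0 0 l)

lemma th_rk (k : ℕ) (g : F⟦X⟧) : th F (rF ^ k * g) = rF ^ k * (th F g + rF * (4 * k * (tF - 1)) * g) := by
  rw [th_mul, th_pow, th_r]
  rcases k with _ | k
  · simp
  · simp; ring

lemma th_iter_ev (m k : ℕ) (l : List F) :
    (th F)^[m] (rF ^ k * ev l) = rF ^ (k + m) * ev (itL 0 m k l) := by
  induction m generalizing k l with
  | zero => simp [itL]
  | succ m ih =>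
    rw [Function.iterate_succ_apply, th_rk]
    have h := stepL_ev k 0 l 0 0
    simp only [pow_zero, one_mul, mul_zero, map_zero, zero_mul, add_zero, mul_one, map_natCast] at h
    have e : rF ^ k * (th F (ev l) + rF * (4 * k * (tF - 1)) * ev l) = rF ^ (k + 1) * ev (stepL k 0 0 0 l) := by
      linear_combination rF ^ k * h
    rw [e, ih, itL]
    push_cast
    congr 2
    ring

lemma th_E6 : th F (EF ^ 6) = EF ^ 6 * (3 * PF - 3) := by
  rw [th_pow, th_E, PF]; norm_num; ring

lemma DD_iter_ev (m k : ℕ) (l : List F) :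
    DD^[m] (EF ^ 6 * (rF ^ k * ev l)) = EF ^ 6 * (rF ^ (k + m) * ev (itL 1 m k l)) := by
  induction m generalizing k l with
  | zero => simp [itL]
  | succ m ih =>
    rw [Function.iterate_succ_apply, DD, th_mul, th_rk, th_E6, P_rt]
    have h := stepL_ev k 1 l 0 0
    simp only [pow_zero, one_mul, mul_zero, map_zero, map_one, add_zero, mul_one, map_natCast] at h
    have e : EF ^ 6 * (rF ^ k * (th F (ev l) + rF * (4 * k * (tF - 1)) * ev l)) +
        rF ^ k * ev l * (EF ^ 6 * (3 * (rF * (5 * tF + 7)) - 3)) + 3 * (EF ^ 6 * (rF ^ k * ev l))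
        = EF ^ 6 * (rF ^ (k + 1) * ev (stepL k 1 0 0 l)) := by
      linear_combination EF ^ 6 * rF ^ k * h
    rw [e, ih, itL]
    push_cast
    congr 3
    ring

def g1 : List F := [1, 5, 2, 4, 3, 6, 3, 2, 7, 10, 1]

lemma P_ev : PF = rF ^ 1 * ev [7, 5] := by
  rw [P_rt]; simp only [ev, map_ofNat]; ring

lemma th9P : (th F)^[9] PF = rF ^ 10 * ev g1 := by
  rw [P_ev, th_iter_ev]
  have : itL 0 9 ((1 : ℕ) : F) [7, 5] = g1 := by decide +kernel
  rw [this]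

lemma U_E6 : U (EF ^ 6) = 0 := by
  rw [EF, ← map_pent (Int.castRingHom F), ← map_pow, ← U_red]
  ext m
  rw [PowerSeries.coeff_map, coeff_U]
  obtain ⟨w, hw⟩ := coeff_E6 m
  rw [hw, map_mul, show (Int.castRingHom F) 121 = 0 by rfl]; simp

lemma U_QE6 : U (EF ^ 6 * QF) = 0 := by
  have h := proj_DD (EF ^ 6 * QF)
  have e : QF = rF ^ 2 * ev [0, 1] := by
    rw [Q_rt]; simp only [ev, map_zero, map_one]; ring
  have e2 : DD^[10] (EF ^ 6 * QF) = EF ^ 6 * QF := by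
    rw [e, DD_iter_ev]
    have : itL 1 10 ((2 : ℕ) : F) [0, 1] = [0, 0, 0, 0, 0, 1, 0, 0, 0, 0, 0, 0] := by decide +kernel
    rw [this]
    simp only [ev, map_zero, map_one]
    linear_combination EF ^ 6 * rF ^ 2 * tF * (rF ^ 5 * tF ^ 2 + 1) * rt_one
  rw [e2, sub_self, ex_pow] at h
  have := h.symm
  simpa [PowerSeries.X_ne_zero] using this

lemma U_th9P : U (EF ^ 6 * (C (-5) * (th F)^[9] PF)) = QF * EF ^ 18 := by
  have h := proj_DD (EF ^ 6 * (th F)^[9] PF)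
  have e2 : itL 1 10 ((10 : ℕ) : F) g1 = [0, 0, 0, 0, 1, 5, 2, 2, 8, 5, 5, 5, 9, 9, 6, 9, 0, 0, 0, 0, 0] := by
    decide +kernel
  rw [th9P, DD_iter_ev, e2] at h
  have e3 : EF ^ 6 * (C (-5) * (th F)^[9] PF) = C (-5) * (EF ^ 6 * (rF ^ 10 * ev g1)) := by rw [th9P]; ring
  rw [e3, U_C]
  have c5 : (C (-5 : F)) = (-5 : F⟦X⟧) := by rw [map_neg, map_ofNat]
  rw [c5]
  have hfin : X ^ 8 * ((-5) * U (EF ^ 6 * (rF ^ 10 * ev g1))) ^ 11 = X ^ 8 * (QF * EF ^ 18) ^ 11 := by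
    have k1 : X ^ 8 * (QF * EF ^ 18) ^ 11 = EF ^ 6 * QF ^ 11 * (X * EF ^ 24) ^ 8 := by ring
    have k2 : QF ^ 11 = rF ^ 2 * tF ^ 3 := by
      have : QF ^ 11 = tF ^ 2 * QF := by rw [tF]; ring
      rw [this]; conv_lhs => rw [Q_rt]
      ring
    have k3 : (-5 : F⟦X⟧) ^ 11 = -5 := by
      rw [← c5, ← map_pow]; rfl
    rw [k1, k2, disc_rt, mul_pow, k3, ← ex_pow]
    rw [show (X : F⟦X⟧) ^ 8 * (-5 * ex F (U (EF ^ 6 * (rF ^ 10 * ev g1)))) = 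
      -5 * (X ^ 8 * ex F (U (EF ^ 6 * (rF ^ 10 * ev g1)))) by ring, ← h]
    have h1 : rF ^ 10 * tF ^ 4 = 1 := by
      linear_combination (rF ^ 5 * tF ^ 2 + 1) * rt_one
    simp only [g1, ev, map_zero, map_one, map_ofNat]
    generalize rF = r at *
    generalize tF = t at *
    linear_combination EF ^ 6 * (r ^ 10 * (5 * (1 + 5 * t + 2 * t ^ 2 + 4 * t ^ 3 + 3 * t ^ 4 +
      6 * t ^ 5 + 3 * t ^ 6 + 2 * t ^ 7 + 7 * t ^ 8 + 10 * t ^ 9 + t ^ 10) + t ^ 3 * (t - 1) ^ 8)) * h1 +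
      EF ^ 6 * r ^ 20 * (-t ^ 7 + 3 * t ^ 8 - 3 * t ^ 9 + 6 * t ^ 10 - 5 * t ^ 11 + 6 * t ^ 12
        - 3 * t ^ 13 + 3 * t ^ 14 + 4 * t ^ 15) * eleven
  have := mul_left_cancel₀ (pow_ne_zero 8 PowerSeries.X_ne_zero) hfin
  rw [← ex_pow, ← ex_pow] at this
  ext m
  have h5 := congrArg (PowerSeries.coeff (11 * m)) this
  rwa [PowerSeries.coeff_expand_mul, PowerSeries.coeff_expand_mul] at h5

lemma red_dvd (A : ℤ⟦X⟧) (h : red A = 0) : ∃ B, A = 11 * B := by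
  have h' : ∀ n, (11 : ℤ) ∣ A.coeff n := by
    intro n
    have := congrArg (PowerSeries.coeff n) h
    rw [PowerSeries.coeff_map, map_zero] at this
    exact (ZMod.intCast_zmod_eq_zero_iff_dvd _ 11).mp this
  choose b hb using h'
  refine ⟨PowerSeries.mk b, ?_⟩
  ext n
  rw [show (11 : ℤ⟦X⟧) = C 11 from (map_ofNat C 11).symm, PowerSeries.coeff_C_mul, PowerSeries.coeff_mk, hb]

lemma red_th (A : ℤ⟦X⟧) : red (th ℤ A) = th F (red A) := by
  ext n; simp [coeff_th]

lemma red_E : red (pentagonalSeries ℤ) = EF := map_pent _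

lemma exists_f : ∃ f : ℤ⟦X⟧, ex ℤ (pentagonalSeries ℤ) = pentagonalSeries ℤ ^ 11 * (1 - 11 * f) ∧
    th F (red f) = ex F (S1 F) - S1 F := by
  obtain ⟨w, hw⟩ := red_dvd (pentagonalSeries ℤ ^ 11 - ex ℤ (pentagonalSeries ℤ)) (by
    rw [map_sub, PowerSeries.map_expand, map_pow, red_E, ex_pow, sub_self])
  have hP : PZ ^ 11 * pentagonalSeries ℤ ^ 11 = 1 := by rw [← mul_pow, PZ_mul, one_pow]
  have h1 : ex ℤ (pentagonalSeries ℤ) = pentagonalSeries ℤ ^ 11 * (1 - 11 * (PZ ^ 11 * w)) := by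
    linear_combination 11 * w * hP - hw
  refine ⟨PZ ^ 11 * w, h1, ?_⟩
  generalize PZ ^ 11 * w = f at h1
  have h2 := congrArg (th ℤ) h1
  rw [th_ex, th_E, th_mul, th_pow, th_E, map_neg, map_mul, h1] at h2
  have h11 : th ℤ (1 - 11 * f) = - 11 * th ℤ f := by
    have hc : th ℤ (11 : ℤ⟦X⟧) = 0 := by
      rw [show (11 : ℤ⟦X⟧) = C 11 from (map_ofNat C 11).symm]
      ext n; rw [coeff_th, PowerSeries.coeff_C]; split_ifs with h <;> simp [h]
    rw [map_sub, th_mul, hc, Derivation.map_one_eq_zero]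
    ring
  rw [h11] at h2
  have hne : (11 * pentagonalSeries ℤ ^ 11 : ℤ⟦X⟧) ≠ 0 := by
    refine mul_ne_zero ?_ (right_ne_zero_of_mul_eq_one hP)
    intro h
    have := congrArg (PowerSeries.coeff 0) h
    rw [show (11 : ℤ⟦X⟧) = C 11 from (map_ofNat C 11).symm, PowerSeries.coeff_C] at this
    simp at this
  have h3 : th ℤ f = (ex ℤ (S1 ℤ) - S1 ℤ) * (1 - 11 * f) := by
    refine mul_left_cancel₀ hne ?_
    norm_num at h2
    linear_combination h2
  have hS : red (S1 ℤ) = S1 F := by ext n; simp [S1]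
  rw [← red_th, h3]
  rw [map_mul, map_sub, map_sub, map_mul, PowerSeries.map_expand, hS, map_ofNat red 11, eleven, map_one]
  ring

lemma th_iter_add (A B : F⟦X⟧) (m : ℕ) : (th F)^[m] (A - B) = (th F)^[m] A - (th F)^[m] B := by
  ext n; simp only [map_sub, coeff_th_iter]; ring

lemma U_f (f : ℤ⟦X⟧) (hf : th F (red f) = ex F (S1 F) - S1 F) :
    U (EF ^ 6 * red f) = QF * EF ^ 18 := by
  have h0 : (th F)^[9] (ex F (S1 F)) = 0 := by
    ext n
    rw [coeff_th_iter, PowerSeries.coeff_expand]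
    split_ifs with h
    · rw [(ZMod.natCast_eq_zero_iff n 11).mpr h]; simp
    · simp
  have h1 : (th F)^[10] (red f) = - (th F)^[9] (S1 F) := by
    rw [Function.iterate_succ_apply, hf, th_iter_add, h0, zero_sub]
  have h2 : (th F)^[9] PF = -2 * (th F)^[9] (S1 F) := by
    ext n
    have : (-2 : F⟦X⟧) = C (-2) := by rw [map_neg, map_ofNat]
    rw [this, PowerSeries.coeff_C_mul, coeff_th_iter, coeff_th_iter, PF,
      show (2 : F⟦X⟧) = C 2 from (map_ofNat C 2).symm, map_sub, PowerSeries.coeff_C_mul, PowerSeries.coeff_one]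
    split_ifs with h
    · simp [h]
    · ring
  have h3 := proj_th (red f)
  have h4 : red f = (red f - (th F)^[10] (red f)) + C (-5) * (th F)^[9] PF := by
    rw [h1, h2, map_neg, map_ofNat]
    linear_combination - (th F)^[9] (S1 F) * eleven
  rw [h3] at h4
  rw [h4, mul_add, U_add, U_mul_ex, U_E6, U_th9P, zero_mul, zero_add]

lemma final (n : ℕ) : (121 : ℤ) ∣ GZ.coeff (121 * n + 96) := by
  obtain ⟨f, hf, hf2⟩ := exists_f
  set E := pentagonalSeries ℤ with hE
  have h1 : GZ * ex ℤ E = E ^ 6 - C 11 * (E ^ 6 * f) := by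
    rw [hf, map_ofNat]
    linear_combination E ^ 6 * (1 - 11 * f) * GZ_mul
  have h2 := congrArg U h1
  rw [U_mul_ex, U_sub, U_C] at h2
  obtain ⟨W, hW⟩ : ∃ W, U (E ^ 6) = 121 * W := by
    choose b hb using coeff_E6
    refine ⟨PowerSeries.mk b, ?_⟩
    ext m
    rw [show (121 : ℤ⟦X⟧) = C 121 from (map_ofNat C 121).symm, PowerSeries.coeff_C_mul,
      PowerSeries.coeff_mk, coeff_U, hb]
  set g := PZ * (11 * W - U (E ^ 6 * f)) with hg
  have h3 : U GZ = C 11 * g := by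
    rw [hW, map_ofNat] at h2
    rw [hg, map_ofNat]
    linear_combination PZ * h2 - U GZ * PZ_mul
  have h4 : red g * EF = - (QF * EF ^ 18) := by
    have : g * E = 11 * W - U (E ^ 6 * f) := by
      rw [hg]; linear_combination (11 * W - U (E ^ 6 * f)) * PZ_mul
    have := congrArg red this
    clear_value g
    rw [map_mul, red_E, map_sub, map_mul, map_ofNat red 11, eleven, U_red, map_mul, map_pow, red_E, U_f f hf2] at this
    rw [this]; ring
  have h5 : red g * ex F EF = - ((EF ^ 6 * QF) * ex F (EF ^ 2)) := by
    rw [map_pow, ex_pow]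
    linear_combination EF ^ 10 * h4
  have h6 := congrArg U h5
  rw [U_mul_ex, U_neg, U_mul_ex, U_QE6, zero_mul, neg_zero] at h6
  have hEF : EF ≠ 0 := by
    have := congrArg red PZ_mul
    rw [map_mul, red_E, map_one] at this
    exact right_ne_zero_of_mul_eq_one this
  have h7 : U (red g) = 0 := (mul_eq_zero.mp h6).resolve_right hEF
  have h8 := congrArg (PowerSeries.coeff n) h7
  rw [coeff_U, PowerSeries.coeff_map, map_zero] at h8
  have h9 : (11 : ℤ) ∣ g.coeff (11 * n + 8) := (ZMod.intCast_zmod_eq_zero_iff_dvd _ 11).mp h8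
  have h10 := congrArg (PowerSeries.coeff (11 * n + 8)) h3
  rw [coeff_U, PowerSeries.coeff_C_mul, show 11 * (11 * n + 8) + 8 = 121 * n + 96 by ring] at h10
  rw [h10]
  exact mul_dvd_mul (a := (11 : ℤ)) (c := 11) (dvd_refl _) h9

end D2
end MP5

theorem multipartition_five_onetwentyone (n : ℕ) : 121 ∣ multipartition 5 (121 * n + 96) := by
  have h := MP5.final n
  rw [MP5.GZ, PowerSeries.coeff_mk] at h
  exact_mod_cast h
end
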